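/- arXiv:2102.13059 — 6 statements merged into one kernel-verified Lean document; each statement's English description precedes it below -/
import Mathlib

section
/- Let d ≥ 1 be an integer and let A ⊆ [0,d] be a nonempty analytic set that contains its infimum and its supremum. Then there exists a compact set K ⊆ ℝ^d such that {\underline{dim}_B E : E is a microset of K} = A, where \underline{dim}_B denotes lower box dimension. -/
open Filter MeasureTheory Set
open scoped ENNReal

/-- `E` is a microset of the compact set `K ⊆ ℝ^d`. -/
def IsMicroset (d : ℕ) (K E : Set (Fin d → ℝ)) : Prop :=
  IsCompact E ∧ E ⊆ Set.univ.pi (fun _ => Set.Icc (0 : ℝ) 1) ∧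
  (E ∩ Set.univ.pi (fun _ => Set.Ioo (0 : ℝ) 1)).Nonempty ∧
  ∃ (lam : ℕ → ℝ) (u : ℕ → Fin d → ℝ), (∀ n, 1 ≤ lam n) ∧
    Filter.Tendsto
      (fun n => EMetric.hausdorffEdist
        (((fun z => lam n • z + u n) '' K) ∩ Set.univ.pi (fun _ => Set.Icc (0 : ℝ) 1)) E)
      Filter.atTop (nhds 0)

/-- `N_n(s)`: the minimal number of closed balls of radius `2^{-n}` needed to cover `s`. -/
noncomputable def coverNum {X : Type*} [MetricSpace X] (s : Set X) (n : ℕ) : ℕ :=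
  sInf {m : ℕ | ∃ t : Finset X, t.card = m ∧
    s ⊆ ⋃ y ∈ t, Metric.closedBall y ((2 : ℝ) ^ (-(n : ℤ)))}

/-- Lower box dimension: `liminf_n log N_n(s) / (n log 2)`. -/
noncomputable def lbDim {X : Type*} [MetricSpace X] (s : Set X) : ℝ≥0∞ :=
  Filter.liminf
    (fun n : ℕ => ENNReal.ofReal (Real.log (coverNum s n) / (n * Real.log 2)))
    Filter.atTop


/-- linear lower growth rate -/
def LD (u : ℕ → ℝ) (L : ℝ) : Prop :=
  (∀ ε > 0, ∀ᶠ m : ℕ in atTop, (L - ε) * m ≤ u m) ∧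
  (∀ ε > 0, ∃ᶠ m : ℕ in atTop, u m ≤ (L + ε) * m)

lemma LD.transfer {u v : ℕ → ℝ} {L : ℝ} (h : LD u L) (C : ℝ)
    (hC : ∀ᶠ m : ℕ in atTop, |u m - v m| ≤ C) : LD v L := by
  have key : ∀ ε > 0, ∀ᶠ m : ℕ in atTop, C ≤ ε * m := by
    intro ε hε
    have : Tendsto (fun m : ℕ => ε * (m : ℝ)) atTop atTop :=
      Tendsto.const_mul_atTop hε tendsto_natCast_atTop_atTop
    exact this.eventually_ge_atTop C
  constructor
  · intro ε hε
    filter_upwards [h.1 (ε/2) (by positivity), key (ε/2) (by positivity), hC] with m h1 h2 h3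
    have := (abs_le.1 h3)
    nlinarith
  · intro ε hε
    refine ((h.2 (ε/2) (by positivity)).and_eventually
      ((key (ε/2) (by positivity)).and hC)).mono ?_
    rintro m ⟨h1, h2, h3⟩
    have := (abs_le.1 h3)
    nlinarith

lemma LD.affine {u : ℕ → ℝ} {L : ℝ} (h : LD u L) (α β : ℝ) (hβ : 0 ≤ β) :
    LD (fun m => α * m + β * u m) (α + β * L) := by
  have hb : 0 < β + 1 := by linarith
  have e0 : ∀ ε > 0, β * (ε / (β + 1)) ≤ ε := by
    intro ε hε
    rw [mul_div_assoc', div_le_iff₀ hb]; nlinarith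
  constructor
  · intro ε hε
    filter_upwards [h.1 (ε/(β+1)) (by positivity)] with m h1
    have h2 := mul_le_mul_of_nonneg_left h1 hβ
    have h3 := e0 ε hε
    have h4 : (0:ℝ) ≤ m := Nat.cast_nonneg m
    have h5 := mul_le_mul_of_nonneg_right h3 h4
    nlinarith
  · intro ε hε
    refine (h.2 (ε/(β+1)) (by positivity)).mono ?_
    intro m h1
    have h2 := mul_le_mul_of_nonneg_left h1 hβ
    have h3 := e0 ε hε
    have h4 : (0:ℝ) ≤ m := Nat.cast_nonneg m
    have h5 := mul_le_mul_of_nonneg_right h3 h4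
    nlinarith

lemma LD.liminf {u : ℕ → ℝ} {L : ℝ} (h : LD u L) :
    Filter.liminf (fun m : ℕ => ENNReal.ofReal (u m / m)) atTop = ENNReal.ofReal L := by
  apply le_antisymm
  · have : Tendsto (fun ε : ℝ => ENNReal.ofReal (L + ε)) (nhdsWithin 0 (Ioi 0))
        (nhds (ENNReal.ofReal L)) := by
      have h1 : Continuous (fun ε : ℝ => ENNReal.ofReal (L + ε)) :=
        ENNReal.continuous_ofReal.comp (by fun_prop)
      have := h1.tendsto 0
      simp only [add_zero] at this
      exact this.mono_left nhdsWithin_le_nhds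
    refine ge_of_tendsto this ?_
    filter_upwards [self_mem_nhdsWithin] with ε hε
    refine Filter.liminf_le_of_frequently_le ?_
    refine ((h.2 ε hε).and_eventually (eventually_gt_atTop 0)).mono ?_
    rintro m ⟨h1, h2⟩
    apply ENNReal.ofReal_le_ofReal
    rw [div_le_iff₀ (by exact_mod_cast h2)]
    exact h1
  · have : Tendsto (fun ε : ℝ => ENNReal.ofReal (L - ε)) (nhdsWithin 0 (Ioi 0))
        (nhds (ENNReal.ofReal L)) := by
      have h1 : Continuous (fun ε : ℝ => ENNReal.ofReal (L - ε)) :=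
        ENNReal.continuous_ofReal.comp (by fun_prop)
      have := h1.tendsto 0
      simp only [sub_zero] at this
      exact this.mono_left nhdsWithin_le_nhds
    refine le_of_tendsto this ?_
    filter_upwards [self_mem_nhdsWithin] with ε hε
    refine Filter.le_liminf_of_le (by isBoundedDefault) ?_
    filter_upwards [h.1 ε hε, eventually_gt_atTop 0] with m h1 h2
    apply ENNReal.ofReal_le_ofReal
    rw [le_div_iff₀ (by exact_mod_cast h2)]
    exact h1

/-- number of `true` in the window `[p, p+m)` -/
def cnt (y : ℕ → Bool) (p m : ℕ) : ℕ := ∑ i ∈ Finset.range m, if y (p + i) then 1 else 0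

lemma cnt_succ (y : ℕ → Bool) (p m : ℕ) :
    cnt y p (m+1) = cnt y p m + if y (p + m) then 1 else 0 := by
  unfold cnt; rw [Finset.sum_range_succ]

lemma cnt_zero (y : ℕ → Bool) (p : ℕ) : cnt y p 0 = 0 := by simp [cnt]

lemma cnt_add (y : ℕ → Bool) (p r m : ℕ) : cnt y p (r + m) = cnt y p r + cnt y (p + r) m := by
  induction m with
  | zero => simp [cnt_zero]
  | succ m ih => rw [← add_assoc, cnt_succ, ih, cnt_succ, ← add_assoc p r m, add_assoc]

lemma cnt_le (y : ℕ → Bool) (p m : ℕ) : cnt y p m ≤ m := by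
  induction m with
  | zero => simp [cnt_zero]
  | succ m ih => rw [cnt_succ]; split_ifs <;> omega

lemma cnt_congr {y y' : ℕ → Bool} {p p' m : ℕ} (h : ∀ i < m, y (p + i) = y' (p' + i)) :
    cnt y p m = cnt y' p' m := by
  unfold cnt
  exact Finset.sum_congr rfl (fun i hi => by rw [h i (Finset.mem_range.1 hi)])

lemma cnt_eq_self {y : ℕ → Bool} {p m : ℕ} (h : ∀ i < m, y (p + i) = true) : cnt y p m = m := by
  rw [cnt_congr (y' := fun _ => true) (p' := 0) (by simpa using h)]; simp [cnt]

lemma cnt_eq_zero {y : ℕ → Bool} {p m : ℕ} (h : ∀ i < m, y (p + i) = false) : cnt y p m = 0 := by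
  rw [cnt_congr (y' := fun _ => false) (p' := 0) (by simpa using h)]; simp [cnt]

abbrev LDs (y : ℕ → Bool) (L : ℝ) : Prop := LD (fun m => (cnt y 0 m : ℝ)) L

lemma cnt_shift_abs (y y' : ℕ → Bool) (r : ℕ) (h : ∀ i, y' i = y (r + i)) (m : ℕ) :
    |(cnt y 0 m : ℝ) - cnt y' 0 m| ≤ r := by
  have h1 : cnt y' 0 m = cnt y r m := cnt_congr (by intro i _; simp [h])
  have h2 := cnt_add y 0 r m
  have h3 := cnt_add y 0 m r
  have h4 := cnt_le y 0 r
  have h5 := cnt_le y (0+m) r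
  rw [add_comm r m] at h2
  rw [zero_add] at h2
  rw [h1, abs_le]
  constructor
  · have : cnt y r m ≤ cnt y 0 m + r := by omega
    have : (cnt y r m : ℝ) ≤ cnt y 0 m + r := by exact_mod_cast this
    linarith
  · have : cnt y 0 m ≤ cnt y r m + r := by omega
    have : (cnt y 0 m : ℝ) ≤ cnt y r m + r := by exact_mod_cast this
    linarith

lemma LDs.shift {y y' : ℕ → Bool} {r : ℕ} {L : ℝ} (h : ∀ i, y' i = y (r + i)) (hy : LDs y L) :
    LDs y' L := LD.transfer hy r (Eventually.of_forall (cnt_shift_abs y y' r h))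

lemma LDs.unshift {y y' : ℕ → Bool} {r : ℕ} {L : ℝ} (h : ∀ i, y' i = y (r + i)) (hy : LDs y' L) :
    LDs y L := LD.transfer hy r (Eventually.of_forall (fun m => by
      rw [abs_sub_comm]; exact cnt_shift_abs y y' r h m))

lemma LDs.const_true {y : ℕ → Bool} (h : ∀ i, y i = true) : LDs y 1 := by
  have : ∀ m, cnt y 0 m = m := fun m => cnt_eq_self (by simp [h])
  constructor
  · intro ε hε
    refine Eventually.of_forall fun m => ?_
    simp only [this]; nlinarith [(Nat.cast_nonneg m : (0:ℝ) ≤ m)]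
  · intro ε hε
    refine (Eventually.of_forall fun m => ?_).frequently
    simp only [this]; nlinarith [(Nat.cast_nonneg m : (0:ℝ) ≤ m)]

lemma LDs.const_false {y : ℕ → Bool} (h : ∀ i, y i = false) : LDs y 0 := by
  have : ∀ m, cnt y 0 m = 0 := fun m => cnt_eq_zero (by simp [h])
  constructor
  · intro ε hε
    refine Eventually.of_forall fun m => ?_
    simp only [this]; push_cast; nlinarith [(Nat.cast_nonneg m : (0:ℝ) ≤ m)]
  · intro ε hε
    refine (Eventually.of_forall fun m => ?_).frequently
    simp only [this]; push_cast; nlinarith [(Nat.cast_nonneg m : (0:ℝ) ≤ m)]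

lemma exists_block {φ : ℕ → ℕ} (hφ : StrictMono φ) (i : ℕ) (h0 : φ 0 ≤ i) :
    ∃ k, φ k ≤ i ∧ i < φ (k+1) := by
  induction i, h0 using Nat.le_induction with
  | base => exact ⟨0, le_rfl, hφ (by omega)⟩
  | succ i hi ih =>
    obtain ⟨k, h1, h2⟩ := ih
    rcases Nat.lt_or_ge (i+1) (φ (k+1)) with h | h
    · exact ⟨k, by omega, h⟩
    · exact ⟨k+1, h, lt_of_le_of_lt (by omega) (hφ (Nat.lt_succ_self (k+1)))⟩

noncomputable def vv (f : (ℕ → ℕ) → ℝ) (z : ℕ → ℕ) (k : ℕ) : ℝ :=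
  max (f (fun i => if i < k then z i else 0)) (1 / ((k:ℝ) + 2))

noncomputable def bN (f : (ℕ → ℕ) → ℝ) (z : ℕ → ℕ) : ℕ → ℕ
  | 0 => 0
  | k+1 => ⌊(((k+2) * (bN f z k + 1) + z k : ℕ) : ℝ) / vv f z k⌋₊ + 1

noncomputable def bM (f : (ℕ → ℕ) → ℝ) (z : ℕ → ℕ) (k : ℕ) : ℕ :=
  (k+2) * (bN f z k + 1) + z k

lemma bN_succ (f : (ℕ → ℕ) → ℝ) (z : ℕ → ℕ) (k : ℕ) :
    bN f z (k+1) = ⌊(bM f z k : ℝ) / vv f z k⌋₊ + 1 := rfl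

open Classical in
noncomputable def xs (f : (ℕ → ℕ) → ℝ) (z : ℕ → ℕ) (i : ℕ) : Bool :=
  decide (∃ k, bN f z k ≤ i ∧ i < bM f z k)

section
variable {f : (ℕ → ℕ) → ℝ}

lemma vv_pos (f : (ℕ → ℕ) → ℝ) (z : ℕ → ℕ) (k : ℕ) : 0 < vv f z k :=
  lt_of_lt_of_le (by positivity) (le_max_right _ _)

lemma vv_le (hf : ∀ z, f z ≤ 1) (z : ℕ → ℕ) (k : ℕ) : vv f z k ≤ 1 := by
  refine max_le (hf _) ?_
  rw [div_le_one (by positivity)]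
  have : (0:ℝ) ≤ k := Nat.cast_nonneg k
  linarith

lemma bM_ge (f : (ℕ → ℕ) → ℝ) (z : ℕ → ℕ) (k : ℕ) : 2 * bN f z k + k + 2 ≤ bM f z k := by
  unfold bM; nlinarith [Nat.zero_le (k * bN f z k)]

lemma bM_lt (hf : ∀ z, f z ≤ 1) (z : ℕ → ℕ) (k : ℕ) : bM f z k < bN f z (k+1) := by
  rw [bN_succ, Nat.lt_add_one_iff]
  apply Nat.le_floor
  rw [le_div_iff₀ (vv_pos f z k)]
  exact mul_le_of_le_one_right (Nat.cast_nonneg _) (vv_le hf z k)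

lemma bN_strictMono (hf : ∀ z, f z ≤ 1) (z : ℕ → ℕ) : StrictMono (bN f z) :=
  strictMono_nat_of_lt_succ fun k => by
    have := bM_lt hf z k; have := bM_ge f z k; omega

lemma bM_strictMono (hf : ∀ z, f z ≤ 1) (z : ℕ → ℕ) : StrictMono (bM f z) :=
  strictMono_nat_of_lt_succ fun k => by
    have := bM_lt hf z k; have := bM_ge f z (k+1); omega

lemma xs_true (z : ℕ → ℕ) {k i : ℕ} (h1 : bN f z k ≤ i) (h2 : i < bM f z k) : xs f z i = true := by
  simp only [xs, decide_eq_true_eq]; exact ⟨k, h1, h2⟩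

lemma xs_false (hf : ∀ z, f z ≤ 1) (z : ℕ → ℕ) {k i : ℕ} (h1 : bM f z k ≤ i) (h2 : i < bN f z (k+1)) : xs f z i = false := by
  simp only [xs, decide_eq_false_iff_not]
  rintro ⟨k', h3, h4⟩
  rcases Nat.lt_or_ge k k' with h | h
  · have := (bN_strictMono hf z).monotone (show k+1 ≤ k' from h); omega
  · have := (bM_strictMono hf z).monotone h; omega

lemma vv_congr {z z' : ℕ → ℕ} {k : ℕ} (h : ∀ i < k, z i = z' i) : vv f z k = vv f z' k := by
  unfold vv
  congr 2
  ext i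
  split_ifs with hi
  · exact h i hi
  · rfl

lemma bN_congr {z z' : ℕ → ℕ} {k : ℕ} (h : ∀ i < k, z i = z' i) : bN f z k = bN f z' k := by
  induction k with
  | zero => rfl
  | succ k ih =>
    have h' : ∀ i < k, z i = z' i := fun i hi => h i (by omega)
    rw [bN_succ, bN_succ, bM, bM, ih h', h k (by omega), vv_congr h']

lemma bM_congr {z z' : ℕ → ℕ} {k : ℕ} (h : ∀ i < k + 1, z i = z' i) : bM f z k = bM f z' k := by
  rw [bM, bM, bN_congr (fun i hi => h i (by omega)), h k (by omega)]

lemma xs_congr (hf : ∀ z, f z ≤ 1) {z z' : ℕ → ℕ} {k : ℕ} (h : ∀ i < k, z i = z' i) {i : ℕ} (hi : i < bN f z k) :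
    xs f z i = xs f z' i := by
  obtain ⟨l, h1, h2⟩ := exists_block (bN_strictMono hf z) i (Nat.zero_le _)
  have hl : l < k := by
    by_contra hl
    have := (bN_strictMono hf z).monotone (not_lt.1 hl); omega
  have e1 : bN f z l = bN f z' l := bN_congr (fun i hi => h i (by omega))
  have e2 : bM f z l = bM f z' l := bM_congr (fun i hi => h i (by omega))
  have e3 : bN f z (l+1) = bN f z' (l+1) := bN_congr (fun i hi => h i (by omega))
  rcases Nat.lt_or_ge i (bM f z l) with h | h
  · rw [xs_true z h1 h, xs_true z' (e1 ▸ h1) (e2 ▸ h)]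
  · rw [xs_false hf z h h2, xs_false hf z' (e2 ▸ h) (e3 ▸ h2)]

lemma xs_decode (hf : ∀ z, f z ≤ 1) {z z' : ℕ → ℕ} {m k : ℕ} (h : ∀ i < m, xs f z i = xs f z' i)
    (hk : bN f z k ≤ m) : ∀ i < k, z i = z' i := by
  induction k with
  | zero => intro i hi; omega
  | succ k ih =>
    have a1 := bM_lt hf z k
    have a2 := bM_ge f z k
    have ih' := ih (by omega)
    have e := bN_congr (f := f) ih'
    have e1 : bM f z' k ≤ bM f z k := by
      by_contra hlt
      have b1 := xs_true (f := f) z' (k := k) (i := bM f z k) (by omega) (by omega)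
      have b2 := xs_false hf z (k := k) (i := bM f z k) le_rfl a1
      rw [h _ (by omega), b1] at b2; cases b2
    have e2 : bM f z k ≤ bM f z' k := by
      by_contra hlt
      have c := bM_ge f z' k
      have b1 := xs_true (f := f) z (k := k) (i := bM f z' k) (by omega) (by omega)
      have b2 := xs_false hf z' (k := k) (i := bM f z' k) le_rfl (bM_lt hf z' k)
      rw [← h _ (by omega), b1] at b2; cases b2
    have e3 : z k = z' k := by
      have : bM f z k = bM f z' k := le_antisymm e2 e1
      rw [bM, bM, e] at this; omega
    intro i hi
    rcases Nat.lt_succ_iff_lt_or_eq.1 hi with h | rfl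
    · exact ih' i h
    · exact e3

/-- limits of `xs` which are not eventually constant are `xs`. -/
lemma xs_limit (hf : ∀ z, f z ≤ 1) (y : ℕ → Bool) (h : ∀ M, ∃ z, ∀ i < M, xs f z i = y i)
    (h0 : ∀ N, ∃ i ≥ N, y i = false) (h1 : ∀ N, ∃ i ≥ N, y i = true) : ∃ z, y = xs f z := by
  have key : ∀ k, ∃ m, ∀ z, (∀ i < m, xs f z i = y i) → bN f z k ≤ m := by
    intro k
    induction k with
    | zero => exact ⟨0, fun z _ => le_rfl⟩
    | succ k ih =>
      obtain ⟨m, hm⟩ := ih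
      obtain ⟨z0, hz0⟩ := h m
      obtain ⟨q, hq, hq0⟩ := h0 m
      obtain ⟨q', hq', hq1⟩ := h1 q
      refine ⟨q' + 1, fun z hz => ?_⟩
      have a := hm z (fun i hi => hz i (by omega))
      have b : bM f z k ≤ q := by
        by_contra hlt
        have := xs_true (f := f) z (k := k) (i := q) (by omega) (by omega)
        rw [hz q (by omega), hq0] at this; cases this
      by_contra hlt
      have := xs_false hf z (k := k) (i := q') (by omega) (by omega)
      rw [hz q' (by omega), hq1] at this; cases this
  choose m hm using key
  choose Z hZ using fun k => h (m k)
  have agree : ∀ k l z, (∀ i < m k, xs f z i = y i) → l < k → Z k l = z l := by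
    intro k l z hz hl
    refine xs_decode hf (m := m k) (fun i hi => ?_) (hm k (Z k) (hZ k)) l hl
    rw [hZ k i hi, hz i hi]
  refine ⟨fun l => Z (l+1) l, ?_⟩
  funext i
  obtain ⟨w, hw⟩ := h (((Finset.range (i+2)).sup m) + i + 1)
  have hw' : ∀ k < i + 2, ∀ j < m k, xs f w j = y j := fun k hk j hj => hw j (by
    have := Finset.le_sup (f := m) (Finset.mem_range.2 hk); omega)
  have e : ∀ l < i + 1, w l = (fun l => Z (l+1) l) l := fun l hl =>
    (agree (l+1) l w (hw' (l+1) (by omega)) (by omega)).symm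
  rw [← hw i (by omega)]
  refine xs_congr hf e ?_
  exact lt_of_lt_of_le (Nat.lt_succ_self i) (bN_strictMono hf w).le_apply

lemma vv_tendsto (hc : Continuous f) (h0 : ∀ z, 0 ≤ f z) (z : ℕ → ℕ) :
    Tendsto (vv f z) atTop (nhds (f z)) := by
  have h1 : Tendsto (fun k : ℕ => (fun i => if i < k then z i else 0 : ℕ → ℕ)) atTop (nhds z) := by
    rw [tendsto_pi_nhds]
    intro i
    refine tendsto_const_nhds.congr' ?_
    filter_upwards [eventually_gt_atTop i] with k hk
    simp [hk]
  have h2 := (hc.tendsto z).comp h1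
  have h3 : Tendsto (fun k : ℕ => 1 / ((k:ℝ) + 2)) atTop (nhds 0) := by
    have : Tendsto (fun k : ℕ => ((k:ℝ) + 2)) atTop atTop :=
      tendsto_atTop_add_const_right _ _ tendsto_natCast_atTop_atTop
    simpa [Function.comp_def] using (tendsto_inv_atTop_zero.comp this)
  have h4 := h2.max h3
  rw [max_eq_left (h0 z)] at h4
  exact h4

lemma xs_LD (hf : ∀ z, f z ≤ 1) (hc : Continuous f) (h0 : ∀ z, 0 ≤ f z) (z : ℕ → ℕ) :
    LDs (xs f z) (f z) := by
  have hv := vv_tendsto hc h0 z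
  constructor
  · intro ε hε
    have t1 : ∀ᶠ k : ℕ in atTop, f z - ε ≤ vv f z k - 2 / ((k:ℝ) + 3) := by
      have h3 : Tendsto (fun k : ℕ => 2 / ((k:ℝ) + 3)) atTop (nhds 0) := by
        have : Tendsto (fun k : ℕ => ((k:ℝ) + 3)) atTop atTop :=
          tendsto_atTop_add_const_right _ _ tendsto_natCast_atTop_atTop
        simpa [div_eq_mul_inv, Function.comp_def] using (tendsto_inv_atTop_zero.comp this).const_mul 2
      have := hv.sub h3
      rw [sub_zero] at this
      exact this.eventually_const_le (by linarith)
    obtain ⟨K, hK⟩ := eventually_atTop.1 t1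
    filter_upwards [eventually_ge_atTop (bM f z K)] with m hm
    obtain ⟨k', k1, k2⟩ := exists_block (φ := fun k => bM f z (K + k))
      (fun a b hab => bM_strictMono hf z (by omega)) m hm
    obtain ⟨k, rfl⟩ : ∃ k, k = K + k' := ⟨_, rfl⟩
    set k := K + k' with hk
    have k2 : m < bM f z (k+1) := k2
    have k1 : bM f z k ≤ m := k1
    have hk' := hK k (by omega)
    have a1 := bM_lt hf z k
    have a2 := bM_ge f z k
    set N := bN f z k
    set M := bM f z k with hM
    set N' := bN f z (k+1) with hN'
    set v := vv f z k
    have vpos : 0 < v := vv_pos f z k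
    have vle : v ≤ 1 := vv_le hf z k
    have c1 : (v - 2/((k:ℝ)+3)) * N' ≤ M - N := by
      have b1 : v * N' ≤ M + v := by
        have : (N':ℝ) ≤ M / v + 1 := by
          rw [hN', bN_succ]; push_cast
          have := Nat.floor_le (show 0 ≤ (M:ℝ) / v by positivity)
          linarith
        calc v * N' ≤ v * (M / v + 1) := by gcongr
          _ = M + v := by field_simp
      have b2 : (N:ℝ) + 1 ≤ 2/((k:ℝ)+3) * N' := by
        have : ((k:ℝ)+2) * (N+1) ≤ M := by
          have : (k+2) * (N+1) ≤ M := Nat.le_add_right _ _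
          exact_mod_cast this
        have a3 : (M:ℝ) ≤ N' := by exact_mod_cast a1.le
        rw [div_mul_eq_mul_div, le_div_iff₀ (by positivity)]
        have : (0:ℝ) ≤ k * N := by positivity
        nlinarith [(Nat.cast_nonneg k : (0:ℝ) ≤ k), (Nat.cast_nonneg N : (0:ℝ) ≤ N)]
      nlinarith
    -- counting
    have c2 : (M - N) + (m - N') ≤ cnt (xs f z) 0 m := by
      have d1 : cnt (xs f z) N (M - N) = M - N :=
        cnt_eq_self fun i hi => xs_true (f := f) z (k := k) (by omega) (by omega)
      have d2 : cnt (xs f z) N' (m - N') = m - N' :=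
        cnt_eq_self fun i hi => xs_true (f := f) z (k := k+1) (by omega) (by omega)
      rcases Nat.lt_or_ge m N' with hlt | hge
      · have := cnt_add (xs f z) 0 N (M - N + (m - M))
        rw [zero_add, cnt_add _ N, show N + (M - N + (m - M)) = m by omega] at this
        omega
      · have := cnt_add (xs f z) 0 N (M - N + ((N' - M) + (m - N')))
        rw [zero_add, cnt_add _ N, cnt_add _ (N + (M-N)), show N + (M - N + ((N' - M) + (m - N'))) = m by omega,
          show N + (M - N) + (N' - M) = N' by omega] at this
        omega
    have c3 : ((M:ℝ) - N) + max ((m:ℝ) - N') 0 ≤ cnt (xs f z) 0 m := by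
      rcases Nat.lt_or_ge m N' with hlt | hge
      · have : (m:ℝ) < N' := by exact_mod_cast hlt
        rw [max_eq_right (by linarith)]
        have : M - N ≤ cnt (xs f z) 0 m := by omega
        have : ((M - N : ℕ):ℝ) ≤ cnt (xs f z) 0 m := by exact_mod_cast this
        rw [Nat.cast_sub (by omega)] at this
        linarith
      · have : (N':ℝ) ≤ m := by exact_mod_cast hge
        rw [max_eq_left (by linarith)]
        have : (((M - N) + (m - N') : ℕ):ℝ) ≤ cnt (xs f z) 0 m := by exact_mod_cast c2
        rw [Nat.cast_add, Nat.cast_sub (by omega), Nat.cast_sub (by omega)] at this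
        linarith
    set c := v - 2/((k:ℝ)+3)
    have cle : c ≤ 1 := by
      have : 0 ≤ 2/((k:ℝ)+3) := by positivity
      simp only [c]; linarith
    have c4 : c * m ≤ cnt (xs f z) 0 m := by
      refine le_trans ?_ c3
      have NM : (N:ℝ) ≤ M := by exact_mod_cast (show N ≤ M by omega)
      rcases le_total (m:ℝ) N' with hle | hge
      · rw [max_eq_right (by linarith)]
        rcases le_total c 0 with hc0 | hc0
        · nlinarith [(Nat.cast_nonneg m : (0:ℝ) ≤ m)]
        · nlinarith
      · rw [max_eq_left (by linarith)]
        nlinarith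
    exact le_trans (by gcongr) c4
  · intro ε hε
    have t1 : ∀ᶠ k : ℕ in atTop, vv f z k ≤ f z + ε :=
      hv.eventually_le_const (by linarith)
    rw [frequently_atTop]
    intro m0
    obtain ⟨k, hk, hkm⟩ := (t1.and (eventually_ge_atTop m0)).exists
    refine ⟨bN f z (k+1), le_trans (by omega) (bN_strictMono hf z).le_apply, ?_⟩
    have a1 := bM_lt hf z k
    have d : cnt (xs f z) (bM f z k) (bN f z (k+1) - bM f z k) = 0 :=
      cnt_eq_zero fun i hi => xs_false hf z (k := k) (by omega) (by omega)
    have := cnt_add (xs f z) 0 (bM f z k) (bN f z (k+1) - bM f z k)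
    rw [zero_add, d, show bM f z k + (bN f z (k+1) - bM f z k) = bN f z (k+1) by omega] at this
    have e := cnt_le (xs f z) 0 (bM f z k)
    have e2 : ((cnt (xs f z) 0 (bN f z (k+1)) : ℕ) : ℝ) ≤ bM f z k := by exact_mod_cast (by omega)
    refine le_trans e2 ?_
    have e3 : (bM f z k : ℝ) / vv f z k ≤ bN f z (k+1) := by
      rw [bN_succ]; push_cast; exact (Nat.lt_floor_add_one _).le
    rw [div_le_iff₀ (vv_pos f z k)] at e3
    have : (0:ℝ) ≤ bN f z (k+1) := Nat.cast_nonneg _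
    nlinarith
end

noncomputable def PP (W : ℕ → ℕ) : ℕ → ℕ
  | 0 => 0
  | j+1 => 2 * PP W j + 2 * W j + (j+1) * ∑ i ∈ Finset.range (j+2), W i

lemma PP_mul (W : ℕ → ℕ) (j : ℕ) : j * ∑ i ∈ Finset.range (j+1), W i ≤ PP W j := by
  cases j with
  | zero => simp
  | succ j => rw [PP]; exact Nat.le_add_left _ _

lemma PP_ge (W : ℕ → ℕ) (hW : ∀ j, 1 ≤ W j) (j : ℕ) :
    2 * PP W j + 2 * W j + j ≤ PP W (j+1) := by
  rw [PP]
  have : 1 ≤ ∑ i ∈ Finset.range (j+2), W i :=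
    le_trans (hW 0) (Finset.single_le_sum (f := W) (fun _ _ => Nat.zero_le _) (by simp))
  nlinarith

lemma PP_strictMono (W : ℕ → ℕ) (hW : ∀ j, 1 ≤ W j) : StrictMono (PP W) :=
  strictMono_nat_of_lt_succ fun j => by have := PP_ge W hW j; have := hW j; omega

lemma exists_concat (W : ℕ → ℕ) (hW : ∀ j, 1 ≤ W j) (x : ℕ → ℕ → Bool) :
    ∃ g : ℕ → Bool, ∀ j i, PP W j + i < PP W (j+1) → g (PP W j + i) = x j i := by
  have hm := PP_strictMono W hW
  choose J h1 h2 using fun i => exists_block hm i (Nat.zero_le _)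
  refine ⟨fun i => x (J i) (i - PP W (J i)), fun j i hi => ?_⟩
  have a1 := h1 (PP W j + i)
  have a2 := h2 (PP W j + i)
  have : J (PP W j + i) = j := by
    apply le_antisymm
    · by_contra hlt
      have := hm.monotone (show j + 1 ≤ J (PP W j + i) by omega); omega
    · by_contra hlt
      have := hm.monotone (show J (PP W j + i) + 1 ≤ j by omega); omega
  simp only [this]
  congr 1; omega

lemma concat_LD (W : ℕ → ℕ) (hW : ∀ j, 1 ≤ W j) (x : ℕ → ℕ → Bool)
    (hx : ∀ j i, W j ≤ i → x j i = true) (g : ℕ → Bool)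
    (hg : ∀ j i, PP W j + i < PP W (j+1) → g (PP W j + i) = x j i) : LDs g 1 := by
  have hm := PP_strictMono W hW
  have key : ∀ j n, n ≤ PP W j → n ≤ cnt g 0 n + ∑ i ∈ Finset.range j, W i := by
    intro j
    induction j with
    | zero => intro n hn; simp [PP] at hn; simp [hn]
    | succ j ih =>
      intro n hn
      rw [Finset.sum_range_succ]
      rcases le_total n (PP W j) with h | h
      · have := ih n h; omega
      · have i0 := ih (PP W j) le_rfl
        have e := cnt_add g 0 (PP W j) (n - PP W j)
        rw [zero_add, show PP W j + (n - PP W j) = n by omega] at e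
        rcases le_total n (PP W j + W j) with h' | h'
        · omega
        · have e2 := cnt_add g (PP W j) (W j) (n - PP W j - W j)
          rw [show W j + (n - PP W j - W j) = n - PP W j by omega] at e2
          have e3 : cnt g (PP W j + W j) (n - PP W j - W j) = n - PP W j - W j := by
            apply cnt_eq_self
            intro i hi
            rw [add_assoc, hg j (W j + i) (by omega), hx j _ (by omega)]
          omega
  constructor
  · intro ε hε
    obtain ⟨j0, hj0⟩ := exists_nat_gt (1/ε)
    filter_upwards [eventually_ge_atTop (PP W j0)] with n hn
    obtain ⟨j', h1, h2⟩ := exists_block (φ := fun k => PP W (j0 + k))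
      (fun a b hab => hm (by omega)) n hn
    have h1 : PP W (j0 + j') ≤ n := h1
    have a := key (j0 + j' + 1) n h2.le
    have b := PP_mul W (j0 + j')
    set s := ∑ i ∈ Finset.range (j0 + j' + 1), W i
    have c : j0 * s ≤ n := le_trans (Nat.mul_le_mul_right s (Nat.le_add_right j0 j')) (b.trans h1)
    have c' : (j0:ℝ) * s ≤ n := by exact_mod_cast c
    have a' : (n:ℝ) ≤ cnt g 0 n + s := by exact_mod_cast a
    have d : 1 < ε * j0 := by rwa [div_lt_iff₀' hε] at hj0
    have s0 : (0:ℝ) ≤ s := Nat.cast_nonneg s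
    have : (s:ℝ) ≤ ε * n := by
      calc (s:ℝ) ≤ (ε * j0) * s := by nlinarith
        _ = ε * (j0 * s) := by ring
        _ ≤ ε * n := by gcongr
    linarith
  · intro ε hε
    refine (Eventually.of_forall fun m => ?_).frequently
    have : (cnt g 0 m : ℝ) ≤ m := by exact_mod_cast cnt_le g 0 m
    nlinarith [(Nat.cast_nonneg m : (0:ℝ) ≤ m)]

def InL (g y : ℕ → Bool) : Prop := ∀ m, ∃ p, ∀ i < m, g (p + i) = y i

lemma pigeon (R : ℕ) (Pr : ℕ → ℕ → Prop) (hanti : ∀ p m m', m ≤ m' → Pr m' p → Pr m p)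
    (h : ∀ m, ∃ p ≤ R, Pr m p) : ∃ p ≤ R, ∀ m, Pr m p := by
  by_contra hcon
  push Not at hcon
  choose! m hm using hcon
  obtain ⟨p, hp, hpp⟩ := h ((Finset.range (R+1)).sup m)
  exact hm p hp (hanti p _ _ (Finset.le_sup (f := m) (Finset.mem_range.2 (by omega))) hpp)

theorem symbolic {f : (ℕ → ℕ) → ℝ} (hf : ∀ z, f z ≤ 1) (hc : Continuous f) (h0 : ∀ z, 0 ≤ f z)
    (z0 z1 : ℕ → ℕ) (hz0 : f z0 = 0) (hz1 : f z1 = 1) :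
    ∃ g : ℕ → Bool, (∀ y, InL g y → ∃ z, LDs y (f z)) ∧ ∀ z, ∃ y, InL g y ∧ LDs y (f z) := by
  obtain ⟨s, hs⟩ := exists_surjective_nat (List ℕ)
  set Z : ℕ → ℕ → ℕ := fun j i => (s j).getD i 0 with hZ
  set w : ℕ → ℕ := fun j => bN f (Z j) (s j).length with hw
  set W : ℕ → ℕ := fun j => w j + 1 with hWdef
  set x : ℕ → ℕ → Bool := fun j i => if i < w j then xs f (Z j) i else true with hx
  have hW : ∀ j, 1 ≤ W j := fun j => by simp [hWdef]
  have hx1 : ∀ j i, w j ≤ i → x j i = true := fun j i hi => by simp [hx, not_lt.2 hi]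
  have hx0 : ∀ j i, i < w j → x j i = xs f (Z j) i := fun j i hi => by simp [hx, hi]
  have hxf : ∀ j i, x j i = false → i < w j := fun j i hi => by
    by_contra hlt
    rw [hx1 j i (by omega)] at hi; cases hi
  obtain ⟨g, hg⟩ := exists_concat W hW x
  have hgLD := concat_LD W hW x (fun j i hi => hx1 j i (by simp only [hWdef] at hi; omega)) g hg
  have hm := PP_strictMono W hW
  refine ⟨g, ?_, ?_⟩
  · intro y hy
    by_cases c1 : ∃ N, ∀ i ≥ N, y i = true
    · obtain ⟨N, hN⟩ := c1
      refine ⟨z1, ?_⟩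
      rw [hz1]
      exact LDs.unshift (y' := fun i => y (N + i)) (r := N) (fun i => rfl)
        (LDs.const_true fun i => hN _ (by omega))
    by_cases c2 : ∃ N, ∀ i ≥ N, y i = false
    · obtain ⟨N, hN⟩ := c2
      refine ⟨z0, ?_⟩
      rw [hz0]
      exact LDs.unshift (y' := fun i => y (N + i)) (r := N) (fun i => rfl)
        (LDs.const_false fun i => hN _ (by omega))
    push Not at c1 c2
    simp only [ne_eq, Bool.not_eq_true, Bool.not_eq_false] at c1 c2
    obtain ⟨N0, -, hN0⟩ := c1 0
    set y1 : ℕ → Bool := fun i => y (N0 + i) with hy1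
    suffices H : ∃ z, LDs y1 (f z) by
      obtain ⟨z, hz⟩ := H
      exact ⟨z, LDs.unshift (r := N0) (fun i => rfl) hz⟩
    have hL : InL g y1 := by
      intro m
      obtain ⟨p, hp⟩ := hy (N0 + m)
      refine ⟨p + N0, fun i hi => ?_⟩
      rw [add_assoc, hp (N0 + i) (by omega)]
    have inf0 : ∀ N, ∃ i ≥ N, y1 i = false := by
      intro N
      obtain ⟨i, hi, h⟩ := c1 (N0 + N)
      exact ⟨i - N0, by omega, by simp only [hy1]; rw [show N0 + (i - N0) = i by omega, h]⟩
    have inf1 : ∀ N, ∃ i ≥ N, y1 i = true := by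
      intro N
      obtain ⟨i, hi, h⟩ := c2 (N0 + N)
      exact ⟨i - N0, by omega, by simp only [hy1]; rw [show N0 + (i - N0) = i by omega, h]⟩
    have y10 : y1 0 = false := hN0
    clear_value y1
    obtain ⟨q2, -, hq2⟩ := inf1 0
    obtain ⟨Q, hQ, hQ0⟩ := inf0 q2
    by_cases hb : ∃ R, ∀ m, ∃ p ≤ R, ∀ i < m, g (p + i) = y1 i
    · obtain ⟨R, hR⟩ := hb
      obtain ⟨p, -, hp⟩ := pigeon R (fun m p => ∀ i < m, g (p + i) = y1 i)
        (fun p m m' h1 h2 i hi => h2 i (by omega)) hR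
      refine ⟨z1, ?_⟩
      rw [hz1]
      exact LDs.shift (r := p) (fun i => (hp (i+1) i (by omega)).symm) hgLD
    push Not at hb
    have step : ∀ M, ∃ r ≤ Q, ∃ z, ∀ i < M, xs f z (r + i) = y1 i := by
      intro M
      obtain ⟨m, hm'⟩ := hb (PP W (M + Q + 1))
      obtain ⟨p, hp⟩ := hL (m + M + Q + 1)
      have hpR : PP W (M + Q + 1) < p := by
        by_contra hlt
        obtain ⟨i, hi, hne⟩ := hm' p (by omega)
        exact hne (hp i (by omega))
      obtain ⟨j, h1, h2⟩ := exists_block hm p (Nat.zero_le _)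
      have hj : M + Q + 1 ≤ j := by
        by_contra hlt
        have := hm.monotone (show j + 1 ≤ M + Q + 1 by omega); omega
      obtain ⟨o, rfl⟩ := Nat.exists_eq_add_of_le h1
      have o0 : x j o = false := by
        rw [← hg j o h2]
        have := hp 0 (by omega)
        rw [add_zero] at this; rw [this, y10]
      have oW := hxf j o o0
      have gap := PP_ge W hW j
      have match' : ∀ i < M + Q + 1, x j (o + i) = y1 i := by
        intro i hi
        rw [← hg j (o + i) (by simp only [hWdef] at gap ⊢; omega), ← add_assoc]
        exact hp i (by omega)
      have xQ : x j (o + Q) = false := by rw [match' Q (by omega), hQ0]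
      have QW := hxf j _ xQ
      have xq2 : x j (o + q2) = true := by rw [match' q2 (by omega), hq2]
      rw [hx0 j _ (by omega)] at xQ xq2 o0
      have ⟨k, hk1, hk2⟩ : ∃ k, bN f (Z j) k ≤ o + q2 ∧ o + q2 < bM f (Z j) k := by
        simpa [xs] using xq2
      have hk3 : o < bN f (Z j) k := by
        by_contra hlt
        rw [xs_true (Z j) (k := k) (by omega) (by omega)] at o0; cases o0
      have hk4 : bM f (Z j) k ≤ o + Q := by
        by_contra hlt
        rw [xs_true (Z j) (k := k) (by omega) (by omega)] at xQ; cases xQ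
      have hk5 := bM_ge f (Z j) k
      refine ⟨o, by omega, fun i => if i < (s j).length then Z j i else M + Q, fun i hi => ?_⟩
      rw [← match' i (by omega)]
      have cg : ∀ l < (s j).length, Z j l = (fun i => if i < (s j).length then Z j i else M + Q) l :=
        fun l hl => by simp [hl]
      rcases Nat.lt_or_ge (o + i) (w j) with h | h
      · rw [hx0 j _ h]
        exact (xs_congr hf cg h).symm
      · rw [hx1 j _ h]
        refine xs_true _ (k := (s j).length) ?_ ?_
        · rw [← bN_congr cg]; exact h
        · rw [bM]; simp only [lt_irrefl, if_false]; omega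
    obtain ⟨r, hr, hrM⟩ := pigeon Q (fun M r => ∃ z, ∀ i < M, xs f z (r + i) = y1 i)
      (fun p m m' h1 ⟨z, h2⟩ => ⟨z, fun i hi => h2 i (by omega)⟩) step
    choose zM hzM using hrM
    obtain ⟨y2, -, φ, hφ, hlim⟩ := isCompact_univ.tendsto_subseq
      (x := fun M => xs f (zM M)) (fun _ => mem_univ _)
    have hlim' : ∀ i, ∀ᶠ n in atTop, xs f (zM (φ n)) i = y2 i := by
      intro i
      have := (tendsto_pi_nhds.1 hlim) i
      rw [nhds_discrete] at this
      exact tendsto_pure.1 this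
    have e12 : ∀ i, y1 i = y2 (r + i) := by
      intro i
      obtain ⟨n, h1, h2⟩ := ((hlim' (r + i)).and (eventually_gt_atTop i)).exists
      rw [← h1, hzM (φ n) i (lt_of_lt_of_le h2 (hφ.le_apply))]
    have hy2 : ∀ M, ∃ z, ∀ i < M, xs f z i = y2 i := by
      intro M
      have : ∀ᶠ n in atTop, ∀ i ∈ Finset.range M, xs f (zM (φ n)) i = y2 i := by
        rw [Filter.eventually_all_finset]
        exact fun i _ => hlim' i
      obtain ⟨n, hn⟩ := this.exists
      exact ⟨_, fun i hi => hn i (Finset.mem_range.2 hi)⟩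
    obtain ⟨z, rfl⟩ := xs_limit hf y2 hy2
      (fun N => by
        obtain ⟨i, hi, h⟩ := inf0 N
        exact ⟨r + i, by omega, by rw [← e12, h]⟩)
      (fun N => by
        obtain ⟨i, hi, h⟩ := inf1 N
        exact ⟨r + i, by omega, by rw [← e12, h]⟩)
    exact ⟨z, LDs.shift (r := r) e12 (xs_LD hf hc h0 z)⟩
  · intro z
    refine ⟨xs f z, fun m => ?_, xs_LD hf hc h0 z⟩
    obtain ⟨j, hj⟩ := hs ((List.range m).map z)
    have cg : ∀ i < m, z i = Z j i := by
      intro i hi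
      simp [hZ, hj, hi]
    have hl : (s j).length = m := by simp [hj]
    have hwj : w j = bN f z m := by simp only [hw]; rw [hl, bN_congr cg]
    have hmw : m ≤ w j := by rw [hwj]; exact (bN_strictMono hf z).le_apply
    have gap := PP_ge W hW j
    refine ⟨PP W j, fun i hi => ?_⟩
    rw [hg j i (by simp only [hWdef] at gap ⊢; omega), hx0 j i (by omega)]
    exact (xs_congr hf cg (by omega)).symm

/-- one-dimensional digit set -/
def K1 (S : ℕ → Bool) : Set ℝ :=
  (@Real.ofDigits 2) '' {e | ∀ i, S i = false → e i = 0}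

lemma K1_compact (S : ℕ → Bool) : IsCompact (K1 S) := by
  refine IsCompact.image ?_ Real.continuous_ofDigits
  refine IsClosed.isCompact ?_
  simp only [Set.ofPred_forall]
  refine isClosed_iInter fun i => isClosed_iInter fun _ => ?_
  exact isClosed_eq (continuous_apply i) continuous_const

lemma zero_mem_K1 (S : ℕ → Bool) : (0:ℝ) ∈ K1 S :=
  ⟨fun _ => 0, fun _ _ => rfl, by simp [Real.ofDigits, Real.ofDigitsTerm]⟩

noncomputable def pre (e : ℕ → Fin 2) (n : ℕ) : ℝ := ∑ i ∈ Finset.range n, Real.ofDigitsTerm e i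

lemma pre_succ (e : ℕ → Fin 2) (n : ℕ) :
    pre e (n+1) = pre e n + ((e n : ℕ) : ℝ) * ((2:ℝ)^(n+1))⁻¹ := by
  rw [pre, Finset.sum_range_succ, ← pre, Real.ofDigitsTerm]; norm_num

lemma pre_int (e : ℕ → Fin 2) (n : ℕ) : ∃ N : ℤ, pre e n = N * ((2:ℝ)^n)⁻¹ := by
  induction n with
  | zero => exact ⟨0, by simp [pre]⟩
  | succ n ih =>
    obtain ⟨N, hN⟩ := ih
    refine ⟨2 * N + (e n : ℕ), ?_⟩
    rw [pre_succ, hN]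
    push_cast
    field_simp
    ring

lemma pre_abs (e : ℕ → Fin 2) (n : ℕ) : |Real.ofDigits e - pre e n| ≤ ((2:ℝ)^n)⁻¹ := by
  rw [Real.ofDigits_eq_sum_add_ofDigits e n, pre, add_sub_cancel_left]
  have h1 := Real.ofDigits_nonneg (fun i => e (i+n))
  have h2 := Real.ofDigits_le_one (fun i => e (i+n))
  rw [abs_of_nonneg (by positivity)]
  push_cast
  exact mul_le_of_le_one_right (by positivity) h2

lemma cover_aux (S : ℕ → Bool) (z : ℝ) (p m : ℕ) : ∃ T : Finset ℝ, T.card ≤ 5 * 2 ^ cnt S p m ∧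
    ∀ e : ℕ → Fin 2, (∀ i, S i = false → e i = 0) → |Real.ofDigits e - z| ≤ ((2:ℝ)^p)⁻¹ →
      pre e (p + m) ∈ T := by
  classical
  induction m with
  | zero =>
    refine ⟨(Finset.Icc ⌈2^p * z - 2⌉ ⌊2^p * z + 2⌋).image (fun N : ℤ => N * ((2:ℝ)^p)⁻¹), ?_, ?_⟩
    · refine Finset.card_image_le.trans ?_
      rw [Int.card_Icc, cnt_zero]
      have h1 := Int.le_ceil (2^p * z - 2)
      have h2 := Int.floor_le (2^p * z + 2)
      have : ((⌊2^p * z + 2⌋ : ℤ) : ℝ) ≤ ((⌈2^p * z - 2⌉ + 4 : ℤ) : ℝ) := by push_cast; linarith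
      have : ⌊2^p * z + 2⌋ ≤ ⌈2^p * z - 2⌉ + 4 := by exact_mod_cast this
      omega
    · intro e he hz
      obtain ⟨N, hN⟩ := pre_int e p
      have h1 := pre_abs e p
      rw [add_zero, Finset.mem_image]
      refine ⟨N, ?_, hN.symm⟩
      have h2 : |pre e p - z| ≤ 2 * ((2:ℝ)^p)⁻¹ := by
        have := abs_sub_le (pre e p) (Real.ofDigits e) z
        rw [abs_sub_comm (pre e p) (Real.ofDigits e)] at this
        linarith
      have h3 : |(N:ℝ) - 2^p * z| ≤ 2 := by
        have e1 : (N:ℝ) - 2^p * z = 2^p * (pre e p - z) := by rw [hN]; field_simp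
        rw [e1, abs_mul, abs_of_pos (by positivity)]
        calc (2:ℝ)^p * |pre e p - z| ≤ 2^p * (2 * ((2:ℝ)^p)⁻¹) := by gcongr
          _ = 2 := by field_simp
      rw [abs_le] at h3
      rw [Finset.mem_Icc, Int.ceil_le, Int.le_floor]
      constructor <;> linarith
  | succ m ih =>
    obtain ⟨T, hT, hmem⟩ := ih
    rcases hS : S (p + m) with _ | _
    · refine ⟨T, by rw [cnt_succ, hS]; simpa using hT, fun e he hz => ?_⟩
      have := hmem e he hz
      rw [← add_assoc, pre_succ, he _ hS]
      simpa using this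
    · refine ⟨T ∪ T.image (fun t => t + ((2:ℝ)^(p+m+1))⁻¹), ?_, fun e he hz => ?_⟩
      · refine (Finset.card_union_le _ _).trans ?_
        have := Finset.card_image_le (s := T) (f := fun t => t + ((2:ℝ)^(p+m+1))⁻¹)
        rw [cnt_succ, hS, if_pos rfl, pow_succ (2:ℕ)]
        omega
      · have := hmem e he hz
        rw [← add_assoc, pre_succ, Finset.mem_union]
        have h2 : e (p+m) = 0 ∨ e (p+m) = 1 := by
          generalize e (p+m) = a; revert a; decide
        rcases h2 with h | h
        · left; rw [h]; simpa using this
        · right; rw [h, Finset.mem_image]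
          exact ⟨_, this, by simp⟩

lemma K1_cover (S : ℕ → Bool) (z : ℝ) (p m : ℕ) : ∃ T : Finset ℝ, T.card ≤ 5 * 2 ^ cnt S p m ∧
    ∀ x ∈ K1 S, |x - z| ≤ ((2:ℝ)^p)⁻¹ → ∃ t ∈ T, |x - t| ≤ ((2:ℝ)^(p+m))⁻¹ := by
  obtain ⟨T, h1, h2⟩ := cover_aux S z p m
  refine ⟨T, h1, ?_⟩
  rintro _ ⟨e, he, rfl⟩ hx
  exact ⟨_, h2 e he hx, pre_abs e _⟩

lemma sep_aux (S : ℕ → Bool) (e : ℕ → Fin 2) (he : ∀ i, S i = false → e i = 0) (p m : ℕ) :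
    ∃ D : Finset ℝ, D.card = 2 ^ cnt S p m ∧ ∀ x ∈ D, ∃ e' : ℕ → Fin 2,
      (∀ i, S i = false → e' i = 0) ∧ (∀ i < p, e' i = e i) ∧ (∀ i ≥ p + m, e' i = e i) ∧
      pre e' (p + m) = x := by
  classical
  induction m with
  | zero => exact ⟨{pre e p}, by simp [cnt_zero], by
      intro x hx
      rw [Finset.mem_singleton] at hx
      exact ⟨e, he, fun _ _ => rfl, fun _ _ => rfl, hx.symm⟩⟩
  | succ m ih =>
    obtain ⟨D, hD, hmem⟩ := ih
    rcases hS : S (p + m) with _ | _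
    · refine ⟨D, by rw [cnt_succ, hS]; simpa using hD, fun x hx => ?_⟩
      obtain ⟨e', h1, h2, h3, h4⟩ := hmem x hx
      refine ⟨e', h1, h2, fun i hi => h3 i (by omega), ?_⟩
      rw [← add_assoc, pre_succ, h1 _ hS, h4]; simp
    · refine ⟨D ∪ D.image (fun t => t + ((2:ℝ)^(p+m+1))⁻¹), ?_, fun x hx => ?_⟩
      · rw [Finset.card_union_of_disjoint, Finset.card_image_of_injective _ (add_left_injective _),
          cnt_succ, hS, if_pos rfl, pow_succ, hD]
        · ring
        · rw [Finset.disjoint_left]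
          intro a ha hb
          obtain ⟨b, hb, hab⟩ := Finset.mem_image.1 hb
          obtain ⟨e1, -, -, -, h1⟩ := hmem a ha
          obtain ⟨e2, -, -, -, h2⟩ := hmem b hb
          obtain ⟨N1, hN1⟩ := pre_int e1 (p+m)
          obtain ⟨N2, hN2⟩ := pre_int e2 (p+m)
          rw [← h1, ← h2, hN1, hN2, pow_succ] at hab
          have : (2 * N2 + 1 : ℝ) = 2 * N1 := by
            field_simp at hab
            linarith
          have : 2 * N2 + 1 = 2 * N1 := by exact_mod_cast this
          omega
      · have upd : ∀ (t : ℝ) (_ : t ∈ D) (a : Fin 2), ∃ e' : ℕ → Fin 2,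
            (∀ i, S i = false → e' i = 0) ∧ (∀ i < p, e' i = e i) ∧
            (∀ i ≥ p + (m + 1), e' i = e i) ∧
            pre e' (p + (m + 1)) = t + ((a : ℕ) : ℝ) * ((2:ℝ)^(p+m+1))⁻¹ := by
          intro t ht a
          obtain ⟨e', h1, h2, h3, h4⟩ := hmem t ht
          refine ⟨Function.update e' (p+m) a, ?_, ?_, ?_, ?_⟩
          · intro i hi
            have : i ≠ p + m := by rintro rfl; rw [hS] at hi; cases hi
            rw [Function.update_of_ne this]; exact h1 i hi
          · intro i hi
            rw [Function.update_of_ne (by omega)]; exact h2 i hi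
          · intro i hi
            rw [Function.update_of_ne (by omega)]; exact h3 i (by omega)
          · rw [← add_assoc, pre_succ, Function.update_self, ← h4]
            congr 1
            refine Finset.sum_congr rfl fun i hi => ?_
            rw [Finset.mem_range] at hi
            rw [Real.ofDigitsTerm, Real.ofDigitsTerm, Function.update_of_ne (by omega)]
        rcases Finset.mem_union.1 hx with h | h
        · obtain ⟨e', h1, h2, h3, h4⟩ := upd x h 0
          exact ⟨e', h1, h2, h3, by rw [h4]; simp⟩
        · obtain ⟨t, ht, rfl⟩ := Finset.mem_image.1 h
          obtain ⟨e', h1, h2, h3, h4⟩ := upd t ht 1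
          exact ⟨e', h1, h2, h3, by rw [h4]; simp⟩

lemma K1_sep (S : ℕ → Bool) (x : ℝ) (hx : x ∈ K1 S) (p m : ℕ) :
    ∃ T : Finset ℝ, T.card = 2 ^ cnt S p m ∧ (∀ t ∈ T, t ∈ K1 S ∧ |t - x| ≤ ((2:ℝ)^p)⁻¹) ∧
      ∀ t ∈ T, ∀ t' ∈ T, t ≠ t' → ((2:ℝ)^(p+m))⁻¹ ≤ |t - t'| := by
  classical
  obtain ⟨e, he, rfl⟩ := hx
  obtain ⟨D, hD, hmem⟩ := sep_aux S e he p m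
  set tail := ((2:ℝ)^(p+m))⁻¹ * Real.ofDigits (fun i => e (i + (p+m))) with htail
  refine ⟨D.image (fun d => d + tail), ?_, ?_, ?_⟩
  · rw [Finset.card_image_of_injective _ (add_left_injective _), hD]
  · intro t ht
    obtain ⟨d, hd, rfl⟩ := Finset.mem_image.1 ht
    obtain ⟨e', h1, h2, h3, h4⟩ := hmem d hd
    have : d + tail = Real.ofDigits e' := by
      rw [Real.ofDigits_eq_sum_add_ofDigits e' (p+m), ← pre, h4, htail]
      have : (fun i => e' (i + (p+m))) = (fun i => e (i + (p+m))) := by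
        funext i; exact h3 _ (by omega)
      rw [this]; norm_num
    simp only [this]
    refine ⟨⟨e', h1, rfl⟩, ?_⟩
    simpa using Real.abs_ofDigits_sub_ofDigits_le h2
  · intro t ht t' ht' hne
    obtain ⟨d, hd, rfl⟩ := Finset.mem_image.1 ht
    obtain ⟨d', hd', rfl⟩ := Finset.mem_image.1 ht'
    obtain ⟨e1, -, -, -, h1⟩ := hmem d hd
    obtain ⟨e2, -, -, -, h2⟩ := hmem d' hd'
    obtain ⟨N1, hN1⟩ := pre_int e1 (p+m)
    obtain ⟨N2, hN2⟩ := pre_int e2 (p+m)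
    have hN : N1 ≠ N2 := by
      rintro rfl
      exact hne (by rw [← h1, ← h2, hN1, hN2])
    rw [add_sub_add_right_eq_sub, ← h1, ← h2, hN1, hN2, ← sub_mul, abs_mul,
      abs_of_pos (show (0:ℝ) < ((2:ℝ)^(p+m))⁻¹ by positivity)]
    have : (1:ℝ) ≤ |(N1:ℝ) - N2| := by
      have : 1 ≤ |N1 - N2| := Int.one_le_abs (sub_ne_zero.2 hN)
      exact_mod_cast this
    exact le_mul_of_one_le_left (by positivity) this

/-- The compact set. -/
def KK (d : ℕ) (S : ℕ → Bool) : Set (Fin d → ℝ) := Set.univ.pi (fun _ => K1 S)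

lemma KK_compact (d : ℕ) (S : ℕ → Bool) : IsCompact (KK d S) :=
  isCompact_univ_pi fun _ => K1_compact S

lemma zero_mem_KK (d : ℕ) (S : ℕ → Bool) : (0 : Fin d → ℝ) ∈ KK d S :=
  fun _ _ => zero_mem_K1 S

lemma KK_cover (d : ℕ) (S : ℕ → Bool) (z : Fin d → ℝ) (p m : ℕ) :
    ∃ T : Finset (Fin d → ℝ), T.card ≤ (5 * 2 ^ cnt S p m) ^ d ∧
    ∀ x ∈ KK d S, dist x z ≤ ((2:ℝ)^p)⁻¹ → ∃ t ∈ T, dist x t ≤ ((2:ℝ)^(p+m))⁻¹ := by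
  choose T h1 h2 using fun j => K1_cover S (z j) p m
  refine ⟨Fintype.piFinset T, ?_, ?_⟩
  · rw [Fintype.card_piFinset]
    refine (Finset.prod_le_pow_card _ _ _ (fun j _ => h1 j)).trans ?_
    simp
  · intro x hx hxz
    rw [dist_pi_le_iff (by positivity)] at hxz
    choose t ht1 ht2 using fun j => h2 j (x j) (hx j (mem_univ j)) (hxz j)
    refine ⟨t, Fintype.mem_piFinset.2 ht1, ?_⟩
    rw [dist_pi_le_iff (by positivity)]
    exact ht2

lemma KK_sep (d : ℕ) (S : ℕ → Bool) (x : Fin d → ℝ) (hx : x ∈ KK d S) (p m : ℕ) :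
    ∃ T : Finset (Fin d → ℝ), T.card = (2 ^ cnt S p m) ^ d ∧
    (∀ t ∈ T, t ∈ KK d S ∧ dist t x ≤ ((2:ℝ)^p)⁻¹) ∧
      ∀ t ∈ T, ∀ t' ∈ T, t ≠ t' → ((2:ℝ)^(p+m))⁻¹ ≤ dist t t' := by
  choose T h1 h2 h3 using fun j => K1_sep S (x j) (hx j (mem_univ j)) p m
  refine ⟨Fintype.piFinset T, ?_, ?_, ?_⟩
  · rw [Fintype.card_piFinset, Finset.prod_congr rfl (fun j _ => h1 j)]; simp
  · intro t ht
    rw [Fintype.mem_piFinset] at ht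
    refine ⟨fun j _ => (h2 j _ (ht j)).1, ?_⟩
    rw [dist_pi_le_iff (by positivity)]
    exact fun j => (h2 j _ (ht j)).2
  · intro t ht t' ht' hne
    rw [Fintype.mem_piFinset] at ht ht'
    obtain ⟨j, hj⟩ := Function.ne_iff.1 hne
    exact (h3 j _ (ht j) _ (ht' j) hj).trans (dist_le_pi_dist t t' j)

lemma coverNum_le' {X : Type*} [MetricSpace X] {s : Set X} {n : ℕ} (t : Finset X)
    (h : ∀ x ∈ s, ∃ y ∈ t, dist x y ≤ ((2:ℝ)^n)⁻¹) : coverNum s n ≤ t.card := by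
  refine Nat.sInf_le ⟨t, rfl, fun x hx => ?_⟩
  obtain ⟨y, hy, hxy⟩ := h x hx
  simp only [mem_iUnion, Metric.mem_closedBall]
  exact ⟨y, hy, by rwa [zpow_neg, zpow_natCast]⟩

lemma le_coverNum {X : Type*} [MetricSpace X] {s : Set X} (hs : IsCompact s) {n : ℕ}
    (D : Finset X) (hD : ∀ x ∈ D, x ∈ s)
    (hsep : ∀ x ∈ D, ∀ y ∈ D, x ≠ y → 2 * ((2:ℝ)^n)⁻¹ < dist x y) : D.card ≤ coverNum s n := by
  have hne : {m : ℕ | ∃ t : Finset X, t.card = m ∧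
      s ⊆ ⋃ y ∈ t, Metric.closedBall y ((2 : ℝ) ^ (-(n : ℤ)))}.Nonempty := by
    obtain ⟨t, -, htf, ht⟩ := hs.finite_cover_balls (e := (2 : ℝ) ^ (-(n : ℤ))) (by positivity)
    refine ⟨_, htf.toFinset, rfl, fun x hx => ?_⟩
    have := ht hx
    simp only [mem_iUnion] at this ⊢
    obtain ⟨i, hi, hx⟩ := this
    exact ⟨i, by simpa using hi, Metric.ball_subset_closedBall hx⟩
  obtain ⟨t, ht, hcov⟩ := Nat.sInf_mem hne
  change D.card ≤ sInf _
  rw [← ht]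
  have : ∀ x ∈ D, ∃ y ∈ t, dist x y ≤ ((2:ℝ)^n)⁻¹ := by
    intro x hx
    have := hcov (hD x hx)
    simp only [mem_iUnion, Metric.mem_closedBall, zpow_neg, zpow_natCast] at this
    obtain ⟨y, hy, h⟩ := this
    exact ⟨y, hy, h⟩
  choose! c hc1 hc2 using this
  refine Finset.card_le_card_of_injOn c (fun x hx => hc1 x hx) ?_
  intro x hx y hy hxy
  by_contra hne
  have h1 := hsep x hx y hy hne
  have h2 := hc2 x hx
  have h3 := hc2 y hy
  rw [← hxy] at h3
  have := dist_triangle_right x y (c x)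
  linarith

lemma haus_near {X : Type*} [MetricSpace X] {F : ℕ → Set X} {E : Set X}
    (h : Tendsto (fun n => Metric.hausdorffEDist (F n) E) atTop (nhds 0)) {δ : ℝ} (hδ : 0 < δ) :
    ∀ᶠ n in atTop, (∀ x ∈ F n, ∃ y ∈ E, dist x y < δ) ∧ (∀ x ∈ E, ∃ y ∈ F n, dist x y < δ) := by
  have : ∀ᶠ n in atTop, Metric.hausdorffEDist (F n) E < ENNReal.ofReal δ :=
    h.eventually_lt_const (by simpa using hδ)
  filter_upwards [this] with n hn
  constructor
  · intro x hx
    obtain ⟨y, hy, hxy⟩ := Metric.exists_edist_lt_of_hausdorffEDist_lt hx hn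
    exact ⟨y, hy, by rwa [edist_lt_ofReal] at hxy⟩
  · intro x hx
    rw [Metric.hausdorffEDist_comm] at hn
    obtain ⟨y, hy, hxy⟩ := Metric.exists_edist_lt_of_hausdorffEDist_lt hx hn
    exact ⟨y, hy, by rwa [edist_lt_ofReal] at hxy⟩

abbrev cube (d : ℕ) : Set (Fin d → ℝ) := Set.univ.pi (fun _ => Set.Icc (0 : ℝ) 1)

lemma dist_aff {d : ℕ} (l : ℝ) (hl : 0 ≤ l) (u x y : Fin d → ℝ) :
    dist (l • x + u) (l • y + u) = l * dist x y := by
  rw [dist_add_right, dist_smul₀, Real.norm_of_nonneg hl]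

lemma micro_upper (d : ℕ) (S : ℕ → Bool) (E : Set (Fin d → ℝ)) (lam : ℕ → ℝ)
    (u : ℕ → Fin d → ℝ) (p : ℕ → ℕ) (hp1 : ∀ n, (2:ℝ)^(p n) ≤ lam n)
    (hp2 : ∀ n, lam n ≤ (2:ℝ)^(p n + 1))
    (h : Tendsto (fun n => Metric.hausdorffEDist
        (((fun z => lam n • z + u n) '' KK d S) ∩ cube d) E) atTop (nhds 0)) (m : ℕ) :
    ∀ᶠ n in atTop, coverNum E m ≤ (5 * 2 ^ cnt S (p n) (m+2)) ^ d := by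
  filter_upwards [haus_near h (δ := ((2:ℝ)^(m+1))⁻¹) (by positivity)] with n hn
  have hl : 0 < lam n := lt_of_lt_of_le (by positivity) (hp1 n)
  set c : Fin d → ℝ := fun _ => 1/2
  set z : Fin d → ℝ := (lam n)⁻¹ • (c - u n) with hz
  have hzc : lam n • z + u n = c := by
    rw [hz, smul_inv_smul₀ hl.ne']; simp
  obtain ⟨T, hT, hcov⟩ := KK_cover d S z (p n) (m+2)
  classical
  refine le_trans (coverNum_le' (T.image (fun t => lam n • t + u n)) ?_) (Finset.card_image_le.trans hT)
  intro y hy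
  obtain ⟨_, ⟨⟨x, hx, rfl⟩, hc⟩, hd⟩ := hn.2 y hy
  have hdc : dist (lam n • x + u n) c ≤ 1 := by
    rw [dist_pi_le_iff zero_le_one]
    intro j
    have := hc j (mem_univ j)
    simp only [mem_Icc] at this
    rw [Real.dist_eq, abs_le]
    simp only [c]
    constructor <;> linarith [this.1, this.2]
  have hxz : dist x z ≤ ((2:ℝ)^(p n))⁻¹ := by
    rw [← hzc, dist_aff _ hl.le] at hdc
    calc dist x z ≤ (lam n)⁻¹ := by rw [← one_div, le_div_iff₀ hl]; linarith
      _ ≤ _ := inv_anti₀ (by positivity) (hp1 n)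
  obtain ⟨t, ht, hxt⟩ := hcov x hx hxz
  refine ⟨lam n • t + u n, Finset.mem_image_of_mem _ ht, ?_⟩
  have e1 : dist (lam n • x + u n) (lam n • t + u n) ≤ ((2:ℝ)^(m+1))⁻¹ := by
    rw [dist_aff _ hl.le]
    calc lam n * dist x t ≤ 2^(p n + 1) * ((2:ℝ)^(p n+(m+2)))⁻¹ := by gcongr; exact hp2 n
      _ = ((2:ℝ)^(m+1))⁻¹ := by
        rw [show p n + (m+2) = (p n + 1) + (m+1) by ring, pow_add _ (p n + 1)]; field_simp
  have e2 : ((2:ℝ)^m)⁻¹ = 2 * ((2:ℝ)^(m+1))⁻¹ := by rw [pow_succ]; field_simp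
  have := dist_triangle y (lam n • x + u n) (lam n • t + u n)
  linarith

lemma micro_lower (d : ℕ) (S : ℕ → Bool) (E : Set (Fin d → ℝ)) (hE : IsCompact E)
    (hE2 : (E ∩ Set.univ.pi (fun _ => Set.Ioo (0 : ℝ) 1)).Nonempty) (lam : ℕ → ℝ)
    (u : ℕ → Fin d → ℝ) (p : ℕ → ℕ) (hp1 : ∀ n, (2:ℝ)^(p n) ≤ lam n)
    (hp2 : ∀ n, lam n ≤ (2:ℝ)^(p n + 1))
    (h : Tendsto (fun n => Metric.hausdorffEDist
        (((fun z => lam n • z + u n) '' KK d S) ∩ cube d) E) atTop (nhds 0)) :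
    ∃ k, ∀ m, ∀ᶠ n in atTop, (2 ^ cnt S (p n + k) m) ^ d ≤ coverNum E (k + m + 2) := by
  obtain ⟨e0, he0, hint⟩ := hE2
  have hop : IsOpen (Set.univ.pi (fun _ : Fin d => Set.Ioo (0 : ℝ) 1)) :=
    isOpen_set_pi finite_univ (fun _ _ => isOpen_Ioo)
  obtain ⟨η, hη, hball⟩ := Metric.isOpen_iff.1 hop e0 hint
  obtain ⟨k, hk⟩ := exists_pow_lt_of_lt_one (show 0 < η/4 by positivity) (show (1/2:ℝ) < 1 by norm_num)
  have hk' : 2 * ((2:ℝ)^k)⁻¹ < η/2 := by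
    rw [one_div, inv_pow] at hk; linarith
  refine ⟨k, fun m => ?_⟩
  filter_upwards [haus_near h (δ := η/2) (by positivity),
    haus_near h (δ := ((2:ℝ)^(k+m))⁻¹/8) (by positivity)] with n hn1 hn2
  have hl : 0 < lam n := lt_of_lt_of_le (by positivity) (hp1 n)
  obtain ⟨_, ⟨⟨x, hx, rfl⟩, -⟩, hd⟩ := hn1.2 e0 he0
  obtain ⟨T, hT, hT1, hT2⟩ := KK_sep d S x hx (p n + k) m
  have hmem : ∀ t ∈ T, ∃ y ∈ E, dist (lam n • t + u n) y < ((2:ℝ)^(k+m))⁻¹/8 := by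
    intro t ht
    refine hn2.1 _ ⟨⟨t, (hT1 t ht).1, rfl⟩, ?_⟩
    have e1 : dist (lam n • t + u n) (lam n • x + u n) ≤ 2 * ((2:ℝ)^k)⁻¹ := by
      rw [dist_aff _ hl.le]
      calc lam n * dist t x ≤ 2^(p n + 1) * ((2:ℝ)^(p n + k))⁻¹ := by
            gcongr
            · exact hp2 n
            · exact (hT1 t ht).2
        _ = 2 * ((2:ℝ)^k)⁻¹ := by rw [pow_add, pow_add]; field_simp
    have : lam n • t + u n ∈ Metric.ball e0 η := by
      rw [Metric.mem_ball]
      have := dist_triangle (lam n • t + u n) (lam n • x + u n) e0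
      simp only [dist_comm e0] at hd
      linarith
    exact fun j hj => Ioo_subset_Icc_self (hball this j hj)
  choose! y hy1 hy2 using hmem
  have hsep : ∀ t ∈ T, ∀ t' ∈ T, t ≠ t' → (3/4) * ((2:ℝ)^(k+m))⁻¹ < dist (y t) (y t') := by
    intro t ht t' ht' hne
    have e1 : ((2:ℝ)^(k+m))⁻¹ ≤ dist (lam n • t + u n) (lam n • t' + u n) := by
      rw [dist_aff _ hl.le]
      calc ((2:ℝ)^(k+m))⁻¹ = 2^(p n) * ((2:ℝ)^(p n + k + m))⁻¹ := by
            rw [add_assoc (p n), pow_add _ (p n)]; field_simp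
        _ ≤ lam n * dist t t' := by
            gcongr
            · exact hp1 n
            · exact hT2 t ht t' ht' hne
    have e2 := hy2 t ht
    have e3 := hy2 t' ht'
    have e4 := dist_triangle4 (lam n • t + u n) (y t) (y t') (lam n • t' + u n)
    rw [dist_comm (y t') (lam n • t' + u n)] at e4
    linarith
  have h0 : 0 < ((2:ℝ)^(k+m))⁻¹ := by positivity
  classical
  rw [← hT, ← Finset.card_image_of_injOn (f := y) (s := T)]
  · refine le_coverNum hE _ ?_ ?_
    · intro a ha
      obtain ⟨t, ht, rfl⟩ := Finset.mem_image.1 ha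
      exact hy1 t ht
    · intro a ha b hb hab
      obtain ⟨t, ht, rfl⟩ := Finset.mem_image.1 ha
      obtain ⟨t', ht', rfl⟩ := Finset.mem_image.1 hb
      have := hsep t ht t' ht' (by rintro rfl; exact hab rfl)
      have e : 2 * ((2:ℝ)^(k+m+2))⁻¹ = (1/2) * ((2:ℝ)^(k+m))⁻¹ := by
        rw [pow_add _ (k+m)]; field_simp
      linarith
  · intro t ht t' ht' htt
    by_contra hne
    have := hsep t ht t' ht' hne
    rw [htt, dist_self] at this
    linarith

/-- digit set with prescribed densities -/
lemma exists_S (a b : ℝ) (ha : 0 ≤ a) (hab : a ≤ b) (hb : b ≤ 1) (g : ℕ → Bool) :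
    ∃ S : ℕ → Bool, ∀ p m, |(cnt S p m : ℝ) - (a * m + (b - a) * cnt g p m)| ≤ 1 := by
  set G : ℕ → ℝ := fun n => a * n + (b - a) * cnt g 0 n with hG
  have G0 : ∀ n, 0 ≤ G n := fun n => by
    have : 0 ≤ b - a := by linarith
    simp only [hG]; positivity
  have Gs : ∀ n, G n ≤ G (n+1) ∧ G (n+1) ≤ G n + 1 := by
    intro n
    simp only [hG, cnt_succ]
    push_cast
    split_ifs <;> constructor <;> push_cast <;> nlinarith
  set S : ℕ → Bool := fun i => decide (⌊G i⌋₊ < ⌊G (i+1)⌋₊) with hS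
  have hc : ∀ n, cnt S 0 n = ⌊G n⌋₊ := by
    intro n
    induction n with
    | zero => simp [cnt_zero, hG]
    | succ n ih =>
      rw [cnt_succ, ih, zero_add]
      have h1 : ⌊G n⌋₊ ≤ ⌊G (n+1)⌋₊ := Nat.floor_mono (Gs n).1
      have h2 : ⌊G (n+1)⌋₊ ≤ ⌊G n⌋₊ + 1 := by
        rw [← Nat.floor_add_one (G0 n)]; exact Nat.floor_mono (Gs n).2
      by_cases h : ⌊G n⌋₊ < ⌊G (n+1)⌋₊
      · simp only [hS, h, decide_true, if_true]; omega
      · simp only [hS, h, decide_false]; simp; omega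
  refine ⟨S, fun p m => ?_⟩
  have e1 := cnt_add S 0 p m
  have e2 := cnt_add g 0 p m
  rw [zero_add, hc, hc] at e1
  rw [zero_add] at e2
  have e1' : (⌊G (p+m)⌋₊ : ℝ) = ⌊G p⌋₊ + cnt S p m := by exact_mod_cast e1
  have e3 : G (p+m) = G p + (a * m + (b - a) * cnt g p m) := by
    simp only [hG, e2]; push_cast; ring
  have f1 := Nat.floor_le (G0 p)
  have f2 := Nat.lt_floor_add_one (G p)
  have f3 := Nat.floor_le (G0 (p+m))
  have f4 := Nat.lt_floor_add_one (G (p+m))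
  rw [abs_le]
  constructor <;> linarith

lemma micro_dim (d : ℕ) (S g : ℕ → Bool) (a b : ℝ) (ha : 0 ≤ a) (hab : a ≤ b) (hb : b ≤ 1)
    (hS : ∀ p m, |(cnt S p m:ℝ) - (a*m+(b-a)*cnt g p m)| ≤ 1)
    (E : Set (Fin d → ℝ)) (hE : IsCompact E)
    (hE2 : (E ∩ Set.univ.pi (fun _ => Set.Ioo (0 : ℝ) 1)).Nonempty) (lam : ℕ → ℝ)
    (u : ℕ → Fin d → ℝ) (p : ℕ → ℕ) (hp1 : ∀ n, (2:ℝ)^(p n) ≤ lam n)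
    (hp2 : ∀ n, lam n ≤ (2:ℝ)^(p n + 1))
    (h : Tendsto (fun n => Metric.hausdorffEDist
        (((fun z => lam n • z + u n) '' KK d S) ∩ cube d) E) atTop (nhds 0))
    (y : ℕ → Bool) (hy : ∀ m, ∀ᶠ n in atTop, ∀ i < m, g (p n + i) = y i)
    (β : ℝ) (hβ : LDs y β) :
    lbDim E = ENNReal.ofReal (d * (a + (b - a) * β)) := by
  obtain ⟨k, hk⟩ := micro_lower d S E hE hE2 lam u p hp1 hp2 h
  have l2 : 0 < Real.log 2 := Real.log_pos (by norm_num)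
  have main : LD (fun m => Real.log (coverNum E m) / Real.log 2) (d * a + d * (b - a) * β) := by
    refine (LD.affine hβ (d * a) (d * (b - a))
      (mul_nonneg (Nat.cast_nonneg _) (by linarith))).transfer (d * (k + 6)) ?_
    filter_upwards [eventually_ge_atTop (k + 2)] with m hm
    obtain ⟨m', rfl⟩ : ∃ m', m = k + m' + 2 := ⟨m - (k+2), by omega⟩
    obtain ⟨n, h1, h2, h3⟩ := ((hk m').and
      ((micro_upper d S E lam u p hp1 hp2 h (k + m' + 2)).and (hy (k + m' + 2 + 2)))).exists
    set N := coverNum E (k + m' + 2) with hN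
    have hdn : (0:ℝ) ≤ d := Nat.cast_nonneg d
    have N1 : (1:ℝ) ≤ N := by
      have : 1 ≤ N := le_trans (Nat.one_le_pow _ _ (by positivity)) h1
      exact_mod_cast this
    have u1 : Real.log N ≤ d * (3 * Real.log 2 + cnt S (p n) (k + m' + 2 + 2) * Real.log 2) := by
      have : (N:ℝ) ≤ (5 * 2 ^ cnt S (p n) (k + m' + 2 + 2)) ^ d := by exact_mod_cast h2
      have h5 : Real.log 5 ≤ 3 * Real.log 2 := by
        rw [show (3:ℝ) * Real.log 2 = Real.log (2^3) by rw [Real.log_pow]; norm_num]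
        exact Real.log_le_log (by norm_num) (by norm_num)
      calc Real.log N ≤ Real.log ((5 * 2 ^ cnt S (p n) (k + m' + 2 + 2)) ^ d) :=
            Real.log_le_log (by linarith) this
        _ = d * (Real.log 5 + cnt S (p n) (k + m' + 2 + 2) * Real.log 2) := by
            rw [Real.log_pow, Real.log_mul (by norm_num) (by positivity), Real.log_pow]
        _ ≤ _ := by gcongr
    have l1 : d * (cnt S (p n + k) m' * Real.log 2) ≤ Real.log N := by
      have : ((2:ℝ) ^ cnt S (p n + k) m') ^ d ≤ N := by exact_mod_cast h1
      calc _ = Real.log (((2:ℝ) ^ cnt S (p n + k) m') ^ d) := by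
            rw [Real.log_pow, Real.log_pow]
        _ ≤ _ := Real.log_le_log (by positivity) this
    have u2 : Real.log N / Real.log 2 ≤ d * (3 + cnt S (p n) (k + m' + 2 + 2)) := by
      rw [div_le_iff₀ l2]; linarith
    have l2' : d * (cnt S (p n + k) m' : ℝ) ≤ Real.log N / Real.log 2 := by
      rw [le_div_iff₀ l2]; linarith
    have e1 : cnt g (p n) (k + m' + 2 + 2) = cnt y 0 (k + m' + 2 + 2) :=
      cnt_congr (fun i hi => by rw [h3 i hi, zero_add])
    have e2 : cnt g (p n + k) m' = cnt y k m' :=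
      cnt_congr (fun i hi => by rw [add_assoc, h3 (k + i) (by omega)])
    have e3 := cnt_add y 0 (k + m' + 2) 2
    have e4 := cnt_add y 0 (k + m') 2
    have e5 := cnt_add y 0 k m'
    rw [zero_add] at e5
    have f1 := cnt_le y (0 + (k + m' + 2)) 2
    have f2 := cnt_le y (0 + (k + m')) 2
    have f3 := cnt_le y 0 k
    have s1 := (abs_le.1 (hS (p n) (k + m' + 2 + 2))).2
    have s2 := (abs_le.1 (hS (p n + k) m')).1
    rw [e1] at s1
    rw [e2] at s2
    set c := cnt y 0 (k + m' + 2) with hc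
    have g1 : (cnt y 0 (k + m' + 2 + 2) : ℝ) ≤ c + 2 := by
      have : cnt y 0 (k + m' + 2 + 2) ≤ c + 2 := by omega
      exact_mod_cast this
    have g2 : (c : ℝ) ≤ cnt y k m' + k + 2 := by
      have : c ≤ cnt y k m' + k + 2 := by omega
      exact_mod_cast this
    have hba : 0 ≤ b - a := by linarith
    push_cast at s1 s2 ⊢
    have kk : (0:ℝ) ≤ k := Nat.cast_nonneg k
    have U : (cnt S (p n) (k + m' + 2 + 2) : ℝ) ≤ a * (k + m' + 2) + (b - a) * c + 3 := by
      nlinarith [mul_le_mul_of_nonneg_left g1 hba]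
    have L : a * (k + m' + 2) + (b - a) * c - (k + 3) ≤ (cnt S (p n + k) m' : ℝ) := by
      nlinarith [mul_le_mul_of_nonneg_left g2 hba, mul_nonneg (sub_nonneg.2 hb) kk]
    have U' := mul_le_mul_of_nonneg_left U hdn
    have L' := mul_le_mul_of_nonneg_left L hdn
    have := mul_nonneg hdn kk
    rw [abs_le]
    constructor <;> nlinarith
  have := main.liminf
  rw [lbDim, show d * (a + (b - a) * β) = d * a + d * (b - a) * β by ring, ← this]
  congr 1
  ext m
  congr 1
  rw [div_div, mul_comm (Real.log 2)]

lemma micro_fwd (d : ℕ) (S g : ℕ → Bool) (a b : ℝ) (ha : 0 ≤ a) (hab : a ≤ b) (hb : b ≤ 1)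
    (hS : ∀ p m, |(cnt S p m:ℝ) - (a*m+(b-a)*cnt g p m)| ≤ 1)
    (E : Set (Fin d → ℝ)) (hE : IsMicroset d (KK d S) E) :
    ∃ y, InL g y ∧ ∀ β, LDs y β → lbDim E = ENNReal.ofReal (d * (a + (b - a) * β)) := by
  obtain ⟨hc, -, hE2, lam, u, hl, ht⟩ := hE
  have : ∀ n, ∃ p : ℕ, (2:ℝ)^p ≤ lam n ∧ lam n < (2:ℝ)^(p+1) :=
    fun n => exists_nat_pow_near (hl n) (by norm_num)
  choose p hp1 hp2 using this
  obtain ⟨y, -, φ, hφ, hlim⟩ := isCompact_univ.tendsto_subseq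
      (x := fun n i => g (p n + i)) (fun _ => mem_univ _)
  have hlim' : ∀ m, ∀ᶠ n in atTop, ∀ i < m, g (p (φ n) + i) = y i := by
    intro m
    have : ∀ᶠ n in atTop, ∀ i ∈ Finset.range m, g (p (φ n) + i) = y i := by
      rw [Filter.eventually_all_finset]
      intro i _
      have := (tendsto_pi_nhds.1 hlim) i
      rw [nhds_discrete] at this
      exact tendsto_pure.1 this
    filter_upwards [this] with n hn i hi using hn i (Finset.mem_range.2 hi)
  refine ⟨y, fun m => ?_, fun β hβ => ?_⟩
  · obtain ⟨n, hn⟩ := (hlim' m).exists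
    exact ⟨_, hn⟩
  · exact micro_dim d S g a b ha hab hb hS E hc hE2 (fun n => lam (φ n)) (fun n => u (φ n))
      (fun n => p (φ n)) (fun n => hp1 _) (fun n => (hp2 _).le)
      (ht.comp hφ.tendsto_atTop) y hlim' β hβ

lemma micro_exists (d : ℕ) (S g : ℕ → Bool) (a b : ℝ) (ha : 0 ≤ a) (hab : a ≤ b) (hb : b ≤ 1)
    (hS : ∀ p m, |(cnt S p m:ℝ) - (a*m+(b-a)*cnt g p m)| ≤ 1)
    (y : ℕ → Bool) (hy : InL g y) (β : ℝ) (hβ : LDs y β) :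
    ∃ E, IsMicroset d (KK d S) E ∧ lbDim E = ENNReal.ofReal (d * (a + (b - a) * β)) := by
  choose p hp using hy
  set u : Fin d → ℝ := fun _ => 1/2 with hu
  have cc : IsCompact (cube d) := isCompact_univ_pi fun _ => isCompact_Icc
  haveI : CompactSpace (cube d) := isCompact_iff_compactSpace.1 cc
  have uc : u ∈ cube d := fun i _ => by simp only [hu]; constructor <;> norm_num
  set F : ℕ → Set (Fin d → ℝ) :=
    fun n => ((fun z => (2:ℝ)^(p n) • z + u) '' KK d S) ∩ cube d with hF
  have uF : ∀ n, u ∈ F n := fun n => ⟨⟨0, zero_mem_KK d S, by simp⟩, uc⟩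
  have Fc : ∀ n, IsCompact (F n) := fun n =>
    ((KK_compact d S).image (by fun_prop)).inter cc
  let G : ℕ → TopologicalSpace.NonemptyCompacts (cube d) := fun n =>
    ⟨⟨(Subtype.val : cube d → _) ⁻¹' (F n), ((Fc n).isClosed.preimage continuous_subtype_val).isCompact⟩,
      ⟨⟨u, uc⟩, uF n⟩⟩
  obtain ⟨H, -, φ, hφ, hlim⟩ := isCompact_univ.tendsto_subseq (x := G) (fun _ => mem_univ _)
  set E : Set (Fin d → ℝ) := (Subtype.val : cube d → _) '' (H : Set (cube d)) with hEdef
  have ht : Tendsto (fun n => Metric.hausdorffEDist (F (φ n)) E) atTop (nhds 0) := by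
    have h1 := tendsto_iff_edist_tendsto_0.1 hlim
    refine h1.congr fun n => ?_
    have e : F (φ n) = (Subtype.val : cube d → _) '' (G (φ n) : Set (cube d)) := by
      change _ = (Subtype.val : cube d → _) '' ((Subtype.val : cube d → _) ⁻¹' (F (φ n)))
      rw [Subtype.image_preimage_coe]
      exact (inter_eq_right.2 inter_subset_right).symm
    rw [e, hEdef, Metric.hausdorffEDist_image isometry_subtype_coe]
    rfl
  have Ec : IsCompact E := H.isCompact.image continuous_subtype_val
  have uE : u ∈ E := by
    rw [Metric.mem_iff_infEDist_zero_of_closed Ec.isClosed]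
    refine le_antisymm (ge_of_tendsto' ht fun n => ?_) bot_le
    exact Metric.infEDist_le_hausdorffEDist_of_mem (uF _)
  have hE2 : (E ∩ Set.univ.pi (fun _ => Set.Ioo (0 : ℝ) 1)).Nonempty :=
    ⟨u, uE, fun i _ => by simp only [hu]; constructor <;> norm_num⟩
  refine ⟨E, ⟨Ec, ?_, hE2, fun n => 2^(p (φ n)), fun _ => u,
    fun n => one_le_pow₀ (by norm_num), ht⟩, ?_⟩
  · rintro _ ⟨x, -, rfl⟩
    exact x.2
  · refine micro_dim d S g a b ha hab hb hS E Ec hE2 (fun n => 2^(p (φ n))) (fun _ => u)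
      (fun n => p (φ n)) (fun n => le_rfl) (fun n => ?_) ht y (fun m => ?_) β hβ
    · exact pow_le_pow_right₀ (by norm_num) (by omega)
    · filter_upwards [eventually_ge_atTop m] with n hn i hi
      exact hp (φ n) i (lt_of_lt_of_le hi (hn.trans hφ.le_apply))

/-- If `A ⊆ [0,d]` is a nonempty analytic set containing its infimum and supremum, then
there is a compact set `K ⊆ ℝ^d` whose microsets attain exactly the lower box dimensions
in `A`. -/
theorem statement2 (d : ℕ) (hd : 1 ≤ d) (A : Set ℝ) (hne : A.Nonempty)
    (hsub : A ⊆ Set.Icc 0 (d : ℝ)) (han : MeasureTheory.AnalyticSet A)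
    (hinf : sInf A ∈ A) (hsup : sSup A ∈ A) :
    ∃ K : Set (Fin d → ℝ), IsCompact K ∧
      {e : ℝ≥0∞ | ∃ E, IsMicroset d K E ∧ lbDim E = e} = ENNReal.ofReal '' A := by
  have d0 : (0:ℝ) < d := by exact_mod_cast hd
  have hbb : BddBelow A := bddBelow_Icc.mono hsub
  have hba : BddAbove A := bddAbove_Icc.mono hsub
  set s := sInf A with hs
  set t := sSup A with ht
  have sA : ∀ x ∈ A, s ≤ x := fun x hx => csInf_le hbb hx
  have tA : ∀ x ∈ A, x ≤ t := fun x hx => le_csSup hba hx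
  clear_value s t
  have key : ∃ g : ℕ → Bool, (∀ y, InL g y → ∃ β, s + (t - s) * β ∈ A ∧ LDs y β) ∧
      ∀ α ∈ A, ∃ y, InL g y ∧ ∃ β, s + (t - s) * β = α ∧ LDs y β := by
    rcases (sA t hsup).eq_or_lt with hst | hst
    · refine ⟨fun _ => false, fun y hy => ⟨0, by simpa using hinf, LDs.const_false fun i => ?_⟩,
        fun α hα => ⟨fun _ => false, fun m => ⟨0, fun i _ => rfl⟩, 0, ?_, LDs.const_false fun i => rfl⟩⟩
      · obtain ⟨p, hp⟩ := hy (i+1)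
        exact (hp i (by omega)).symm
      · have := sA α hα
        have := tA α hα
        linarith
    · rw [AnalyticSet] at han
      rcases han with h | ⟨f, hf, hr⟩
      · exact absurd h hne.ne_empty
      have hfA : ∀ z, f z ∈ A := fun z => hr ▸ mem_range_self z
      have ts : 0 < t - s := sub_pos.2 hst
      obtain ⟨z0, hz0⟩ : s ∈ range f := hr ▸ hinf
      obtain ⟨z1, hz1⟩ : t ∈ range f := hr ▸ hsup
      have ee : ∀ z, s + (t - s) * ((f z - s) / (t - s)) = f z := fun z => by
        rw [mul_div_cancel₀ _ ts.ne']; ring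
      obtain ⟨g, h1, h2⟩ := symbolic (f := fun z => (f z - s) / (t - s))
        (fun z => by rw [div_le_one ts]; linarith [tA _ (hfA z)]) (by fun_prop)
        (fun z => div_nonneg (by linarith [sA _ (hfA z)]) ts.le) z0 z1
        (by simp [hz0]) (by simp only [hz1]; exact div_self ts.ne')
      refine ⟨g, fun y hy => ?_, fun α hα => ?_⟩
      · obtain ⟨z, hz⟩ := h1 y hy
        exact ⟨_, by rw [ee z]; exact hfA z, hz⟩
      · rw [← hr] at hα
        obtain ⟨z, rfl⟩ := hα
        obtain ⟨y, hy, hz⟩ := h2 z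
        exact ⟨y, hy, _, ee z, hz⟩
  obtain ⟨g, hg1, hg2⟩ := key
  have a0 : 0 ≤ s / d := div_nonneg (hsub hinf).1 d0.le
  have ab : s / d ≤ t / d := by gcongr; exact sA t hsup
  have b1 : t / d ≤ 1 := (div_le_one d0).2 (hsub hsup).2
  obtain ⟨S, hS⟩ := exists_S (s / d) (t / d) a0 ab b1 g
  have eq : ∀ β, d * (s / d + (t / d - s / d) * β) = s + (t - s) * β := fun β => by field_simp
  refine ⟨KK d S, KK_compact d S, ?_⟩
  ext e
  constructor
  · rintro ⟨E, hE, rfl⟩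
    obtain ⟨y, hy, h⟩ := micro_fwd d S g _ _ a0 ab b1 hS E hE
    obtain ⟨β, hβ, hL⟩ := hg1 y hy
    exact ⟨_, hβ, by rw [h β hL, eq]⟩
  · rintro ⟨α, hα, rfl⟩
    obtain ⟨y, hy, β, rfl, hL⟩ := hg2 α hα
    obtain ⟨E, hE, h⟩ := micro_exists d S g _ _ a0 ab b1 hS y hy β hL
    exact ⟨E, hE, by rw [h, eq]⟩
end

section
/- For every integer d ≥ 1 and every compact set K ⊆ ℝ^d, the set {dim_H E : E is a microset of K} is an analytic subset of ℝ. -/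
open Filter MeasureTheory Set
open scoped ENNReal

open scoped NNReal Topology
open TopologicalSpace

/-- `E` has a fine countable open cover of small `s`-cost. -/
def HasFineCover {X : Type*} [EMetricSpace X] (s : ℝ) (r : ℝ≥0∞) (E : Set X) : Prop :=
  ∃ U : ℕ → Set X, (∀ n, IsOpen (U n)) ∧ (∀ n, Metric.ediam (U n) ≤ r) ∧
    (∑' n, Metric.ediam (U n) ^ s ≤ r) ∧ E ⊆ ⋃ n, U n

theorem isOpen_hasFineCover {X : Type*} [EMetricSpace X] (s : ℝ) (r : ℝ≥0∞) :
    IsOpen {E : NonemptyCompacts X | HasFineCover s r (E : Set X)} := by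
  have : {E : NonemptyCompacts X | HasFineCover s r (E : Set X)} =
      ⋃ (U : ℕ → Set X) (_ : (∀ n, IsOpen (U n)) ∧ (∀ n, Metric.ediam (U n) ≤ r) ∧
        (∑' n, Metric.ediam (U n) ^ s ≤ r)), {E : NonemptyCompacts X | (E : Set X) ⊆ ⋃ n, U n} := by
    ext E
    simp only [HasFineCover, mem_ofPred_eq, mem_iUnion, exists_prop, and_assoc]
  rw [this]
  refine isOpen_biUnion fun U hU => ?_
  exact NonemptyCompacts.isOpen_subsets_of_isOpen (isOpen_iUnion hU.1)

theorem exists_thicken {X : Type*} [EMetricSpace X] {s : ℝ} (hs : 0 < s) {r : ℝ≥0∞}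
    {ε : ℝ≥0∞} (hε : 0 < ε) (t : Set X) (ht : Metric.ediam t < r) :
    ∃ U : Set X, IsOpen U ∧ t ⊆ U ∧ Metric.ediam U ≤ r ∧
      Metric.ediam U ^ s ≤ Metric.ediam t ^ s + ε := by
  set x := Metric.ediam t with hx
  have hxt : x ≠ ∞ := (ht.trans_le le_top).ne
  have h1 : Tendsto (fun δ : ℝ≥0 => x + 2 * (δ : ℝ≥0∞)) (𝓝[>] 0) (𝓝 x) := by
    have : Continuous (fun δ : ℝ≥0 => x + 2 * (δ : ℝ≥0∞)) := by
      refine continuous_const.add ?_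
      exact (ENNReal.continuous_const_mul (by simp)).comp ENNReal.continuous_coe
    have h := this.tendsto 0
    simp only [ENNReal.coe_zero, mul_zero, add_zero] at h
    exact h.mono_left nhdsWithin_le_nhds
  have h2 : Tendsto (fun δ : ℝ≥0 => (x + 2 * (δ : ℝ≥0∞)) ^ s) (𝓝[>] 0) (𝓝 (x ^ s)) :=
    (ENNReal.continuous_rpow_const.tendsto x).comp h1
  have hxs : x ^ s ≠ ∞ := ENNReal.rpow_ne_top_of_nonneg hs.le hxt
  have e1 := h1.eventually (gt_mem_nhds ht)
  have e2 := h2.eventually (gt_mem_nhds (ENNReal.lt_add_right hxs hε.ne'))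
  obtain ⟨δ, hδ1, hδ2, hδ0⟩ := (e1.and (e2.and self_mem_nhdsWithin)).exists
  have hd : Metric.ediam (Metric.thickening δ t) ≤ x + 2 * δ := Metric.ediam_thickening_le δ
  refine ⟨Metric.thickening δ t, Metric.isOpen_thickening,
    Metric.self_subset_thickening (by exact_mod_cast hδ0) t, hd.trans hδ1.le, ?_⟩
  exact (ENNReal.rpow_le_rpow hd hs.le).trans hδ2.le

theorem hausdorff_zero_iff {X : Type*} [EMetricSpace X] [MeasurableSpace X] [BorelSpace X]
    {s : ℝ} (hs : 0 < s) (E : Set X) :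
    Measure.hausdorffMeasure s E = 0 ↔ ∀ n : ℕ, HasFineCover s ((n : ℝ≥0∞) + 1)⁻¹ E := by
  have hle : ∀ t : Set X, (⨆ _ : t.Nonempty, Metric.ediam t ^ s) = Metric.ediam t ^ s := by
    intro t
    rcases t.eq_empty_or_nonempty with rfl | h
    · simp [hs]
    · simp [h]
  rw [Measure.hausdorffMeasure_apply]
  simp only [hle]
  constructor
  · intro h n
    set r : ℝ≥0∞ := ((n : ℝ≥0∞) + 1)⁻¹ with hr
    have hr0 : 0 < r := by
      rw [hr, ENNReal.inv_pos]; exact ENNReal.add_ne_top.2 ⟨by simp, by simp⟩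
    have hrt : r ≠ ∞ := by simp [hr]
    have hr2 : r / 2 < r := ENNReal.half_lt_self hr0.ne' hrt
    have hr20 : 0 < r / 2 := ENNReal.half_pos hr0.ne'
    simp only [ENNReal.iSup_eq_zero] at h
    have h' := (h (r / 2) hr20).trans_lt hr20
    simp only [iInf_lt_iff] at h'
    obtain ⟨t, hcov, hdiam, hsum⟩ := h'
    obtain ⟨ε, hε, hεs⟩ := ENNReal.exists_pos_sum_of_countable' hr20.ne' ℕ
    choose U hUo htU hUd hUs using fun n =>
      exists_thicken hs (hε n) (t n) ((hdiam n).trans_lt hr2)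
    refine ⟨U, hUo, hUd, ?_, hcov.trans (iUnion_mono htU)⟩
    calc ∑' n, Metric.ediam (U n) ^ s ≤ ∑' n, (Metric.ediam (t n) ^ s + ε n) :=
          ENNReal.tsum_le_tsum hUs
      _ = ∑' n, Metric.ediam (t n) ^ s + ∑' n, ε n := ENNReal.tsum_add
      _ ≤ r / 2 + r / 2 := add_le_add hsum.le hεs.le
      _ = r := ENNReal.add_halves r
  · intro h
    simp only [ENNReal.iSup_eq_zero]
    intro r hr
    refine le_antisymm (le_of_forall_pos_le_add fun ε hε => ?_) bot_le
    obtain ⟨n, hn⟩ := ENNReal.exists_inv_nat_lt (lt_min hr hε).ne'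
    obtain ⟨U, -, hUd, hUs, hcov⟩ := h n
    have hn' : ((n : ℝ≥0∞) + 1)⁻¹ ≤ min r ε :=
      (ENNReal.inv_le_inv.2 le_self_add).trans hn.le
    rw [zero_add]
    refine iInf_le_of_le U ?_
    refine iInf_le_of_le hcov ?_
    refine iInf_le_of_le (fun n => (hUd n).trans (hn'.trans (min_le_left _ _))) ?_
    exact hUs.trans (hn'.trans (min_le_right _ _))

theorem measurable_dimH_nonemptyCompacts {X : Type*} [EMetricSpace X]
    [MeasurableSpace (NonemptyCompacts X)] [BorelSpace (NonemptyCompacts X)] :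
    Measurable (fun E : NonemptyCompacts X => dimH (E : Set X)) := by
  borelize X
  refine measurable_of_Iio fun t => ?_
  have : (fun E : NonemptyCompacts X => dimH (E : Set X)) ⁻¹' Iio t =
      ⋃ (q : ℚ) (_ : 0 < q ∧ (Real.toNNReal q : ℝ≥0∞) < t),
        ⋂ n : ℕ, {E : NonemptyCompacts X |
          HasFineCover (Real.toNNReal q : ℝ) ((n : ℝ≥0∞) + 1)⁻¹ (E : Set X)} := by
    ext E
    simp only [mem_preimage, mem_Iio, mem_iUnion, mem_iInter, mem_ofPred_eq, exists_prop]
    constructor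
    · intro h
      obtain ⟨q, -, h1, h2⟩ := ENNReal.lt_iff_exists_rat_btwn.1 h
      have hq : 0 < Real.toNNReal q := by
        have : (0 : ℝ≥0∞) < _ := lt_of_le_of_lt bot_le h1
        exact_mod_cast this
      refine ⟨q, ⟨by exact_mod_cast Real.toNNReal_pos.1 hq, h2⟩, ?_⟩
      exact (hausdorff_zero_iff (by exact_mod_cast hq) _).1 (hausdorffMeasure_of_dimH_lt h1)
    · rintro ⟨q, ⟨hq, h2⟩, h⟩
      have hq' : 0 < Real.toNNReal q := Real.toNNReal_pos.2 (by exact_mod_cast hq)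
      have h0 := (hausdorff_zero_iff (by exact_mod_cast hq') _).2 h
      exact (dimH_le_of_hausdorffMeasure_ne_top (by rw [h0]; simp)).trans_lt h2
  rw [this]
  exact MeasurableSet.iUnion fun q => MeasurableSet.iUnion fun _ =>
    MeasurableSet.iInter fun n => (isOpen_hasFineCover _ _).measurableSet

/-- For every compact `K ⊆ ℝ^d`, the set of Hausdorff dimensions of microsets of `K` is an
analytic subset of `ℝ`. -/
theorem statement3 (d : ℕ) (hd : 1 ≤ d) (K : Set (Fin d → ℝ)) (hK : IsCompact K) :
    MeasureTheory.AnalyticSet {x : ℝ | ∃ E, IsMicroset d K E ∧ (dimH E).toReal = x} := by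
  let X := Fin d → ℝ
  borelize (NonemptyCompacts X)
  have hcube : IsCompact (Set.univ.pi (fun _ : Fin d => Set.Icc (0 : ℝ) 1)) :=
    isCompact_univ_pi fun _ => isCompact_Icc
  have hopen : IsOpen (Set.univ.pi (fun _ : Fin d => Set.Ioo (0 : ℝ) 1)) :=
    isOpen_set_pi finite_univ fun _ _ => isOpen_Ioo
  let T : Set (NonemptyCompacts X) := {F | ∃ (l : ℝ) (u : X), 1 ≤ l ∧
    (F : Set X) = ((fun z => l • z + u) '' K) ∩ Set.univ.pi (fun _ => Set.Icc (0 : ℝ) 1)}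
  let M : Set (NonemptyCompacts X) :=
    {E | (E : Set X) ⊆ Set.univ.pi (fun _ => Set.Icc (0 : ℝ) 1)} ∩
    {E | ((E : Set X) ∩ Set.univ.pi (fun _ => Set.Ioo (0 : ℝ) 1)).Nonempty} ∩ closure T
  have hM : MeasurableSet M := by
    refine (MeasurableSet.inter ?_ ?_).inter isClosed_closure.measurableSet
    · exact (NonemptyCompacts.isClosed_subsets_of_isClosed hcube.isClosed).measurableSet
    · exact (NonemptyCompacts.isOpen_inter_nonempty_of_isOpen hopen).measurableSet
  have hmicro : ∀ E : NonemptyCompacts X, E ∈ M ↔ IsMicroset d K E := by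
    intro E
    constructor
    · rintro ⟨⟨h1, h2⟩, h3⟩
      obtain ⟨F, hF, hlim⟩ := mem_closure_iff_seq_limit.1 h3
      choose l u hl hFe using hF
      refine ⟨E.isCompact, h1, h2, l, u, hl, ?_⟩
      have := tendsto_iff_edist_tendsto_0.1 hlim
      refine this.congr fun n => ?_
      rw [← hFe n]; rfl
    · rintro ⟨-, h1, h2, l, u, hl, hlim⟩
      refine ⟨⟨h1, h2⟩, EMetric.mem_closure_iff.2 fun ε hε => ?_⟩
      obtain ⟨n, hn, hn'⟩ := ((hlim.eventually (gt_mem_nhds hε)).and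
        (hlim.eventually (gt_mem_nhds ENNReal.zero_lt_top))).exists
      have hne : (((fun z => l n • z + u n) '' K) ∩
          Set.univ.pi (fun _ => Set.Icc (0 : ℝ) 1)).Nonempty := by
        refine Metric.nonempty_of_hausdorffEDist_ne_top E.nonempty ?_
        rw [Metric.hausdorffEDist_comm]
        exact hn'.ne
      have hc : IsCompact (((fun z => l n • z + u n) '' K) ∩
          Set.univ.pi (fun _ => Set.Icc (0 : ℝ) 1)) :=
        (hK.image (by fun_prop)).inter hcube
      refine ⟨⟨⟨_, hc⟩, hne⟩, ⟨l n, u n, hl n, rfl⟩, ?_⟩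
      rw [edist_comm]
      exact hn
  have himg : {x : ℝ | ∃ E, IsMicroset d K E ∧ (dimH E).toReal = x} =
      (fun E : NonemptyCompacts X => (dimH (E : Set X)).toReal) '' M := by
    ext x
    constructor
    · rintro ⟨E, hE, rfl⟩
      let E' : NonemptyCompacts X := ⟨⟨E, hE.1⟩, hE.2.2.1.mono inter_subset_left⟩
      exact ⟨E', (hmicro E').2 hE, rfl⟩
    · rintro ⟨E, hE, rfl⟩
      exact ⟨E, (hmicro E).1 hE, rfl⟩
  rw [himg]
  have : PolishSpace (NonemptyCompacts X) := inferInstance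
  exact hM.analyticSet_image measurable_dimH_nonemptyCompacts.ennreal_toReal
end

section
/- For every integer d ≥ 1 and every compact set K ⊆ ℝ^d, the set M_K of all microsets of K is an F_σ subset of the space 𝒦([0,1]^d) of nonempty compact subsets of [0,1]^d equipped with the Hausdorff metric, i.e. M_K is a countable union of closed subsets of 𝒦([0,1]^d). -/
open Filter MeasureTheory Set
open scoped ENNReal

/-- The unit cube `[0,1]^d` as a subtype of `ℝ^d`. -/
abbrev UnitCube (d : ℕ) : Type :=
  ↥(Set.univ.pi (fun _ : Fin d => Set.Icc (0 : ℝ) 1))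

theorem micro_closed_aux (d : ℕ) (A : Set (Set (Fin d → ℝ))) :
    IsClosed {C : TopologicalSpace.NonemptyCompacts (UnitCube d) |
      ∀ ε : ℝ≥0∞, 0 < ε → ∃ S ∈ A,
        Metric.hausdorffEDist S (Subtype.val '' (C : Set (UnitCube d))) < ε} := by
  rw [← isSeqClosed_iff_isClosed]
  intro c C hc hlim ε hε
  have h2 : 0 < ε / 2 := ENNReal.half_pos hε.ne'
  obtain ⟨n, hn⟩ := ((EMetric.tendsto_nhds.1 hlim) (ε / 2) h2).exists
  obtain ⟨S, hS, hlt⟩ := hc n (ε / 2) h2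
  refine ⟨S, hS, ?_⟩
  have he : Metric.hausdorffEDist (Subtype.val '' (c n : Set (UnitCube d)))
      (Subtype.val '' (C : Set (UnitCube d))) < ε / 2 := by
    rw [Metric.hausdorffEDist_image isometry_subtype_coe]
    exact hn
  calc _ ≤ _ := Metric.hausdorffEDist_triangle
    _ < ε / 2 + ε / 2 := ENNReal.add_lt_add hlt he
    _ = ε := ENNReal.add_halves ε

/-- The set of microsets of a compact `K ⊆ ℝ^d`, viewed inside the space `𝒦([0,1]^d)` of
nonempty compact subsets of the unit cube with the Hausdorff metric, is an `F_σ` set,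
i.e. a countable union of closed sets. -/
theorem statement4 (d : ℕ) (hd : 1 ≤ d) (K : Set (Fin d → ℝ)) (hK : IsCompact K) :
    ∃ F : ℕ → Set (TopologicalSpace.NonemptyCompacts (UnitCube d)),
      (∀ n, IsClosed (F n)) ∧
      {C : TopologicalSpace.NonemptyCompacts (UnitCube d) |
        IsMicroset d K (Subtype.val '' (C : Set (UnitCube d)))} = ⋃ n, F n := by
  let A : Set (Set (Fin d → ℝ)) := {S | ∃ (l : ℝ) (u : Fin d → ℝ), 1 ≤ l ∧
    S = ((fun z => l • z + u) '' K) ∩ Set.univ.pi (fun _ => Set.Icc (0 : ℝ) 1)}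
  let G : ℕ → Set (UnitCube d) := fun n =>
    Subtype.val ⁻¹' (Set.univ.pi (fun _ => Set.Icc (1 / ((n : ℝ) + 1)) (1 - 1 / ((n : ℝ) + 1))))
  refine ⟨fun n => {C | ∀ ε : ℝ≥0∞, 0 < ε → ∃ S ∈ A,
        Metric.hausdorffEDist S (Subtype.val '' (C : Set (UnitCube d))) < ε} ∩
      {C | ((C : Set (UnitCube d)) ∩ G n).Nonempty}, fun n => ?_, ?_⟩
  · refine (micro_closed_aux d A).inter
      (TopologicalSpace.NonemptyCompacts.isClosed_inter_nonempty_of_isClosed ?_)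
    exact (isClosed_set_pi fun _ _ => isClosed_Icc).preimage continuous_subtype_val
  · ext C
    rw [Set.mem_iUnion]
    constructor
    · rintro ⟨-, -, ⟨x, ⟨y, hy, rfl⟩, hx⟩, lam, u, hl, ht⟩
      have hev : ∀ᶠ n : ℕ in atTop, ∀ i : Fin d, 1 / ((n : ℝ) + 1) ≤ y.1 i ∧
          1 / ((n : ℝ) + 1) ≤ 1 - y.1 i := by
        rw [Filter.eventually_all]
        intro i
        have h := hx i (Set.mem_univ i)
        have h0 : 0 < y.1 i := h.1
        have h1 : 0 < 1 - y.1 i := sub_pos.2 h.2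
        have T := tendsto_one_div_add_atTop_nhds_zero_nat (𝕜 := ℝ)
        exact (T.eventually_le_const h0).and (T.eventually_le_const h1)
      obtain ⟨n, hn⟩ := hev.exists
      refine ⟨n, ?_, ⟨y, hy, ?_⟩⟩
      · intro ε hε
        obtain ⟨m, hm⟩ := (ht.eventually_lt_const hε).exists
        exact ⟨_, ⟨lam m, u m, hl m, rfl⟩, hm⟩
      · intro i _
        exact ⟨(hn i).1, by linarith [(hn i).2]⟩
    · rintro ⟨n, hC, ⟨y, hy, hG⟩⟩
      refine ⟨C.isCompact.image continuous_subtype_val, ?_, ⟨y.1, ⟨y, hy, rfl⟩, ?_⟩, ?_⟩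
      · rintro _ ⟨z, _, rfl⟩
        exact z.2
      · intro i hi
        have h := hG i hi
        have hp : 0 < 1 / ((n : ℝ) + 1) := by positivity
        exact ⟨hp.trans_le h.1, h.2.trans_lt (by linarith)⟩
      · have hp : ∀ m : ℕ, (0 : ℝ≥0∞) < ((m : ℝ≥0∞))⁻¹ := fun m => by simp
        choose S hS hlt using fun m : ℕ => hC _ (hp m)
        choose lam u hl hSe using hS
        refine ⟨lam, u, hl, ?_⟩
        refine tendsto_of_tendsto_of_tendsto_of_le_of_le tendsto_const_nhds
          ENNReal.tendsto_inv_nat_nhds_zero (fun _ => zero_le) (fun m => ?_)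
        have := (hlt m).le
        rw [hSe m] at this
        exact this
end

section
/- Let d ≥ 1 be an integer, let K ⊆ ℝ^d be a nonempty compact set, and let A ⊆ [0, dim_H K] be an analytic set. Then there exists a set 𝒞 of nonempty compact subsets of K that is compact in the Hausdorff metric and satisfies {dim_H C : C ∈ 𝒞} = A. -/
open Filter MeasureTheory Set
open scoped ENNReal

section Tree
open PiNat Topology

variable {ι : Type} 

/-- Weight of a set: least weight of a cylinder of level at least `k` containing it. -/
noncomputable def cw (w : ℕ → ℝ≥0∞) (k : ℕ) (t : Set (ℕ → ι)) : ℝ≥0∞ :=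
  ⨅ (x : ℕ → ι) (n : ℕ) (_ : k ≤ n) (_ : t ⊆ cylinder x n), w n

/-- Net content. -/
noncomputable def cM (w : ℕ → ℝ≥0∞) (k : ℕ) : OuterMeasure (ℕ → ι) :=
  OuterMeasure.boundedBy (cw w k)

lemma cw_le (w : ℕ → ℝ≥0∞) {k n : ℕ} {t : Set (ℕ → ι)} {x : ℕ → ι} (h : k ≤ n)
    (ht : t ⊆ cylinder x n) : cw w k t ≤ w n :=
  iInf_le_of_le x (iInf_le_of_le n (iInf_le_of_le h (iInf_le_of_le ht le_rfl)))

lemma cw_lt {w : ℕ → ℝ≥0∞} {k : ℕ} {t : Set (ℕ → ι)} {a : ℝ≥0∞} (h : cw w k t < a) :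
    ∃ x : ℕ → ι, ∃ n, k ≤ n ∧ t ⊆ cylinder x n ∧ w n < a := by
  simp only [cw, iInf_lt_iff] at h
  obtain ⟨x, n, h1, h2, h3⟩ := h
  exact ⟨x, n, h1, h2, h3⟩

lemma cw_empty [Nonempty ι] {w : ℕ → ℝ≥0∞} (hw : Tendsto w atTop (𝓝 0)) (k : ℕ) :
    cw w k (∅ : Set (ℕ → ι)) = 0 := by
  by_contra h
  have hpos : 0 < cw w k (∅ : Set (ℕ → ι)) := pos_iff_ne_zero.2 h
  obtain ⟨n, hn, hk⟩ := ((hw.eventually_lt_const hpos).and (eventually_ge_atTop k)).exists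
  obtain ⟨a⟩ := ‹Nonempty ι›
  exact absurd (cw_le w (x := fun _ => a) hk (empty_subset _)) (not_le.2 hn)

lemma cM_le_w (w : ℕ → ℝ≥0∞) {k n : ℕ} {t : Set (ℕ → ι)} {x : ℕ → ι} (h : k ≤ n)
    (ht : t ⊆ cylinder x n) : cM w k t ≤ w n :=
  (OuterMeasure.boundedBy_le _).trans (cw_le w h ht)

lemma cM_mono (w : ℕ → ℝ≥0∞) {k l : ℕ} (h : k ≤ l) (t : Set (ℕ → ι)) :
    cM w k t ≤ cM w l t := by
  refine OuterMeasure.le_boundedBy.2 (fun s => (OuterMeasure.boundedBy_le _).trans ?_) t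
  refine le_iInf fun x => le_iInf fun n => le_iInf fun h1 => le_iInf fun h2 => ?_
  exact cw_le w (h.trans h1) h2

lemma cyl_sub_or {x y : ℕ → ι} {j n : ℕ} (h : j ≤ n) :
    cylinder y n ⊆ cylinder x j ∨ Disjoint (cylinder y n) (cylinder x j) := by
  by_cases hd : Disjoint (cylinder y n) (cylinder x j)
  · exact Or.inr hd
  · left
    obtain ⟨z, hz1, hz2⟩ := not_disjoint_iff.1 hd
    intro u hu i hi
    rw [hu i (by lia), ← hz1 i (by lia), hz2 i hi]

lemma cM_cara [Nonempty ι] {w : ℕ → ℝ≥0∞} (hw : Tendsto w atTop (𝓝 0)) {j k : ℕ} (h : j ≤ k)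
    (x : ℕ → ι) (S : Set (ℕ → ι)) :
    cM w k S = cM w k (S ∩ cylinder x j) + cM w k (S \ cylinder x j) := by
  have := OuterMeasure.boundedBy_caratheodory (m := cw w k) (s := cylinder x j) (fun t => by
    refine le_iInf fun y => le_iInf fun n => le_iInf fun h1 => le_iInf fun h2 => ?_
    rcases cyl_sub_or (x := x) (y := y) (h.trans h1) with hs | hd
    · have : t \ cylinder x j = ∅ := sdiff_eq_empty.2 (h2.trans hs)
      rw [this, cw_empty hw, add_zero]
      exact cw_le w h1 (inter_subset_left.trans h2)
    · have : t ∩ cylinder x j = ∅ := (hd.mono_left h2).inter_eq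
      rw [this, cw_empty hw, zero_add]
      exact cw_le w h1 (sdiff_subset.trans h2))
  exact this S

lemma cM_min (w : ℕ → ℝ≥0∞) (n : ℕ) (S : Set (ℕ → ι)) :
    min (w n) (cM w (n + 1) S) ≤ cM w n S := by
  conv_rhs => rw [cM, OuterMeasure.boundedBy_apply]
  refine le_iInf fun t => le_iInf fun ht => ?_
  by_cases h : ∃ i, (t i).Nonempty ∧ w n ≤ cw w n (t i)
  · obtain ⟨i, hi, h⟩ := h
    refine (min_le_left _ _).trans (h.trans ?_)
    refine le_trans ?_ (ENNReal.le_tsum i)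
    exact le_iSup (fun _ : (t i).Nonempty => cw w n (t i)) hi
  · push Not at h
    refine (min_le_right _ _).trans ?_
    rw [cM, OuterMeasure.boundedBy_apply]
    refine iInf_le_of_le t (iInf_le_of_le ht ?_)
    refine ENNReal.tsum_le_tsum fun i => iSup_mono fun hi => ?_
    have hlt := h i hi
    refine le_iInf fun y => le_iInf fun m => le_iInf fun h1 => le_iInf fun h2 => ?_
    rcases h1.eq_or_lt with rfl | h1
    · obtain ⟨z, l, h3, h4, h5⟩ := cw_lt hlt
      have : n ≠ l := by rintro rfl; exact h5.false
      exact (cw_le w (by lia) h4).trans h5.le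
    · exact cw_le w h1 h2

lemma cM_zero {w : ℕ → ℝ≥0∞} (hpos : ∀ n, w n ≠ 0) {S : Set (ℕ → ι)} (h : cM w 0 S = 0) (n : ℕ) :
    cM w n S = 0 := by
  induction n with
  | zero => exact h
  | succ n ih =>
    have := cM_min w n S
    rw [ih, nonpos_iff_eq_zero] at this
    rcases min_eq_bot.1 this with h | h
    · exact absurd h (hpos n)
    · exact h

lemma cM_glue [Nonempty ι] {w : ℕ → ℝ≥0∞} (hw : Tendsto w atTop (𝓝 0)) (n : ℕ) (x : ℕ → ι)
    (E E' : Set (ℕ → ι)) (h1 : E \ cylinder x n = E' \ cylinder x n)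
    (h2 : cM w n (E ∩ cylinder x n) ≤ cM w n (E' ∩ cylinder x n)) :
    cM w 0 E ≤ cM w 0 E' := by
  induction n with
  | zero => simpa using h2
  | succ n ih =>
    have hsub : cylinder x (n + 1) ⊆ cylinder x n := cylinder_anti x n.le_succ
    have e1 : E \ cylinder x n = E' \ cylinder x n := by
      ext y
      have := Set.ext_iff.1 h1 y
      have := @hsub y
      simp only [Set.mem_sdiff] at *
      tauto
    refine ih e1 ?_
    have key : cM w (n + 1) (E ∩ cylinder x n) ≤ cM w (n + 1) (E' ∩ cylinder x n) := by
      rw [cM_cara hw (le_refl (n + 1)) x (E ∩ cylinder x n),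
        cM_cara hw (le_refl (n + 1)) x (E' ∩ cylinder x n)]
      have a1 : ∀ F : Set (ℕ → ι), F ∩ cylinder x n ∩ cylinder x (n + 1) =
          F ∩ cylinder x (n + 1) := fun F => by
        rw [inter_assoc, inter_eq_right.2 hsub]
      have a2 : ∀ F : Set (ℕ → ι), (F ∩ cylinder x n) \ cylinder x (n + 1) =
          (F \ cylinder x (n + 1)) ∩ cylinder x n := fun F => by
        ext; simp only [Set.mem_sdiff, mem_inter_iff]; tauto
      rw [a1, a1, a2, a2, h1]
      gcongr
    calc cM w n (E ∩ cylinder x n) ≤ min (w n) (cM w (n + 1) (E ∩ cylinder x n)) :=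
          le_min (cM_le_w w le_rfl inter_subset_right) (cM_mono w n.le_succ _)
      _ ≤ min (w n) (cM w (n + 1) (E' ∩ cylinder x n)) := by gcongr
      _ ≤ _ := cM_min w n _

lemma cM_sum_le [Nonempty ι] {w : ℕ → ℝ≥0∞} (hw : Tendsto w atTop (𝓝 0)) {n : ℕ} {α : Type*}
    (s : Finset α) (x : α → ℕ → ι)
    (hd : ∀ a b, a ≠ b → Disjoint (cylinder (x a) n) (cylinder (x b) n))
    (E : Set (ℕ → ι)) : ∑ a ∈ s, cM w n (E ∩ cylinder (x a) n) ≤ cM w n E := by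
  classical
  induction s using Finset.induction_on generalizing E with
  | empty => simp
  | insert a s ha ih =>
    rw [Finset.sum_insert ha, cM_cara hw (le_refl n) (x a) E]
    gcongr
    refine le_trans (le_of_eq ?_) (ih (E \ cylinder (x a) n))
    refine Finset.sum_congr rfl fun b hb => ?_
    congr 1
    ext y
    have hab : a ≠ b := by rintro rfl; exact ha hb
    have : y ∈ cylinder (x a) n → y ∉ cylinder (x b) n := fun h => Set.disjoint_left.1 (hd a b hab) h
    simp only [Set.mem_sdiff, mem_inter_iff]; tauto

lemma cM_level [Nonempty ι] [Finite ι] {w : ℕ → ℝ≥0∞} (hw : Tendsto w atTop (𝓝 0)) {n : ℕ}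
    (E : Set (ℕ → ι))
    (h : ∀ x, cM w (n + 1) (E ∩ cylinder x n) ≤ cM w n (E ∩ cylinder x n)) :
    cM w (n + 1) E ≤ cM w n E := by
  classical
  have := Fintype.ofFinite ι
  obtain ⟨a0⟩ := ‹Nonempty ι›
  have : Nonempty ι := ⟨a0⟩
  let ext : (Fin n → ι) → ℕ → ι := fun u i => if hi : i < n then u ⟨i, hi⟩ else a0
  have hE : E ⊆ ⋃ u, E ∩ cylinder (ext u) n := by
    intro y hy
    refine mem_iUnion.2 ⟨fun i => y i, hy, fun i hi => ?_⟩
    simp [ext, hi]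
  calc cM w (n + 1) E ≤ cM w (n + 1) (⋃ u, E ∩ cylinder (ext u) n) := measure_mono hE
    _ ≤ ∑ u, cM w (n + 1) (E ∩ cylinder (ext u) n) := measure_iUnion_fintype_le _ _
    _ ≤ ∑ u, cM w n (E ∩ cylinder (ext u) n) := Finset.sum_le_sum fun u _ => h _
    _ ≤ _ := cM_sum_le hw _ _ (fun u v huv => by
      refine Set.disjoint_left.2 fun y hy hy' => huv ?_
      funext i
      have h1 := hy i i.2
      have h2 := hy' i i.2
      simp only [ext, i.2, dite_true, Fin.eta] at h1 h2
      rw [← h1, ← h2]) E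

variable [TopologicalSpace ι] [DiscreteTopology ι]

lemma cM_open (w : ℕ → ℝ≥0∞) {S : Set (ℕ → ι)} {δ : ℝ≥0∞} (h : cM w 0 S < δ) :
    ∃ U, IsOpen U ∧ S ⊆ U ∧ cM w 0 U < δ := by
  have h' := h
  rw [cM, OuterMeasure.boundedBy_apply] at h'
  simp only [iInf_lt_iff] at h'
  obtain ⟨t, ht, hlt⟩ := h'
  obtain ⟨ε, hε, hlt2⟩ := ENNReal.exists_pos_sum_of_countable' (tsub_pos_of_lt hlt).ne' ℕ
  have hU : ∀ i, ∃ U, IsOpen U ∧ t i ⊆ U ∧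
      cM w 0 U ≤ (⨆ _ : (t i).Nonempty, cw w 0 (t i)) + ε i := by
    intro i
    rcases (t i).eq_empty_or_nonempty with he | hne
    · exact ⟨∅, isOpen_empty, he.subset, by simp⟩
    · rw [ciSup_pos hne]
      have hf : cw w 0 (t i) ≠ ∞ := by
        have h1 := ENNReal.le_tsum (f := fun n => ⨆ _ : (t n).Nonempty, cw w 0 (t n)) i
        simp only [ciSup_pos hne] at h1
        exact (h1.trans_lt (hlt.trans_le le_top)).ne
      obtain ⟨x, n, -, h2, h3⟩ := cw_lt (ENNReal.lt_add_right hf (hε i).ne')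
      exact ⟨cylinder x n, isOpen_cylinder _ x n, h2, (cM_le_w w (Nat.zero_le n) subset_rfl).trans h3.le⟩
  choose U hU1 hU2 hU3 using hU
  refine ⟨⋃ i, U i, isOpen_iUnion hU1, ht.trans (iUnion_mono hU2), ?_⟩
  calc cM w 0 (⋃ i, U i) ≤ ∑' i, cM w 0 (U i) := measure_iUnion_le _
    _ ≤ ∑' i, ((⨆ _ : (t i).Nonempty, cw w 0 (t i)) + ε i) := ENNReal.tsum_le_tsum hU3
    _ = (∑' i, ⨆ _ : (t i).Nonempty, cw w 0 (t i)) + ∑' i, ε i := ENNReal.tsum_add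
    _ < δ := lt_tsub_iff_left.1 hlt2

lemma exists_min [Nonempty ι] [Finite ι] {w : ℕ → ℝ≥0∞} (hw : Tendsto w atTop (𝓝 0))
    (hfin : ∀ n, w n ≠ ∞) {K : Set (ℕ → ι)} (hK : IsClosed K) :
    ∃ E ⊆ K, IsClosed E ∧ cM w 0 K ≤ cM w 0 E ∧ ∀ n, cM w n E ≤ cM w 0 E := by
  have hz := zorn_superset_nonempty {E : Set (ℕ → ι) | IsClosed E ∧ cM w 0 K ≤ cM w 0 E} (by
    intro c hc hchain hne
    refine ⟨⋂₀ c, ⟨isClosed_sInter fun s hs => (hc hs).1, ?_⟩, fun s hs => sInter_subset_of_mem hs⟩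
    by_contra hlt
    obtain ⟨U, hU, hsub, hlt⟩ := cM_open w (not_le.1 hlt)
    have : Nonempty c := hne.to_subtype
    have hdir : DirectedOn (· ⊇ ·) c := fun a ha b hb => by
      rcases hchain.total ha hb with h | h
      · exact ⟨a, ha, subset_rfl, h⟩
      · exact ⟨b, hb, h, subset_rfl⟩
    obtain ⟨⟨s, hs⟩, hsU⟩ := exists_subset_nhds_of_isCompact' (V := fun s : c => (s : Set (ℕ → ι)))
      (directedOn_iff_directed.1 hdir) (fun s => (hc s.2).1.isCompact) (fun s => (hc s.2).1)
      (U := U) (fun x hx => hU.mem_nhds (hsub (by simpa [sInter_eq_iInter] using hx)))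
    exact absurd ((hc hs).2.trans (measure_mono hsU)) (not_le.2 hlt)) K ⟨hK, le_rfl⟩
  obtain ⟨E, hEK, hE⟩ := hz
  refine ⟨E, hEK, hE.prop.1, hE.prop.2, fun n => ?_⟩
  induction n with
  | zero => rfl
  | succ n ih =>
    refine (cM_level hw E fun x => ?_).trans ih
    by_contra hlt
    rw [not_le] at hlt
    have hmin := cM_min w n (E ∩ cylinder x n)
    have h1 : w n ≤ cM w n (E ∩ cylinder x n) := by
      rcases min_le_iff.1 hmin with h | h
      · exact h
      · exact absurd h (not_le.2 hlt)
    have h2 : w n < cM w (n + 1) (E ∩ cylinder x n) := h1.trans_lt hlt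
    have hne : (E ∩ cylinder x n).Nonempty := by
      by_contra hne
      rw [not_nonempty_iff_eq_empty.1 hne] at h2
      simp at h2
    obtain ⟨y, hyE, hyx⟩ := hne
    have h3 : Tendsto (fun N => w n + w N) atTop (𝓝 (w n + 0)) := tendsto_const_nhds.add hw
    rw [add_zero] at h3
    obtain ⟨N, hN, hNn⟩ := ((h3.eventually_lt_const h2).and (eventually_ge_atTop (n + 1))).exists
    have hVQ : cylinder y N ⊆ cylinder x n := fun z hz i hi => by
      rw [hz i (by lia), hyx i hi]
    have h4 : cM w (n + 1) (E ∩ cylinder x n) ≤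
        cM w (n + 1) ((E \ cylinder y N) ∩ cylinder x n) + w N := by
      calc _ ≤ cM w (n + 1) ((E \ cylinder y N) ∩ cylinder x n ∪ cylinder y N) :=
            measure_mono (fun z hz => by
              by_cases hzV : z ∈ cylinder y N
              · exact Or.inr hzV
              · exact Or.inl ⟨⟨hz.1, hzV⟩, hz.2⟩)
        _ ≤ _ := (measure_union_le _ _).trans (by gcongr; exact cM_le_w w hNn subset_rfl)
    have h5 : w n ≤ cM w (n + 1) ((E \ cylinder y N) ∩ cylinder x n) :=
      ENNReal.le_of_add_le_add_right (hfin N) (hN.le.trans h4)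
    have h6 : w n ≤ cM w n ((E \ cylinder y N) ∩ cylinder x n) :=
      (le_min le_rfl h5).trans (cM_min w n _)
    have h7 := cM_glue hw n x E (E \ cylinder y N) (by
      ext z
      have := @hVQ z
      simp only [Set.mem_sdiff]; tauto)
      ((cM_le_w w le_rfl inter_subset_right).trans h6)
    have hcl : IsClosed (E \ cylinder y N) :=
      hE.prop.1.sdiff (isOpen_cylinder _ y N)
    have := hE.le_of_le (y := E \ cylinder y N) ⟨hcl, hE.prop.2.trans h7⟩ sdiff_subset
    exact (this hyE).2 (self_mem_cylinder y N)

end Tree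

section Coding
open PiNat Topology

/-- Coding map from digit sequences to the cube of side `L`. -/
noncomputable def cpi (L : ℝ) (d : ℕ) (x : ℕ → Fin d → Fin 2) : Fin d → ℝ :=
  fun i => L * (Real.ofDigits (fun n => x n i) - 1 / 2)

/-- Integer formed by the first `n` digits. -/
def cN {d : ℕ} (x : ℕ → Fin d → Fin 2) (i : Fin d) : ℕ → ℕ
  | 0 => 0
  | n + 1 => 2 * cN x i n + (x n i : ℕ)

lemma cN_sum {d : ℕ} (x : ℕ → Fin d → Fin 2) (i : Fin d) (n : ℕ) :
    ∑ j ∈ Finset.range n, Real.ofDigitsTerm (fun n => x n i) j = cN x i n * ((2 : ℝ) ^ n)⁻¹ := by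
  induction n with
  | zero => simp [cN]
  | succ n ih =>
    rw [Finset.sum_range_succ, ih]
    simp only [Real.ofDigitsTerm, cN]
    push_cast
    field_simp
    ring

lemma cN_ofDigits {d : ℕ} (x : ℕ → Fin d → Fin 2) (i : Fin d) (n : ℕ) :
    (cN x i n : ℝ) ≤ 2 ^ n * Real.ofDigits (fun n => x n i) ∧
    2 ^ n * Real.ofDigits (fun n => x n i) ≤ cN x i n + 1 := by
  have h := Real.ofDigits_eq_sum_add_ofDigits (fun n => x n i) n
  rw [cN_sum] at h
  have h1 := Real.ofDigits_nonneg (fun j => x (j + n) i)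
  have h2 := Real.ofDigits_le_one (fun j => x (j + n) i)
  have : 2 ^ n * Real.ofDigits (fun n => x n i) = cN x i n + Real.ofDigits (fun j => x (j + n) i) := by
    rw [h]; push_cast; field_simp
  constructor <;> linarith

lemma cN_inj {d : ℕ} {x y : ℕ → Fin d → Fin 2} {i : Fin d} {n : ℕ} (h : cN x i n = cN y i n) :
    ∀ j < n, x j i = y j i := by
  induction n with
  | zero => simp
  | succ n ih =>
    simp only [cN] at h
    have h1 := (x n i).2
    have h2 := (y n i).2
    intro j hj
    rcases Nat.lt_succ_iff_lt_or_eq.1 hj with h3 | rfl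
    · exact ih (by lia) j h3
    · apply Fin.ext; lia

lemma cpi_cont (L : ℝ) (d : ℕ) : Continuous (cpi L d) := by
  refine continuous_pi fun i => ?_
  have h : Continuous fun x : ℕ → Fin d → Fin 2 => (fun n => x n i : ℕ → Fin 2) := by fun_prop
  exact continuous_const.mul ((Real.continuous_ofDigits.comp h).sub continuous_const)

lemma cpi_surj {L : ℝ} (hL : 0 < L) {d : ℕ} {y : Fin d → ℝ} (hy : ‖y‖ ≤ L / 2) :
    ∃ x, cpi L d x = y := by
  have h : ∀ i, ∃ a : ℕ → Fin 2, Real.ofDigits a = y i / L + 1 / 2 := fun i => by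
    have h1 := (norm_le_pi_norm y i).trans hy
    rw [Real.norm_eq_abs, abs_le] at h1
    obtain ⟨a, -, ha⟩ := Real.ofDigits_SurjOn (b := 2) (by norm_num)
      (show y i / L + 1 / 2 ∈ Set.Icc (0 : ℝ) 1 by
        constructor
        · have : -(1 / 2) ≤ y i / L := by rw [le_div_iff₀ hL]; linarith
          linarith
        · have : y i / L ≤ 1 / 2 := by rw [div_le_iff₀ hL]; linarith
          linarith)
    exact ⟨a, ha⟩
  choose a ha using h
  refine ⟨fun n i => a i n, funext fun i => ?_⟩
  simp only [cpi, ha]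
  field_simp
  ring

/-- the weights -/
noncomputable def cwt (L c : ℝ) (n : ℕ) : ℝ≥0∞ := ENNReal.ofReal (L * (2 ^ n)⁻¹) ^ c

lemma cpi_ediam {L : ℝ} (hL : 0 < L) {d : ℕ} {t : Set (ℕ → Fin d → Fin 2)} {x : ℕ → Fin d → Fin 2}
    {n : ℕ} (ht : t ⊆ cylinder x n) :
    Metric.ediam (cpi L d '' t) ≤ ENNReal.ofReal (L * (2 ^ n)⁻¹) := by
  refine Metric.ediam_le ?_
  rintro _ ⟨y, hy, rfl⟩ _ ⟨z, hz, rfl⟩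
  rw [edist_dist]
  refine ENNReal.ofReal_le_ofReal ((dist_pi_le_iff (by positivity)).2 fun i => ?_)
  have := Real.abs_ofDigits_sub_ofDigits_le (x := fun n => y n i) (y := fun n => z n i) (n := n)
    (fun j hj => by
      have h1 := ht hy j hj
      have h2 := ht hz j hj
      simp only [h1, h2])
  rw [Real.dist_eq, cpi, cpi, ← mul_sub, sub_sub_sub_cancel_right, abs_mul, abs_of_pos hL]
  push_cast at this
  gcongr

lemma tendsto_scale (L : ℝ) : Tendsto (fun n : ℕ => ENNReal.ofReal (L * (2 ^ n)⁻¹)) atTop (𝓝 0) := by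
  have h : Tendsto (fun n : ℕ => L * ((2 : ℝ) ^ n)⁻¹) atTop (𝓝 (L * 0)) := by
    refine tendsto_const_nhds.mul ?_
    simpa using tendsto_pow_atTop_nhds_zero_of_lt_one (r := (2 : ℝ)⁻¹) (by norm_num) (by norm_num)
  simpa using ENNReal.tendsto_ofReal h

lemma cwt_tendsto (L : ℝ) {c : ℝ} (hc : 0 < c) : Tendsto (cwt L c) atTop (𝓝 0) := by
  have := (tendsto_scale L).ennrpow_const c
  rwa [ENNReal.zero_rpow_of_pos hc] at this

lemma cwt_fin (L : ℝ) {c : ℝ} (hc : 0 < c) (n : ℕ) : cwt L c n ≠ ∞ :=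
  ENNReal.rpow_ne_top_of_nonneg hc.le ENNReal.ofReal_ne_top

lemma cwt_ne {L : ℝ} (hL : 0 < L) {c : ℝ} (hc : 0 < c) (n : ℕ) : cwt L c n ≠ 0 := by
  unfold cwt
  simp only [ne_eq, ENNReal.rpow_eq_zero_iff, ENNReal.ofReal_eq_zero, not_or, not_and, not_lt]
  have : 0 < L * ((2 : ℝ) ^ n)⁻¹ := by positivity
  exact ⟨fun h => by linarith, fun h => absurd h ENNReal.ofReal_ne_top⟩

lemma haus_le {L : ℝ} (hL : 0 < L) {c : ℝ} (hc : 0 < c) {d : ℕ} (S : Set (ℕ → Fin d → Fin 2)) :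
    (μH[c] : Measure (Fin d → ℝ)) (cpi L d '' S) ≤ ⨆ n, cM (cwt L c) n S := by
  have e : (μH[c] : Measure (Fin d → ℝ)) (cpi L d '' S) =
      OuterMeasure.mkMetric (fun r => r ^ c) (cpi L d '' S) := by
    rw [OuterMeasure.coe_mkMetric]; rfl
  rw [e, OuterMeasure.mkMetric, OuterMeasure.mkMetric']
  simp only [OuterMeasure.iSup_apply]
  refine iSup_le fun r => iSup_le fun hr => ?_
  obtain ⟨n, hn⟩ := ((tendsto_scale L).eventually_lt_const hr).exists
  refine le_trans ?_ (le_iSup _ n)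
  have key : OuterMeasure.comap (cpi L d)
      (OuterMeasure.mkMetric'.pre (fun s => Metric.ediam s ^ c) r) ≤ cM (cwt L c) n := by
    refine OuterMeasure.le_boundedBy.2 fun t => ?_
    rw [OuterMeasure.comap_apply]
    refine le_iInf fun x => le_iInf fun k => le_iInf fun hk => le_iInf fun ht => ?_
    have h1 := cpi_ediam hL ht
    refine (OuterMeasure.mkMetric'.pre_le (h1.trans (le_trans ?_ hn.le))).trans ?_
    · refine ENNReal.ofReal_le_ofReal ?_
      gcongr
      norm_num
    · exact ENNReal.rpow_le_rpow h1 hc.le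
  have := key S
  rwa [OuterMeasure.comap_apply] at this

lemma cM_preimage {L : ℝ} (hL : 0 < L) {c : ℝ} {d : ℕ} {T : Set (Fin d → ℝ)} {n : ℕ}
    (hT : Metric.ediam T ≤ ENNReal.ofReal (L * (2 ^ n)⁻¹)) :
    cM (cwt L c) 0 (cpi L d ⁻¹' T) ≤ 5 ^ d * cwt L c n := by
  rcases (cpi L d ⁻¹' T).eq_empty_or_nonempty with he | ⟨x0, hx0⟩
  · rw [he]; simp
  let P : (Fin d → Fin 5) → Set (ℕ → Fin d → Fin 2) :=
    fun v => {x | ∀ i, cN x i n + 2 = cN x0 i n + (v i : ℕ)}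
  have hcov : cpi L d ⁻¹' T ⊆ ⋃ v, P v := by
    intro x hx
    have hk : ∀ i, cN x0 i n ≤ cN x i n + 2 ∧ cN x i n + 2 < cN x0 i n + 5 := by
      intro i
      have h1 : dist (cpi L d x) (cpi L d x0) ≤ L * (2 ^ n)⁻¹ := by
        have := (Metric.edist_le_ediam_of_mem (show cpi L d x ∈ T from hx)
          (show cpi L d x0 ∈ T from hx0)).trans hT
        rw [edist_dist] at this
        exact (ENNReal.ofReal_le_ofReal_iff (by positivity)).1 this
      have h2 := (dist_le_pi_dist (cpi L d x) (cpi L d x0) i).trans h1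
      rw [Real.dist_eq, cpi, cpi, ← mul_sub, sub_sub_sub_cancel_right, abs_mul, abs_of_pos hL] at h2
      have h3 := le_of_mul_le_mul_left h2 hL
      have h4 : (2 : ℝ) ^ n * |Real.ofDigits (fun n => x n i) - Real.ofDigits (fun n => x0 n i)| ≤ 1 := by
        calc _ ≤ (2 : ℝ) ^ n * (2 ^ n)⁻¹ := by gcongr
          _ = 1 := by field_simp
      rw [← abs_of_pos (show (0 : ℝ) < 2 ^ n by positivity), ← abs_mul, mul_sub, abs_le] at h4
      have h5 := cN_ofDigits x i n
      have h6 := cN_ofDigits x0 i n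
      have a : (cN x0 i n : ℝ) ≤ cN x i n + 2 := by linarith
      have b : (cN x i n : ℝ) ≤ cN x0 i n + 2 := by linarith
      have a' : cN x0 i n ≤ cN x i n + 2 := by exact_mod_cast a
      have b' : cN x i n ≤ cN x0 i n + 2 := by exact_mod_cast b
      lia
    refine mem_iUnion.2 ⟨fun i => ⟨cN x i n + 2 - cN x0 i n, by have := hk i; lia⟩, fun i => ?_⟩
    have := hk i
    simp only
    lia
  have hP : ∀ v, cM (cwt L c) 0 (P v) ≤ cwt L c n := by
    intro v
    rcases (P v).eq_empty_or_nonempty with he | ⟨x, hx⟩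
    · rw [he]; simp
    · refine cM_le_w (x := x) _ (Nat.zero_le n) fun y hy j hj => ?_
      funext i
      refine cN_inj ?_ j hj
      have h1 := hx i
      have h2 := hy i
      lia
  calc _ ≤ cM (cwt L c) 0 (⋃ v, P v) := measure_mono hcov
    _ ≤ ∑ v, cM (cwt L c) 0 (P v) := measure_iUnion_fintype_le _ _
    _ ≤ ∑ v : Fin d → Fin 5, cwt L c n := Finset.sum_le_sum fun v _ => hP v
    _ = _ := by simp

lemma le_haus {L : ℝ} (hL : 0 < L) {c : ℝ} (hc : 0 < c) {d : ℕ} (S : Set (ℕ → Fin d → Fin 2)) :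
    cM (cwt L c) 0 S ≤ (5 ^ d * 2 ^ c) * (μH[c] : Measure (Fin d → ℝ)) (cpi L d '' S) := by
  have e : (μH[c] : Measure (Fin d → ℝ)) (cpi L d '' S) =
      OuterMeasure.mkMetric (fun r => r ^ c) (cpi L d '' S) := by
    rw [OuterMeasure.coe_mkMetric]; rfl
  have hC : (5 ^ d * 2 ^ c : ℝ≥0∞) ≠ ∞ :=
    ENNReal.mul_ne_top (by simp) (ENNReal.rpow_ne_top_of_nonneg hc.le (by simp))
  have hC0 : (5 ^ d * 2 ^ c : ℝ≥0∞) ≠ 0 := by simp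
  have key : OuterMeasure.map (cpi L d) (cM (cwt L c) 0) ≤
      OuterMeasure.mkMetric ((5 ^ d * 2 ^ c : ℝ≥0∞) • (fun r : ℝ≥0∞ => r ^ c)) := by
    refine OuterMeasure.le_mkMetric _ _ (ENNReal.ofReal L) (by simpa using hL) fun T hT => ?_
    rw [OuterMeasure.map_apply]
    simp only [Pi.smul_apply, smul_eq_mul]
    rcases eq_or_ne (Metric.ediam T) 0 with h0 | h0
    · have h1 : ∀ n, cM (cwt L c) 0 (cpi L d ⁻¹' T) ≤ 5 ^ d * cwt L c n := fun n =>
        cM_preimage hL (by rw [h0]; exact zero_le)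
      have h2 : Tendsto (fun n => 5 ^ d * cwt L c n) atTop (𝓝 (5 ^ d * 0)) :=
        ENNReal.Tendsto.const_mul (cwt_tendsto L hc) (Or.inr (by simp))
      have h3 := ge_of_tendsto' h2 h1
      rw [mul_zero] at h3
      exact h3.trans zero_le
    · have hfin : Metric.ediam T ≠ ∞ := (hT.trans_lt ENNReal.ofReal_lt_top).ne
      set δ := (Metric.ediam T).toReal with hδ
      have hδe : Metric.ediam T = ENNReal.ofReal δ := (ENNReal.ofReal_toReal hfin).symm
      have hδ0 : 0 < δ := ENNReal.toReal_pos h0 hfin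
      have hδL : δ ≤ L := by
        rw [hδe] at hT
        exact (ENNReal.ofReal_le_ofReal_iff hL.le).1 hT
      obtain ⟨n, hn1, hn2⟩ := exists_nat_pow_near_of_lt_one (x := δ / L) (y := (2 : ℝ)⁻¹)
        (by positivity) (by rw [div_le_one hL]; exact hδL) (by norm_num) (by norm_num)
      rw [div_le_iff₀ hL, inv_pow] at hn2
      rw [lt_div_iff₀ hL, pow_succ, inv_pow] at hn1
      refine (cM_preimage hL (n := n) (by
        rw [hδe]; exact ENNReal.ofReal_le_ofReal (by linarith))).trans ?_
      rw [mul_assoc, ← ENNReal.mul_rpow_of_nonneg _ _ hc.le]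
      gcongr
      unfold cwt
      refine ENNReal.rpow_le_rpow ?_ hc.le
      rw [hδe, show (2 : ℝ≥0∞) = ENNReal.ofReal 2 by simp, ← ENNReal.ofReal_mul (by norm_num)]
      exact ENNReal.ofReal_le_ofReal (by linarith)
  rw [OuterMeasure.mkMetric_smul _ hC hC0] at key
  have h := key (cpi L d '' S)
  rw [OuterMeasure.map_apply] at h
  rw [e]
  exact (measure_mono (subset_preimage_image _ _)).trans h

/-- A compact set contains compact subsets of every smaller dimension. -/
lemma exists_dim {d : ℕ} {K : Set (Fin d → ℝ)} (hK : IsCompact K) {c : ℝ} (hc : 0 < c)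
    (hcK : ENNReal.ofReal c < dimH K) : ∃ C ⊆ K, IsCompact C ∧ dimH C = ENNReal.ofReal c := by
  obtain ⟨R, hR0, hR⟩ := hK.isBounded.exists_pos_norm_le
  set L := 2 * R with hLdef
  have hL : 0 < L := by positivity
  set K' := cpi L d ⁻¹' K with hK'
  have himg : cpi L d '' K' = K := by
    refine image_preimage_eq_of_subset fun y hy => ?_
    obtain ⟨x, hx⟩ := cpi_surj hL (y := y) (by rw [hLdef]; linarith [hR y hy])
    exact ⟨x, hx⟩
  have hK'c : IsClosed K' := hK.isClosed.preimage (cpi_cont L d)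
  have hpos : cM (cwt L c) 0 K' ≠ 0 := by
    intro h
    have h1 := haus_le hL hc K'
    simp only [cM_zero (cwt_ne hL hc) h, iSup_const, himg] at h1
    have h2 : (μH[((c.toNNReal : NNReal) : ℝ)] : Measure (Fin d → ℝ)) K = ∞ :=
      hausdorffMeasure_of_lt_dimH hcK
    rw [Real.coe_toNNReal c hc.le] at h2
    rw [h2] at h1
    simp at h1
  obtain ⟨E, hEK, hEc, hE1, hE2⟩ := exists_min (cwt_tendsto L hc) (cwt_fin L hc) hK'c
  refine ⟨cpi L d '' E, by rw [← himg]; exact image_mono hEK, hEc.isCompact.image (cpi_cont L d), ?_⟩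
  apply le_antisymm
  · have : (μH[((c.toNNReal : NNReal) : ℝ)] : Measure (Fin d → ℝ)) (cpi L d '' E) ≠ ∞ := by
      rw [Real.coe_toNNReal c hc.le]
      have h1 : cM (cwt L c) 0 E ≤ cwt L c 0 :=
        cM_le_w (x := fun _ _ => 0) _ le_rfl (by simp)
      exact (((haus_le hL hc E).trans (iSup_le hE2)).trans_lt
        (h1.trans_lt (lt_top_iff_ne_top.2 (cwt_fin L hc 0)))).ne
    exact dimH_le_of_hausdorffMeasure_ne_top this
  · have : (μH[((c.toNNReal : NNReal) : ℝ)] : Measure (Fin d → ℝ)) (cpi L d '' E) ≠ 0 := by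
      rw [Real.coe_toNNReal c hc.le]
      intro h0
      have h1 := le_haus hL hc E
      rw [h0, mul_zero] at h1
      exact hpos (le_antisymm (hE1.trans h1) zero_le)
    exact le_dimH_of_hausdorffMeasure_ne_zero this

end Coding

section Realize
open Topology TopologicalSpace

lemma fin_approx {E : Type*} [MetricSpace E] (M : NonemptyCompacts E) {ε : ℝ} (hε : 0 < ε) :
    ∃ F : NonemptyCompacts E, (F : Set E) ⊆ M ∧ (F : Set E).Finite ∧ dist F M ≤ ε := by
  obtain ⟨t, htM, htf, hcov⟩ := M.isCompact.finite_cover_balls hε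
  have hne : t.Nonempty := by
    obtain ⟨x, hx⟩ := M.nonempty
    obtain ⟨y, hy, -⟩ := mem_iUnion₂.1 (hcov hx)
    exact ⟨y, hy⟩
  refine ⟨⟨⟨t, htf.isCompact⟩, hne⟩, htM, htf, ?_⟩
  rw [Metric.NonemptyCompacts.dist_eq]
  refine Metric.hausdorffDist_le_of_mem_dist hε.le (fun x hx => ⟨x, htM hx, by simpa using hε.le⟩) ?_
  intro x hx
  obtain ⟨y, hy, hxy⟩ := mem_iUnion₂.1 (hcov hx)
  exact ⟨y, hy, (Metric.mem_ball.1 hxy).le⟩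

lemma rel_one {X : Type*} [TopologicalSpace X] [CompactSpace X] {E : Type*} [MetricSpace E]
    (M : NonemptyCompacts E) (δ : X → ℝ) (hδ : Continuous δ) (h0 : ∀ x, 0 ≤ δ x)
    (h1 : ∀ x, δ x ≤ 1) :
    ∃ R : Set (X × NonemptyCompacts E), IsCompact R ∧ (∀ x, ∃ C, (x, C) ∈ R) ∧
      ∀ q ∈ R, (q.2 : Set E) ⊆ M ∧ (δ q.1 = 0 → dimH (q.2 : Set E) = dimH (M : Set E)) ∧
        (δ q.1 ≠ 0 → dimH (q.2 : Set E) = 0) := by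
  choose F hF1 hF2 hF3 using fun k : ℕ => fin_approx M (ε := (2⁻¹ : ℝ) ^ k) (by positivity)
  have hp : Tendsto (fun k : ℕ => (2⁻¹ : ℝ) ^ k) atTop (𝓝 0) :=
    tendsto_pow_atTop_nhds_zero_of_lt_one (by norm_num) (by norm_num)
  have hF : Tendsto F atTop (𝓝 M) :=
    tendsto_iff_dist_tendsto_zero.2 (squeeze_zero (fun _ => dist_nonneg) hF3 hp)
  have hS := (hp.prodMk_nhds hF).isCompact_insert_range
  set S : Set (ℝ × NonemptyCompacts E) := insert (0, M) (range fun k => ((2⁻¹ : ℝ) ^ k, F k))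
  have hcl : IsClosed {q : X × ℝ × NonemptyCompacts E | q.2.1 / 2 ≤ δ q.1 ∧ δ q.1 ≤ q.2.1} := by
    have c1 : IsClosed {q : X × ℝ × NonemptyCompacts E | q.2.1 / 2 ≤ δ q.1} :=
      isClosed_le (by fun_prop) (by fun_prop)
    have c2 : IsClosed {q : X × ℝ × NonemptyCompacts E | δ q.1 ≤ q.2.1} :=
      isClosed_le (by fun_prop) (by fun_prop)
    exact c1.inter c2
  refine ⟨(fun q : X × ℝ × NonemptyCompacts E => (q.1, q.2.2)) ''
    ((univ ×ˢ S) ∩ {q | q.2.1 / 2 ≤ δ q.1 ∧ δ q.1 ≤ q.2.1}), ?_, ?_, ?_⟩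
  · exact ((isCompact_univ.prod hS).inter_right hcl).image (by fun_prop)
  · intro x
    rcases (h0 x).eq_or_lt with h | h
    · exact ⟨M, (x, 0, M), ⟨⟨mem_univ _, mem_insert _ _⟩, by simp [← h]⟩, rfl⟩
    · obtain ⟨k, hk1, hk2⟩ := exists_nat_pow_near_of_lt_one (x := δ x) (y := (2 : ℝ)⁻¹)
        h (h1 x) (by norm_num) (by norm_num)
      refine ⟨F k, (x, (2⁻¹ : ℝ) ^ k, F k), ⟨⟨mem_univ _, mem_insert_of_mem _ ⟨k, rfl⟩⟩, ?_, hk2⟩, rfl⟩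
      rw [pow_succ] at hk1
      simp only
      linarith
  · rintro _ ⟨⟨x, r, C⟩, ⟨⟨-, hS'⟩, hr1, hr2⟩, rfl⟩
    simp only at hr1 hr2 hS' ⊢
    rcases hS' with h | ⟨k, hk⟩
    · obtain ⟨rfl, rfl⟩ := Prod.mk.inj h
      refine ⟨subset_rfl, fun _ => rfl, fun h => absurd (le_antisymm hr2 (h0 x)) h⟩
    · obtain ⟨rfl, rfl⟩ := Prod.mk.inj hk
      refine ⟨hF1 k, fun h => ?_, fun _ => (hF2 k).dimH_zero⟩
      have : (0 : ℝ) < 2⁻¹ ^ k := by positivity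
      linarith

/-- finite partial unions -/
def uN {E : Type*} [MetricSpace E] (p : E) (C : ℕ → NonemptyCompacts E) : ℕ → NonemptyCompacts E
  | 0 => {p}
  | n + 1 => uN p C n ⊔ C n

lemma mem_uN {E : Type*} [MetricSpace E] (p : E) (C : ℕ → NonemptyCompacts E) (n : ℕ) (x : E) :
    x ∈ (uN p C n : Set E) ↔ x = p ∨ ∃ j < n, x ∈ (C j : Set E) := by
  induction n with
  | zero => simp [uN]
  | succ n ih =>
    rw [uN, NonemptyCompacts.coe_sup, mem_union, ih]
    constructor
    · rintro ((h | ⟨j, hj, h⟩) | h)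
      · exact Or.inl h
      · exact Or.inr ⟨j, by lia, h⟩
      · exact Or.inr ⟨n, by lia, h⟩
    · rintro (h | ⟨j, hj, h⟩)
      · exact Or.inl (Or.inl h)
      · rcases Nat.lt_succ_iff_lt_or_eq.1 hj with h3 | rfl
        · exact Or.inl (Or.inr ⟨j, h3, h⟩)
        · exact Or.inr h

lemma uN_cont {E : Type*} [MetricSpace E] (p : E) (n : ℕ) :
    Continuous fun C : ℕ → NonemptyCompacts E => uN p C n := by
  induction n with
  | zero => exact continuous_const
  | succ n ih => exact ih.sup (continuous_apply n)

lemma uU_compact {E : Type*} [MetricSpace E] (p : E) (C : ℕ → NonemptyCompacts E)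
    (hC : ∀ j, (C j : Set E) ⊆ Metric.closedBall p (2⁻¹ ^ j)) :
    IsCompact (insert p (⋃ j, (C j : Set E))) := by
  rw [isCompact_iff_ultrafilter_le_nhds]
  intro f hf
  rw [le_principal_iff] at hf
  by_cases h : ∃ n, (uN p C n : Set E) ∈ f
  · obtain ⟨n, hn⟩ := h
    obtain ⟨x, hx, hfx⟩ := isCompact_iff_ultrafilter_le_nhds.1 (uN p C n).isCompact f
      (le_principal_iff.2 hn)
    refine ⟨x, ?_, hfx⟩
    rcases (mem_uN p C n x).1 hx with h | ⟨j, -, h⟩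
    · exact Or.inl h
    · exact Or.inr (mem_iUnion.2 ⟨j, h⟩)
  · push Not at h
    refine ⟨p, mem_insert _ _, ?_⟩
    rw [Metric.nhds_basis_closedBall.ge_iff]
    intro ε hε
    obtain ⟨n, hn⟩ := exists_pow_lt_of_lt_one hε (show (2⁻¹ : ℝ) < 1 by norm_num)
    have h2 := Ultrafilter.compl_mem_iff_notMem.2 (h n)
    filter_upwards [hf, h2] with x hx1 hx2
    rw [mem_compl_iff, mem_uN] at hx2
    push Not at hx2
    rcases hx1 with hx1 | hx1
    · exact absurd hx1 hx2.1
    · obtain ⟨j, hj⟩ := mem_iUnion.1 hx1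
      have hjn : n ≤ j := by
        by_contra hlt
        exact hx2.2 j (not_le.1 hlt) hj
      refine Metric.closedBall_subset_closedBall ?_ (hC j hj)
      exact (pow_le_pow_of_le_one (by norm_num) (by norm_num) hjn).trans hn.le

open Classical in
/-- full union -/
noncomputable def uU {E : Type*} [MetricSpace E] (p : E) (C : ℕ → NonemptyCompacts E) :
    NonemptyCompacts E :=
  if h : IsCompact (insert p (⋃ j, (C j : Set E))) then ⟨⟨_, h⟩, insert_nonempty _ _⟩ else {p}

lemma uU_coe {E : Type*} [MetricSpace E] (p : E) (C : ℕ → NonemptyCompacts E)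
    (hC : ∀ j, (C j : Set E) ⊆ Metric.closedBall p (2⁻¹ ^ j)) :
    (uU p C : Set E) = insert p (⋃ j, (C j : Set E)) := by
  rw [uU, dif_pos (uU_compact p C hC)]
  rfl

lemma uU_dist {E : Type*} [MetricSpace E] (p : E) (C : ℕ → NonemptyCompacts E)
    (hC : ∀ j, (C j : Set E) ⊆ Metric.closedBall p (2⁻¹ ^ j)) (n : ℕ) :
    dist (uU p C) (uN p C n) ≤ 2⁻¹ ^ n := by
  have hn : (0 : ℝ) ≤ 2⁻¹ ^ n := by positivity
  rw [Metric.NonemptyCompacts.dist_eq, uU_coe p C hC]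
  refine Metric.hausdorffDist_le_of_mem_dist hn ?_ ?_
  · intro x hx
    by_cases hxn : x ∈ (uN p C n : Set E)
    · exact ⟨x, hxn, by simpa using hn⟩
    · refine ⟨p, (mem_uN p C n p).2 (Or.inl rfl), ?_⟩
      rw [mem_uN] at hxn
      push Not at hxn
      rcases hx with hx | hx
      · exact absurd hx hxn.1
      · obtain ⟨j, hj⟩ := mem_iUnion.1 hx
        have hjn : n ≤ j := by
          by_contra hlt
          exact hxn.2 j (not_le.1 hlt) hj
        exact (Metric.mem_closedBall.1 (hC j hj)).trans
          (pow_le_pow_of_le_one (by norm_num) (by norm_num) hjn)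
  · intro x hx
    refine ⟨x, ?_, by simpa using hn⟩
    rcases (mem_uN p C n x).1 hx with h | ⟨j, -, h⟩
    · exact Or.inl h
    · exact Or.inr (mem_iUnion.2 ⟨j, h⟩)

open Classical in
lemma realize {X : Type*} [TopologicalSpace X] [CompactSpace X] [T2Space X]
    {E : Type*} [MetricSpace E] (p : E) (M : ℕ → NonemptyCompacts E)
    (hM : ∀ j, (M j : Set E) ⊆ Metric.closedBall p (2⁻¹ ^ j))
    (δ : ℕ → X → ℝ) (hδ : ∀ j, Continuous (δ j)) (h0 : ∀ j x, 0 ≤ δ j x) (h1 : ∀ j x, δ j x ≤ 1) :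
    ∃ 𝒞 : Set (NonemptyCompacts E), IsCompact 𝒞 ∧
      (∀ C ∈ 𝒞, (C : Set E) ⊆ insert p (⋃ j, (M j : Set E))) ∧
      (∀ C ∈ 𝒞, ∃ x, dimH (C : Set E) = ⨆ j, if δ j x = 0 then dimH (M j : Set E) else 0) ∧
      (∀ x, ∃ C ∈ 𝒞, dimH (C : Set E) = ⨆ j, if δ j x = 0 then dimH (M j : Set E) else 0) := by
  choose R hR1 hR2 hR3 using fun j => rel_one (M j) (δ j) (hδ j) (h0 j) (h1 j)
  set W : Set (X × (ℕ → NonemptyCompacts E)) := {q | ∀ j, (q.1, q.2 j) ∈ R j} with hWdef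
  have hWcl : IsClosed W := by
    rw [hWdef, setOf_forall]
    refine isClosed_iInter fun j => (hR1 j).isClosed.preimage (by fun_prop)
  have hWc : IsCompact W := by
    refine (isCompact_univ.prod (isCompact_univ_pi fun j =>
      (hR1 j).image continuous_snd)).of_isClosed_subset hWcl ?_
    rintro q hq
    exact ⟨mem_univ _, fun j _ => ⟨_, hq j, rfl⟩⟩
  have hball : ∀ q ∈ W, ∀ j, (q.2 j : Set E) ⊆ Metric.closedBall p (2⁻¹ ^ j) := fun q hq j =>
    (hR3 j _ (hq j)).1.trans (hM j)
  have hdim : ∀ q ∈ W, dimH (uU p q.2 : Set E) =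
      ⨆ j, if δ j q.1 = 0 then dimH (M j : Set E) else 0 := by
    intro q hq
    rw [uU_coe p q.2 (hball q hq), insert_eq, dimH_union, dimH_singleton, dimH_iUnion]
    rw [max_eq_right zero_le]
    refine iSup_congr fun j => ?_
    obtain ⟨-, h2, h3⟩ := hR3 j _ (hq j)
    split_ifs with h
    · exact h2 h
    · exact h3 h
  have hcont : ContinuousOn (fun q : X × (ℕ → NonemptyCompacts E) => uU p q.2) W := by
    have hu : TendstoUniformlyOn (fun n (q : X × (ℕ → NonemptyCompacts E)) => uN p q.2 n)
        (fun q => uU p q.2) atTop W := by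
      rw [Metric.tendstoUniformlyOn_iff]
      intro ε hε
      have hp : Tendsto (fun k : ℕ => (2⁻¹ : ℝ) ^ k) atTop (𝓝 0) :=
        tendsto_pow_atTop_nhds_zero_of_lt_one (by norm_num) (by norm_num)
      filter_upwards [hp.eventually_lt_const hε] with n hn q hq
      exact (uU_dist p q.2 (hball q hq) n).trans_lt hn
    exact hu.continuousOn (Frequently.of_forall fun n =>
      ((uN_cont p n).comp continuous_snd).continuousOn)
  refine ⟨_, hWc.image_of_continuousOn hcont, ?_, ?_, ?_⟩
  · rintro _ ⟨q, hq, rfl⟩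
    simp only [uU_coe p q.2 (hball q hq)]
    exact insert_subset_insert (iUnion_mono fun j => (hR3 j _ (hq j)).1)
  · rintro _ ⟨q, hq, rfl⟩
    exact ⟨q.1, hdim q hq⟩
  · intro x
    choose C hC using fun j => hR2 j x
    exact ⟨_, ⟨(x, C), hC, rfl⟩, hdim (x, C) hC⟩

lemma exists_delta {X : Type*} [TopologicalSpace X] [MetrizableSpace X] {F : Set X}
    (hF : IsClosed F) : ∃ δ : X → ℝ, Continuous δ ∧ (∀ x, 0 ≤ δ x) ∧ (∀ x, δ x ≤ 1) ∧
      ∀ x, δ x = 0 ↔ x ∈ F := by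
  letI := metrizableSpaceMetric X
  rcases F.eq_empty_or_nonempty with rfl | hne
  · exact ⟨fun _ => 1, continuous_const, by simp, by simp, by simp⟩
  · refine ⟨fun x => min 1 (Metric.infDist x F), continuous_const.min (Metric.continuous_infDist_pt F),
      fun x => le_min zero_le_one Metric.infDist_nonneg, fun x => min_le_left _ _, fun x => ?_⟩
    rw [hF.mem_iff_infDist_zero hne]
    constructor
    · intro h
      have h : min 1 (Metric.infDist x F) = 0 := h
      rcases min_choice 1 (Metric.infDist x F) with h' | h'
      · rw [h'] at h; norm_num at h
      · rwa [h'] at h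
    · intro h; simp [h]

lemma exists_point {E : Type*} [MetricSpace E] {K : Set E} (hK : IsCompact K) (hne : K.Nonempty) :
    ∃ p ∈ K, ∀ t ∈ 𝓝[K] p, dimH K ≤ dimH t := by
  rcases eq_or_ne (dimH K) 0 with h0 | h0
  · obtain ⟨p, hp⟩ := hne
    exact ⟨p, hp, fun t _ => by rw [h0]; exact zero_le⟩
  by_contra! h
  have := hK.induction_on (p := fun t => dimH t < dimH K) (by simpa using pos_iff_ne_zero.2 h0)
    (fun s t hst ht => (dimH_mono hst).trans_lt ht)
    (fun s t hs ht => by rw [dimH_union]; exact max_lt hs ht) h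
  exact this.false

open Classical in
lemma realize_fun {d : ℕ} {K : Set (Fin d → ℝ)} (hK : IsCompact K) (hne : K.Nonempty)
    {X : Type*} [TopologicalSpace X] [CompactSpace X] [MetrizableSpace X] (φ : X → ℝ)
    (hφK : ∀ x, ENNReal.ofReal (φ x) ≤ dimH K)
    (hG : ∀ t, IsGδ {x | φ x ≤ t}) :
    ∃ 𝒞 : Set (NonemptyCompacts (Fin d → ℝ)), IsCompact 𝒞 ∧
      (∀ C ∈ 𝒞, (C : Set (Fin d → ℝ)) ⊆ K) ∧
      (∀ C ∈ 𝒞, ∃ x, dimH (C : Set (Fin d → ℝ)) = ENNReal.ofReal (φ x)) ∧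
      (∀ x, ∃ C ∈ 𝒞, dimH (C : Set (Fin d → ℝ)) = ENNReal.ofReal (φ x)) := by
  obtain ⟨p, hpK, hp⟩ := exists_point hK hne
  choose U hU1 hU2 using fun q : ℚ => isGδ_iff_eq_iInter_nat.1 (hG q)
  obtain ⟨e, he⟩ := exists_surjective_nat (ℚ × ℕ)
  have hmem : ∀ (q : ℚ) (x : X), (q : ℝ) < φ x ↔ ∃ n, x ∈ (U q n)ᶜ := by
    intro q x
    have := Set.ext_iff.1 (hU2 q) x
    simp only [mem_setOf_eq, mem_iInter] at this
    rw [← not_le, this]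
    simp
  choose δ hδ1 hδ2 hδ3 hδ4 using fun j =>
    exists_delta (F := (U (e j).1 (e j).2)ᶜ) (hU1 (e j).1 (e j).2).isClosed_compl
  have hMex : ∀ j, ∃ M : NonemptyCompacts (Fin d → ℝ), (M : Set (Fin d → ℝ)) ⊆ K ∧
      (M : Set (Fin d → ℝ)) ⊆ Metric.closedBall p (2⁻¹ ^ j) ∧
      (∀ x, δ j x = 0 → dimH (M : Set (Fin d → ℝ)) = ENNReal.ofReal (e j).1) := by
    intro j
    have hr : (0 : ℝ) < 2⁻¹ ^ j := by positivity
    by_cases h : (0 : ℝ) < (e j).1 ∧ ∃ x, δ j x = 0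
    · obtain ⟨hq, x, hx⟩ := h
      have hlt : ((e j).1 : ℝ) < φ x := (hmem _ _).2 ⟨_, (hδ4 j x).1 hx⟩
      have hB : dimH K ≤ dimH (K ∩ Metric.closedBall p (2⁻¹ ^ j)) :=
        hp _ (inter_mem_nhdsWithin K (Metric.closedBall_mem_nhds p hr))
      obtain ⟨C, hC1, hC2, hC3⟩ := exists_dim (K := K ∩ Metric.closedBall p (2⁻¹ ^ j))
        (hK.inter_right Metric.isClosed_closedBall) hq
        (lt_of_lt_of_le ((ENNReal.ofReal_lt_ofReal_iff (hq.trans hlt)).2 hlt)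
          ((hφK x).trans hB))
      have hCne : C.Nonempty := by
        by_contra hC
        rw [not_nonempty_iff_eq_empty.1 hC, dimH_empty] at hC3
        have := ENNReal.ofReal_pos.2 hq
        rw [← hC3] at this
        exact this.false
      exact ⟨⟨⟨C, hC2⟩, hCne⟩, hC1.trans inter_subset_left, hC1.trans inter_subset_right,
        fun _ _ => hC3⟩
    · refine ⟨{p}, by simpa using hpK, by simpa using hr.le, fun x hx => ?_⟩
      have : ¬ (0 : ℝ) < (e j).1 := fun h' => h ⟨h', x, hx⟩
      rw [ENNReal.ofReal_of_nonpos (not_lt.1 this)]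
      simp
  choose M hM1 hM2 hM3 using hMex
  obtain ⟨𝒞, h1, h2, h3, h4⟩ := realize p M hM2 δ hδ1 hδ2 hδ3
  have key : ∀ x, (⨆ j, if δ j x = 0 then dimH (M j : Set (Fin d → ℝ)) else 0) =
      ENNReal.ofReal (φ x) := by
    intro x
    apply le_antisymm
    · refine iSup_le fun j => ?_
      split_ifs with h
      · rw [hM3 j x h]
        exact ENNReal.ofReal_le_ofReal ((hmem _ _).2 ⟨_, (hδ4 j x).1 h⟩).le
      · exact zero_le
    · refine le_of_forall_lt fun a ha => ?_
      have haf : a ≠ ∞ := (ha.trans_le le_top).ne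
      have ha' : a.toReal < φ x := by
        rw [← ENNReal.ofReal_toReal haf] at ha
        exact (ENNReal.ofReal_lt_ofReal_iff_of_nonneg ENNReal.toReal_nonneg).1 ha
      obtain ⟨q, hq1, hq2⟩ := exists_rat_btwn ha'
      obtain ⟨n, hn⟩ := (hmem q x).1 hq2
      obtain ⟨j, hj⟩ := he (q, n)
      have hδ0 : δ j x = 0 := (hδ4 j x).2 (by rw [hj]; exact hn)
      refine lt_of_lt_of_le ?_ (le_iSup _ j)
      rw [if_pos hδ0, hM3 j x hδ0, hj, ← ENNReal.ofReal_toReal haf]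
      exact (ENNReal.ofReal_lt_ofReal_iff_of_nonneg ENNReal.toReal_nonneg).2 hq1
  refine ⟨𝒞, h1, fun C hC => (h2 C hC).trans (insert_subset hpK (iUnion_subset hM1)), ?_, ?_⟩
  · intro C hC
    obtain ⟨x, hx⟩ := h3 C hC
    exact ⟨x, hx.trans (key x)⟩
  · intro x
    obtain ⟨C, hC, hx⟩ := h4 x
    exact ⟨C, hC, hx.trans (key x)⟩

lemma exists_h {f : (ℕ → ℕ) → ℝ} (hf : Continuous f) (m : ℝ) :
    ∃ h : (ℕ → ℕ∞) → ℝ, (∀ t, IsGδ {z | h z ≤ t}) ∧ (∀ z, h z = m ∨ ∃ y, h z = min (f y) m) ∧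
      ∀ y, ∃ z, h z = min (f y) m := by
  classical
  let i : (ℕ → ℕ) → ℕ → ℕ∞ := Pi.map fun _ => ((↑) : ℕ → ℕ∞)
  have hi : IsEmbedding i := IsEmbedding.piMap fun _ => ENat.isEmbedding_natCast
  let h : (ℕ → ℕ∞) → ℝ := fun z => if hz : ∃ y, i y = z then min (f hz.choose) m else m
  have hiy : ∀ y, h (i y) = min (f y) m := fun y => by
    have hz : ∃ y', i y' = i y := ⟨y, rfl⟩
    simp only [h, dif_pos hz, hi.injective hz.choose_spec]
  have hno : ∀ z, (¬ ∃ y, i y = z) → h z = m := fun z hz => by simp only [h, dif_neg hz]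
  have hrange : ∀ z, (∃ y, i y = z) ↔ ∀ n, z n ≠ ⊤ := by
    intro z
    constructor
    · rintro ⟨y, rfl⟩ n
      exact ENat.coe_ne_top _
    · intro hz
      choose y hy using fun n => ENat.ne_top_iff_exists.1 (hz n)
      exact ⟨y, funext hy⟩
  refine ⟨h, fun t => ?_, fun z => ?_, fun y => ⟨i y, hiy y⟩⟩
  · rcases le_or_gt m t with hmt | hmt
    · have : {z | h z ≤ t} = univ := eq_univ_of_forall fun z => by
        by_cases hz : ∃ y, i y = z
        · obtain ⟨y, rfl⟩ := hz
          rw [mem_setOf_eq, hiy]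
          exact (min_le_right _ _).trans hmt
        · rw [mem_setOf_eq, hno z hz]; exact hmt
      rw [this]
      exact IsGδ.univ
    · obtain ⟨O, hO, hOe⟩ := hi.isOpen_iff.1 (isOpen_Ioi.preimage hf : IsOpen (f ⁻¹' Ioi t))
      have : {z | h z ≤ t} = Oᶜ ∩ ⋂ n, {z | z n ≠ ⊤} := by
        ext z
        simp only [mem_setOf_eq, mem_inter_iff, mem_iInter, ← hrange]
        by_cases hz : ∃ y, i y = z
        · obtain ⟨y, rfl⟩ := hz
          have := Set.ext_iff.1 hOe y
          simp only [mem_preimage, mem_Ioi] at this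
          rw [hiy, mem_compl_iff, this, not_lt, min_le_iff]
          simp [not_le.2 hmt]
        · simp [hz, hno z hz, hmt]
      rw [this]
      refine hO.isClosed_compl.isGδ.inter (IsGδ.iInter fun n => IsOpen.isGδ ?_)
      exact isOpen_ne.preimage (continuous_apply n)
  · by_cases hz : ∃ y, i y = z
    · obtain ⟨y, rfl⟩ := hz
      exact Or.inr ⟨y, hiy y⟩
    · exact Or.inl (hno z hz)

end Realize

/-- Given a nonempty compact `K ⊆ ℝ^d` and an analytic set `A ⊆ [0, dim_H K]`, there is a
family `𝒞` of nonempty compact subsets of `K`, compact in the Hausdorff metric, whose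
members attain exactly the Hausdorff dimensions in `A`. -/
theorem statement6 (d : ℕ) (hd : 1 ≤ d) (K : Set (Fin d → ℝ))
    (hKc : IsCompact K) (hKne : K.Nonempty)
    (A : Set ℝ) (han : MeasureTheory.AnalyticSet A)
    (hsub : ∀ a ∈ A, 0 ≤ a ∧ ENNReal.ofReal a ≤ dimH K) :
    ∃ 𝒞 : Set (TopologicalSpace.NonemptyCompacts (Fin d → ℝ)),
      IsCompact 𝒞 ∧ (∀ C ∈ 𝒞, (C : Set (Fin d → ℝ)) ⊆ K) ∧
      {e : ℝ≥0∞ | ∃ C ∈ 𝒞, dimH (C : Set (Fin d → ℝ)) = e} = ENNReal.ofReal '' A := by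
  rw [AnalyticSet] at han
  rcases han with rfl | ⟨f, hf, rfl⟩
  · exact ⟨∅, isCompact_empty, by simp, by simp⟩
  -- a cofinal sequence
  obtain ⟨g, hg⟩ : ∃ g : ℕ → ℕ → ℕ, ∀ y, ∃ n, f y ≤ f (g n) := by
    by_cases hmax : ∃ y0, ∀ y, f y ≤ f y0
    · obtain ⟨y0, hy0⟩ := hmax
      exact ⟨fun _ => y0, fun y => ⟨0, hy0 y⟩⟩
    · push Not at hmax
      refine ⟨TopologicalSpace.denseSeq (ℕ → ℕ), fun y => ?_⟩
      obtain ⟨y', hy'⟩ := hmax y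
      obtain ⟨z, hz, n, rfl⟩ := (TopologicalSpace.denseRange_denseSeq (ℕ → ℕ)).inter_open_nonempty
        (f ⁻¹' Ioi (f y)) (isOpen_Ioi.preimage hf) ⟨y', hy'⟩
      exact ⟨n, le_of_lt hz⟩
  let y0 : ℕ → ℕ := fun _ => 0
  set b := f y0 with hb
  have hmin : ∀ y z, min (f y) (f z) ∈ range f := fun y z => by
    rcases min_choice (f y) (f z) with h | h <;> rw [h] <;> exact mem_range_self _
  have hmaxr : ∀ r ∈ range f, max b r ∈ range f := fun r hr => by
    rcases max_choice b r with h | h <;> rw [h]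
    · exact mem_range_self _
    · exact hr
  obtain ⟨h, hh1, hh2, hh3⟩ := exists_h hf b
  choose H hH1 hH2 hH3 using fun n => exists_h hf (f (g n))
  have hhr : ∀ z, h z ∈ range f := fun z => by
    rcases hh2 z with e | ⟨y, e⟩ <;> rw [e]
    · exact mem_range_self _
    · exact hmin _ _
  have hHr : ∀ n z, H n z ∈ range f := fun n z => by
    rcases hH2 n z with e | ⟨y, e⟩ <;> rw [e]
    · exact mem_range_self _
    · exact hmin _ _
  let Φ : (ℕ → ℕ∞) × ℕ∞ → ℝ := fun q => if q.2 = ⊤ then b else max b (H q.2.toNat q.1)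
  have hΦtop : ∀ z, Φ (z, ⊤) = b := fun z => by simp [Φ]
  have hΦn : ∀ z (n : ℕ), Φ (z, (n : ℕ∞)) = max b (H n z) := fun z n => by simp [Φ]
  have hΦr : ∀ q, Φ q ∈ range f := by
    rintro ⟨z, n⟩
    induction n using ENat.recTopCoe with
    | top => rw [hΦtop]; exact mem_range_self _
    | coe n => rw [hΦn]; exact hmaxr _ (hHr n z)
  have hΦG : ∀ t, IsGδ {q | Φ q ≤ t} := by
    intro t
    rcases lt_or_ge t b with htb | htb
    · have : {q | Φ q ≤ t} = ∅ := by
        refine eq_empty_of_forall_notMem ?_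
        rintro ⟨z, n⟩
        rw [mem_setOf_eq, not_le]
        induction n using ENat.recTopCoe with
        | top => rwa [hΦtop]
        | coe n => rw [hΦn]; exact htb.trans_le (le_max_left _ _)
      rw [this]
      exact IsGδ.empty
    · have : {q | Φ q ≤ t} =
          ⋂ n : ℕ, ({q | q.2 ≠ (n : ℕ∞)} ∪ Prod.fst ⁻¹' {z | H n z ≤ t}) := by
        ext ⟨z, n⟩
        simp only [mem_setOf_eq, mem_iInter, mem_union, mem_preimage]
        induction n using ENat.recTopCoe with
        | top => simp [hΦtop, htb]
        | coe n =>
          rw [hΦn, max_le_iff]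
          constructor
          · rintro ⟨-, h⟩ k
            by_cases hk : n = k
            · subst hk; exact Or.inr h
            · left; exact_mod_cast hk
          · intro h
            refine ⟨htb, ?_⟩
            rcases h n with h | h
            · exact absurd rfl h
            · exact h
      rw [this]
      refine IsGδ.iInter fun n => IsGδ.union (IsOpen.isGδ ?_) ?_
      · exact isOpen_ne.preimage continuous_snd
      · obtain ⟨V, hV1, hV2⟩ := isGδ_iff_eq_iInter_nat.1 (hH1 n t)
        rw [hV2, preimage_iInter]
        exact IsGδ.iInter fun k => ((hV1 k).preimage continuous_fst).isGδ
  obtain ⟨𝒞₁, a1, a2, a3, a4⟩ := realize_fun hKc hKne h (fun z => (hsub _ (hhr z)).2) hh1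
  obtain ⟨𝒞₂, b1, b2, b3, b4⟩ := realize_fun hKc hKne Φ (fun z => (hsub _ (hΦr z)).2) hΦG
  refine ⟨𝒞₁ ∪ 𝒞₂, a1.union b1, ?_, ?_⟩
  · rintro C (hC | hC)
    · exact a2 C hC
    · exact b2 C hC
  · ext e
    constructor
    · rintro ⟨C, hC | hC, rfl⟩
      · obtain ⟨x, hx⟩ := a3 C hC
        exact ⟨h x, hhr x, hx.symm⟩
      · obtain ⟨x, hx⟩ := b3 C hC
        exact ⟨Φ x, hΦr x, hx.symm⟩
    · rintro ⟨_, ⟨y, rfl⟩, rfl⟩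
      rcases le_total (f y) b with hyb | hyb
      · obtain ⟨z, hz⟩ := hh3 y
        obtain ⟨C, hC, hCd⟩ := a4 z
        exact ⟨C, Or.inl hC, by rw [hCd, hz, min_eq_left hyb]⟩
      · obtain ⟨n, hn⟩ := hg y
        obtain ⟨z, hz⟩ := hH3 n y
        obtain ⟨C, hC, hCd⟩ := b4 (z, (n : ℕ∞))
        exact ⟨C, Or.inr hC, by rw [hCd, hΦn, hz, min_eq_left hn, max_eq_right hyb]⟩
end

section
/- Let d ≥ 1 be an integer and let 𝒞 be a set of nonempty compact subsets of ℝ^d that is compact in the Hausdorff metric. Then the set {dim_H C : C ∈ 𝒞} is an analytic subset of ℝ. -/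
open Filter MeasureTheory Set
open scoped ENNReal

lemma aux_open_cover {X : Type*} [EMetricSpace X] {s : ℝ} (hs : 0 < s) (t : Set X)
    (ht : Metric.ediam t ≤ 1) {δ : ℝ≥0∞} (hδ : 0 < δ) :
    ∃ U : Set X, IsOpen U ∧ t ⊆ U ∧
      Metric.ediam U ^ s ≤ (⨆ _ : t.Nonempty, Metric.ediam t ^ s) + δ := by
  rcases t.eq_empty_or_nonempty with rfl | hne
  · exact ⟨∅, isOpen_empty, subset_rfl, by simp [hs]⟩
  have hfin : Metric.ediam t ^ s ≠ ∞ :=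
    ENNReal.rpow_ne_top_of_nonneg hs.le (ht.trans_lt ENNReal.one_lt_top).ne
  have hlt : Metric.ediam t ^ s < Metric.ediam t ^ s + δ :=
    ENNReal.lt_add_right hfin hδ.ne'
  have hc : Tendsto (fun e : NNReal => (Metric.ediam t + 2 * (e : ℝ≥0∞)) ^ s) (nhds 0)
      (nhds (Metric.ediam t ^ s)) := by
    have h1 : Tendsto (fun e : NNReal => Metric.ediam t + 2 * (e : ℝ≥0∞)) (nhds 0)
        (nhds (Metric.ediam t + 2 * ((0 : NNReal) : ℝ≥0∞))) := by
      refine Tendsto.add tendsto_const_nhds ?_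
      exact ENNReal.Tendsto.const_mul (ENNReal.continuous_coe.tendsto 0) (Or.inr (by simp))
    simp only [ENNReal.coe_zero, mul_zero, add_zero] at h1
    exact (ENNReal.continuous_rpow_const.tendsto _).comp h1
  have hev := (hc.eventually_lt_const hlt).filter_mono (nhdsWithin_le_nhds (s := Ioi 0))
  obtain ⟨e, he, he0⟩ := (hev.and self_mem_nhdsWithin).exists
  refine ⟨Metric.thickening e t, Metric.isOpen_thickening,
    Metric.self_subset_thickening (by exact_mod_cast he0) t, ?_⟩
  simp only [hne, iSup_pos]
  exact (ENNReal.rpow_le_rpow (Metric.ediam_thickening_le e) hs.le).trans he.le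

def auxG (X : Type*) [EMetricSpace X] (s : ℝ) (ε : ℝ≥0∞) :
    Set (TopologicalSpace.NonemptyCompacts X) :=
  {C | ∃ t : ℕ → Set X, (∀ n, IsOpen (t n)) ∧ (C : Set X) ⊆ ⋃ n, t n ∧
    ∑' n, Metric.ediam (t n) ^ s < ε}

lemma auxG_open (X : Type*) [EMetricSpace X] (s : ℝ) (ε : ℝ≥0∞) : IsOpen (auxG X s ε) := by
  rw [isOpen_iff_mem_nhds]
  rintro C ⟨t, ht, hC, hsum⟩
  filter_upwards [(TopologicalSpace.NonemptyCompacts.isOpen_subsets_of_isOpen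
    (isOpen_iUnion ht)).mem_nhds hC] with D hD
  exact ⟨t, ht, hD, hsum⟩

lemma aux_null_iff {X : Type*} [EMetricSpace X] [MeasurableSpace X] [BorelSpace X] {s : ℝ}
    (hs : 0 < s) (C : TopologicalSpace.NonemptyCompacts X) :
    μH[s] (C : Set X) = 0 ↔ ∀ n : ℕ, C ∈ auxG X s ((n : ℝ≥0∞) + 1)⁻¹ := by
  rw [Measure.hausdorffMeasure_apply]
  constructor
  · intro h n
    have hε : (0 : ℝ≥0∞) < ((n : ℝ≥0∞) + 1)⁻¹ := by simp
    generalize ((n : ℝ≥0∞) + 1)⁻¹ = ε at hε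
    have h2 : (0 : ℝ≥0∞) < ε / 2 := ENNReal.half_pos hε.ne'
    simp only [ENNReal.iSup_eq_zero] at h
    have h1 := (h 1 one_pos).trans_lt h2
    simp only [iInf_lt_iff] at h1
    obtain ⟨t, hCt, hd, hsum⟩ := h1
    obtain ⟨δ, hδ, hδsum⟩ := ENNReal.exists_pos_sum_of_countable' h2.ne' ℕ
    choose U hUo hUt hU using fun n => aux_open_cover hs (t n) (hd n) (hδ n)
    refine ⟨U, hUo, hCt.trans (iUnion_mono hUt), (ENNReal.tsum_le_tsum hU).trans_lt ?_⟩
    rw [ENNReal.tsum_add]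
    exact (ENNReal.add_lt_add hsum hδsum).trans_eq (ENNReal.add_halves ε)
  · intro h
    simp only [ENNReal.iSup_eq_zero]
    intro r hr
    have key : ∀ ε > 0, ∃ t : ℕ → Set X, (C : Set X) ⊆ ⋃ n, t n ∧
        ∑' n, Metric.ediam (t n) ^ s < ε := by
      intro ε hε
      obtain ⟨n, hn⟩ := ENNReal.exists_inv_nat_lt hε.ne'
      obtain ⟨t, -, hC, hsum⟩ := h n
      exact ⟨t, hC, hsum.trans_le ((ENNReal.inv_le_inv.2 le_self_add).trans hn.le)⟩
    refine le_antisymm (le_of_forall_gt fun ε hε => ?_) zero_le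
    have hr' : 0 < r ^ s := ENNReal.rpow_pos_of_nonneg hr hs.le
    obtain ⟨t, hC, hsum⟩ := key (min ε (r ^ s)) (lt_min hε hr')
    simp only [iInf_lt_iff]
    refine ⟨t, hC, fun n => ?_, ?_⟩
    · exact (ENNReal.rpow_le_rpow_iff hs).1
        ((ENNReal.le_tsum n).trans (hsum.le.trans (min_le_right _ _)))
    · refine lt_of_le_of_lt (ENNReal.tsum_le_tsum fun n => ?_) (hsum.trans_le (min_le_left _ _))
      exact iSup_le fun _ => le_rfl

lemma aux_measurable (X : Type*) [EMetricSpace X]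
    [MeasurableSpace (TopologicalSpace.NonemptyCompacts X)]
    [BorelSpace (TopologicalSpace.NonemptyCompacts X)] :
    Measurable (fun C : TopologicalSpace.NonemptyCompacts X => dimH (C : Set X)) := by
  borelize X
  refine measurable_of_Iio fun r => ?_
  have : (fun C : TopologicalSpace.NonemptyCompacts X => dimH (C : Set X)) ⁻¹' Iio r =
      ⋃ q : {q : ℚ // 0 < q ∧ ENNReal.ofReal q < r},
        ⋂ n : ℕ, auxG X (q.1 : ℝ) ((n : ℝ≥0∞) + 1)⁻¹ := by
    ext C
    simp only [mem_preimage, mem_Iio, mem_iUnion, mem_iInter]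
    constructor
    · intro h
      obtain ⟨q, hq0, hq1, hq2⟩ := ENNReal.lt_iff_exists_rat_btwn.1 h
      have hpos : (0 : ℝ) < q := by
        have := (zero_le.trans_lt hq1)
        simpa using this
      refine ⟨⟨q, by exact_mod_cast hpos, hq2⟩, (aux_null_iff hpos C).1 ?_⟩
      have := hausdorffMeasure_of_dimH_lt hq1
      rwa [Real.coe_toNNReal _ hpos.le] at this
    · rintro ⟨⟨q, hq0, hq⟩, h⟩
      have hpos : (0 : ℝ) < q := by exact_mod_cast hq0
      have h0 := (aux_null_iff hpos C).2 h
      refine lt_of_le_of_lt ?_ hq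
      refine dimH_le_of_hausdorffMeasure_ne_top (d := Real.toNNReal q) ?_
      rw [Real.coe_toNNReal _ hpos.le, h0]
      exact ENNReal.zero_ne_top
  rw [this]
  exact MeasurableSet.iUnion fun q => MeasurableSet.iInter fun n => (auxG_open X _ _).measurableSet

/-- If `𝒞` is a family of nonempty compact subsets of `ℝ^d` that is compact in the
Hausdorff metric, then the set of Hausdorff dimensions attained by members of `𝒞` is an
analytic subset of `ℝ`. -/
theorem statement7 (d : ℕ) (hd : 1 ≤ d)
    (𝒞 : Set (TopologicalSpace.NonemptyCompacts (Fin d → ℝ))) (h𝒞 : IsCompact 𝒞) :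
    MeasureTheory.AnalyticSet
      {x : ℝ | ∃ C ∈ 𝒞, (dimH (C : Set (Fin d → ℝ))).toReal = x} := by
  borelize (TopologicalSpace.NonemptyCompacts (Fin d → ℝ))
  have hm := (aux_measurable (Fin d → ℝ)).ennreal_toReal
  exact h𝒞.isClosed.measurableSet.analyticSet_image hm
end

section
/- Let K be a nonempty compact metric space and let A ⊆ [0, \overline{dim}_B K] be an analytic set. Then there exists a set 𝒞 of nonempty compact subsets of K that is compact in the Hausdorff metric and satisfies {\overline{dim}_B C : C ∈ 𝒞} = A. -/
open Filter MeasureTheory Set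
open scoped ENNReal

/-- Upper box dimension: `limsup_n log N_n(s) / (n log 2)`. -/
noncomputable def ubDim {X : Type*} [MetricSpace X] (s : Set X) : ℝ≥0∞ :=
  Filter.limsup
    (fun n : ℕ => ENNReal.ofReal (Real.log (coverNum s n) / (n * Real.log 2)))
    Filter.atTop

section helpers
variable {X : Type*} [MetricSpace X]

theorem coverNum_le_of (s : Set X) (n : ℕ) (t : Finset X)
    (h : s ⊆ ⋃ y ∈ t, Metric.closedBall y ((2 : ℝ) ^ (-(n : ℤ)))) : coverNum s n ≤ t.card :=
  Nat.sInf_le ⟨t, rfl, h⟩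

theorem exists_cover [CompactSpace X] (s : Set X) (n : ℕ) :
    ∃ t : Finset X, t.card = coverNum s n ∧
      s ⊆ ⋃ y ∈ t, Metric.closedBall y ((2 : ℝ) ^ (-(n : ℤ))) := by
  have hne : {m : ℕ | ∃ t : Finset X, t.card = m ∧
    s ⊆ ⋃ y ∈ t, Metric.closedBall y ((2 : ℝ) ^ (-(n : ℤ)))}.Nonempty := by
    have hpos : (0 : ℝ) < (2 : ℝ) ^ (-(n : ℤ)) := by positivity
    obtain ⟨t, -, htf, ht⟩ := (isCompact_univ (X := X)).finite_cover_balls hpos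
    refine ⟨_, htf.toFinset, rfl, fun x _ => ?_⟩
    have := ht (mem_univ x)
    simp only [mem_iUnion, Set.Finite.mem_toFinset] at this ⊢
    obtain ⟨y, hy, hxy⟩ := this
    exact ⟨y, hy, Metric.ball_subset_closedBall hxy⟩
  exact Nat.sInf_mem hne

theorem coverNum_mono [CompactSpace X] {s t : Set X} (h : s ⊆ t) (n : ℕ) :
    coverNum s n ≤ coverNum t n := by
  obtain ⟨u, hu, hc⟩ := exists_cover t n
  rw [← hu]
  exact coverNum_le_of s n u (h.trans hc)

theorem coverNum_closure [CompactSpace X] (s : Set X) (n : ℕ) :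
    coverNum (closure s) n ≤ coverNum s n := by
  obtain ⟨u, hu, hc⟩ := exists_cover s n
  rw [← hu]
  refine coverNum_le_of _ n u (closure_minimal hc ?_)
  exact Set.Finite.isClosed_biUnion u.finite_toSet (fun _ _ => Metric.isClosed_closedBall)

theorem coverNum_union [CompactSpace X] (s t : Set X) (n : ℕ) :
    coverNum (s ∪ t) n ≤ coverNum s n + coverNum t n := by
  classical
  obtain ⟨u, hu, hc⟩ := exists_cover s n
  obtain ⟨v, hv, hd⟩ := exists_cover t n
  rw [← hu, ← hv]
  refine (coverNum_le_of _ n (u ∪ v) ?_).trans (Finset.card_union_le u v)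
  rintro x (hx | hx)
  · have := hc hx
    simp only [mem_iUnion, Finset.mem_union] at this ⊢
    obtain ⟨y, hy, h⟩ := this
    exact ⟨y, Or.inl hy, h⟩
  · have := hd hx
    simp only [mem_iUnion, Finset.mem_union] at this ⊢
    obtain ⟨y, hy, h⟩ := this
    exact ⟨y, Or.inr hy, h⟩

theorem coverNum_finset (F : Finset X) (n : ℕ) : coverNum (F : Set X) n ≤ F.card := by
  refine coverNum_le_of _ n F fun x hx => ?_
  simp only [mem_iUnion]
  exact ⟨x, hx, Metric.mem_closedBall_self (by positivity)⟩

theorem coverNum_ball (p : X) (n : ℕ) :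
    coverNum (Metric.closedBall p ((2 : ℝ) ^ (-(n : ℤ)))) n ≤ 1 := by
  refine coverNum_le_of _ n {p} ?_
  simp

theorem coverNum_pos [CompactSpace X] {s : Set X} (hs : s.Nonempty) (n : ℕ) :
    1 ≤ coverNum s n := by
  obtain ⟨u, hu, hc⟩ := exists_cover s n
  rw [← hu]
  obtain ⟨x, hx⟩ := hs
  have := hc hx
  simp only [mem_iUnion] at this
  obtain ⟨y, hy, h⟩ := this
  exact Finset.card_pos.2 ⟨y, hy⟩

theorem exists_sep (s : Set X) (n q : ℕ) (hq : q ≤ coverNum s n) :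
    ∃ F : Finset X, (F : Set X) ⊆ s ∧ F.card = q ∧
      ∀ x ∈ F, ∀ y ∈ F, x ≠ y → (2 : ℝ) ^ (-(n : ℤ)) < dist x y := by
  classical
  induction q with
  | zero => exact ⟨∅, by simp⟩
  | succ q ih =>
    obtain ⟨F, hFs, hFc, hF⟩ := ih (by omega)
    have : ¬ s ⊆ ⋃ y ∈ F, Metric.closedBall y ((2 : ℝ) ^ (-(n : ℤ))) := fun h => by
      have := coverNum_le_of s n F h
      omega
    obtain ⟨x, hx, hxn⟩ := Set.not_subset.1 this
    simp only [mem_iUnion, Metric.mem_closedBall, not_exists, not_le] at hxn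
    have hxF : x ∉ F := fun h => by
      have := hxn x h
      rw [dist_self] at this
      have h2 : (0 : ℝ) < (2 : ℝ) ^ (-(n : ℤ)) := by positivity
      linarith
    refine ⟨insert x F, ?_, ?_, ?_⟩
    · intro z hz
      rcases Finset.mem_insert.1 hz with rfl | hz
      · exact hx
      · exact hFs hz
    · rw [Finset.card_insert_of_notMem hxF, hFc]
    · intro a ha b hb hab
      rcases Finset.mem_insert.1 ha with hax | ha1 <;> rcases Finset.mem_insert.1 hb with hbx | hb1
      · exact absurd (hax.trans hbx.symm) hab
      · rw [hax]; exact hxn b hb1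
      · rw [hbx, dist_comm]; exact hxn a ha1
      · exact hF a ha1 b hb1 hab

theorem card_le_coverNum [CompactSpace X] (F : Finset X) (n : ℕ)
    (hF : ∀ x ∈ F, ∀ y ∈ F, x ≠ y → (2 : ℝ) ^ (-(n : ℤ)) < dist x y) :
    F.card ≤ coverNum (F : Set X) (n + 1) := by
  obtain ⟨t, ht, hc⟩ := exists_cover (F : Set X) (n + 1)
  rw [← ht]
  have : ∀ x ∈ F, ∃ y ∈ t, dist x y ≤ (2 : ℝ) ^ (-((n + 1 : ℕ) : ℤ)) := by
    intro x hx
    have := hc hx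
    simp only [mem_iUnion, Metric.mem_closedBall] at this
    obtain ⟨y, hy, h⟩ := this
    exact ⟨y, hy, h⟩
  choose! φ hφ hd using this
  refine Finset.card_le_card_of_injOn φ hφ ?_
  intro x hx y hy hxy
  by_contra hne
  have h1 := hF x hx y hy hne
  have h2 := hd x hx
  have h3 := hd y hy
  rw [← hxy] at h3
  have h4 := dist_triangle_right x y (φ x)
  have h5 : (2 : ℝ) ^ (-(n : ℤ)) = 2 * (2 : ℝ) ^ (-((n + 1 : ℕ) : ℤ)) := by
    rw [show (-(n : ℤ)) = 1 + (-((n + 1 : ℕ) : ℤ)) by push_cast; ring, zpow_add₀ (by norm_num)]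
    simp
  linarith

/-- the building block: finite sets near `p` with controlled covering numbers -/
theorem exists_block_s8 [CompactSpace X] (p : X) (m : ℕ) (a : ℝ) (ha : 0 ≤ a)
    (hadm : ∃ n ≥ m, (2 : ℝ) ^ ((n : ℝ) * a) ≤
      coverNum (Metric.closedBall p ((2 : ℝ) ^ (-(m : ℤ)))) n) :
    ∃ F : Finset X, (F : Set X) ⊆ Metric.closedBall p ((2 : ℝ) ^ (-(m : ℤ))) ∧
      (∃ n ≥ m, (2 : ℝ) ^ ((n : ℝ) * a) ≤ coverNum (F : Set X) (n + 1)) ∧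
      ∀ j ≥ m, (coverNum (F : Set X) j : ℝ) ≤ (2 : ℝ) ^ ((j : ℝ) * a) + 1 := by
  classical
  obtain ⟨hn, hN⟩ := Nat.find_spec hadm
  have hmin := fun j => Nat.find_min hadm (m := j)
  set n := Nat.find hadm
  obtain ⟨F, hFs, hFc, hF⟩ := exists_sep (Metric.closedBall p ((2 : ℝ) ^ (-(m : ℤ)))) n
    ⌈(2 : ℝ) ^ ((n : ℝ) * a)⌉₊ (Nat.ceil_le.2 hN)
  refine ⟨F, hFs, ⟨n, hn, ?_⟩, ?_⟩
  · have := card_le_coverNum F n hF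
    rw [hFc] at this
    exact Nat.ceil_le.1 this
  · intro j hj
    rcases lt_or_ge j n with hjn | hjn
    · have h1 := hmin j hjn
      have h2 : (coverNum (Metric.closedBall p ((2 : ℝ) ^ (-(m : ℤ)))) j : ℝ)
          < (2 : ℝ) ^ ((j : ℝ) * a) := by
        by_contra h
        exact h1 ⟨hj, not_lt.1 h⟩
      have h3 : (coverNum (F : Set X) j : ℝ) ≤
          coverNum (Metric.closedBall p ((2 : ℝ) ^ (-(m : ℤ)))) j := by
        exact_mod_cast coverNum_mono hFs j
      linarith
    · have h1 : (coverNum (F : Set X) j : ℝ) ≤ F.card := by exact_mod_cast coverNum_finset F j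
      rw [hFc] at h1
      have h2 := (Nat.ceil_lt_add_one (a := (2 : ℝ) ^ ((n : ℝ) * a)) (by positivity)).le
      have h3 : (2 : ℝ) ^ ((n : ℝ) * a) ≤ (2 : ℝ) ^ ((j : ℝ) * a) := by
        apply Real.rpow_le_rpow_of_exponent_le (by norm_num)
        have : (n : ℝ) ≤ j := by exact_mod_cast hjn
        gcongr
      linarith

theorem tendsto_aux (L : ℝ) (b : ℝ) :
    Tendsto (fun n : ℕ => b + Real.log ((n : ℝ) + L) / (n * Real.log 2)) atTop (nhds b) := by
  have h1 : Tendsto (fun x : ℝ => Real.log x / x) atTop (nhds 0) :=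
    Real.isLittleO_log_id_atTop.tendsto_div_nhds_zero
  have h2 : Tendsto (fun n : ℕ => (n : ℝ) + L) atTop atTop :=
    tendsto_atTop_add_const_right _ _ tendsto_natCast_atTop_atTop
  have h3 := h1.comp h2
  have h4 : Tendsto (fun n : ℕ => ((n : ℝ) + L) / n) atTop (nhds 1) := by
    have : Tendsto (fun n : ℕ => 1 + L / (n : ℝ)) atTop (nhds (1 + 0)) :=
      tendsto_const_nhds.add (tendsto_const_div_atTop_nhds_zero_nat L)
    rw [add_zero] at this
    refine this.congr' ?_
    filter_upwards [eventually_gt_atTop 0] with n hn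
    have : (n : ℝ) ≠ 0 := by positivity
    field_simp
  have h5 := ((h3.mul h4).div_const (Real.log 2)).const_add b
  simp only [zero_mul, zero_div, add_zero] at h5
  refine h5.congr' ?_
  filter_upwards [eventually_gt_atTop 0, h2.eventually_gt_atTop 0] with n hn hn2
  have h6 : (n : ℝ) ≠ 0 := by positivity
  have h7 : (n : ℝ) + L ≠ 0 := ne_of_gt hn2
  have h8 : Real.log 2 ≠ 0 := by positivity
  simp only [Function.comp]
  field_simp

theorem ubDim_le (s : Set X) (L b : ℝ) (hb : 0 ≤ b)
    (h : ∀ᶠ n : ℕ in atTop, (coverNum s n : ℝ) ≤ ((n : ℝ) + L) * (2 : ℝ) ^ ((n : ℝ) * b)) :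
    ubDim s ≤ ENNReal.ofReal b := by
  have ht := ENNReal.tendsto_ofReal (tendsto_aux L b)
  rw [← ht.limsup_eq]
  refine limsup_le_limsup ?_
  have h2 : Tendsto (fun n : ℕ => (n : ℝ) + L) atTop atTop :=
    tendsto_atTop_add_const_right _ _ tendsto_natCast_atTop_atTop
  filter_upwards [h, eventually_gt_atTop 0, h2.eventually_ge_atTop 1] with n hn hn0 hn1
  apply ENNReal.ofReal_le_ofReal
  have h8 : 0 < Real.log 2 := Real.log_pos (by norm_num)
  have h9 : (0 : ℝ) < n := by positivity
  rw [div_le_iff₀ (by positivity)]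
  have e : (b + Real.log ((n : ℝ) + L) / (n * Real.log 2)) * (n * Real.log 2)
      = n * b * Real.log 2 + Real.log ((n : ℝ) + L) := by
    field_simp
  rw [e]
  rcases Nat.eq_zero_or_pos (coverNum s n) with h0 | h0
  · rw [h0]
    simp only [Nat.cast_zero, Real.log_zero]
    have := Real.log_nonneg hn1
    positivity
  · have h10 := Real.log_le_log (by exact_mod_cast h0) hn
    rw [Real.log_mul (by linarith) (by positivity), Real.log_rpow (by norm_num)] at h10
    linarith

theorem le_ubDim (s : Set X) (a : ℝ)
    (h : ∀ b, 0 ≤ b → b < a → ∃ᶠ n : ℕ in atTop,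
      (2 : ℝ) ^ ((n : ℝ) * b) ≤ coverNum s (n + 1)) :
    ENNReal.ofReal a ≤ ubDim s := by
  refine le_of_forall_lt fun c hc => ?_
  have hcr : c = ENNReal.ofReal c.toReal := (ENNReal.ofReal_toReal (ne_top_of_lt hc)).symm
  have hc0 : 0 ≤ c.toReal := ENNReal.toReal_nonneg
  set r := c.toReal
  have hra : r < a := by
    rw [hcr] at hc
    exact (ENNReal.ofReal_lt_ofReal_iff_of_nonneg hc0).1 hc
  obtain ⟨b', hb1, hb2⟩ := exists_between hra
  obtain ⟨b, hb3, hb4⟩ := exists_between hb2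
  have key : ENNReal.ofReal b' ≤ ubDim s := by
    have ht : Tendsto (fun n : ℕ => (n : ℝ) / (n + 1) * b) atTop (nhds (1 * b)) :=
      (tendsto_natCast_div_add_atTop (1 : ℝ)).mul_const b
    rw [one_mul] at ht
    have hev := ht.eventually_const_lt hb3
    refine le_limsup_of_frequently_le ?_
    have hf := (h b (by linarith) hb4).and_eventually hev
    refine (tendsto_add_atTop_nat 1).frequently (hf.mono ?_)
    rintro n ⟨h1, h2⟩
    apply ENNReal.ofReal_le_ofReal
    have h8 : 0 < Real.log 2 := Real.log_pos (by norm_num)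
    have h9 := Real.log_le_log (by positivity) h1
    rw [Real.log_rpow (by norm_num)] at h9
    refine h2.le.trans ?_
    push_cast
    rw [le_div_iff₀ (by positivity)]
    refine le_trans (le_of_eq ?_) h9
    field_simp
  refine lt_of_lt_of_le ?_ key
  rw [hcr]
  exact (ENNReal.ofReal_lt_ofReal_iff_of_nonneg hc0).2 hb1

/-- a point around which the space has full dimension -/
theorem exists_point_s8 [CompactSpace X] [Nonempty X] :
    ∃ p : X, ∀ a : ℝ, 0 ≤ a → (a = 0 ∨ ENNReal.ofReal a < ubDim (univ : Set X)) →
      ∀ m : ℕ, ∃ n ≥ m, (2 : ℝ) ^ ((n : ℝ) * a) ≤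
        coverNum (Metric.closedBall p ((2 : ℝ) ^ (-(m : ℤ)))) n := by
  by_contra hcon
  push Not at hcon
  have h0 : ∀ p : X, ∃ a : ℝ, 0 ≤ a ∧ ENNReal.ofReal a < ubDim (univ : Set X) ∧
      ∃ m : ℕ, ∀ n ≥ m, (coverNum (Metric.closedBall p ((2 : ℝ) ^ (-(m : ℤ)))) n : ℝ) <
        (2 : ℝ) ^ ((n : ℝ) * a) := by
    intro p
    obtain ⟨a, ha, hd, m, hm⟩ := hcon p
    refine ⟨a, ha, ?_, m, hm⟩
    rcases hd with rfl | hd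
    · exfalso
      have h1 := hm m le_rfl
      simp only [mul_zero, Real.rpow_zero] at h1
      have h2 : 1 ≤ coverNum (Metric.closedBall p ((2 : ℝ) ^ (-(m : ℤ)))) m :=
        coverNum_pos ⟨p, Metric.mem_closedBall_self (by positivity)⟩ m
      have h3 : (1 : ℝ) ≤ coverNum (Metric.closedBall p ((2 : ℝ) ^ (-(m : ℤ)))) m := by
        exact_mod_cast h2
      linarith
    · exact hd
  have hdpos : 0 < ubDim (univ : Set X) := by
    obtain ⟨a, _, h, _⟩ := h0 (Classical.arbitrary X)
    exact lt_of_le_of_lt bot_le h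
  have main : ∃ a : ℝ, 0 ≤ a ∧ ENNReal.ofReal a < ubDim (univ : Set X) ∧ ∃ L : ℝ, 0 ≤ L ∧
      ∃ m : ℕ, ∀ n ≥ m, (coverNum (univ : Set X) n : ℝ) ≤ L * (2 : ℝ) ^ ((n : ℝ) * a) := by
    refine (isCompact_univ (X := X)).induction_on
      (p := fun s => ∃ a : ℝ, 0 ≤ a ∧ ENNReal.ofReal a < ubDim (univ : Set X) ∧ ∃ L : ℝ, 0 ≤ L ∧
      ∃ m : ℕ, ∀ n ≥ m, (coverNum s n : ℝ) ≤ L * (2 : ℝ) ^ ((n : ℝ) * a)) ?_ ?_ ?_ ?_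
    · refine ⟨0, le_rfl, by simpa using hdpos, 0, le_rfl, 0, fun n _ => ?_⟩
      have := coverNum_le_of (∅ : Set X) n ∅ (by simp)
      simp only [Finset.card_empty, Nat.le_zero] at this
      simp [this]
    · rintro s t hst ⟨a, ha, hd, L, hL, m, hm⟩
      refine ⟨a, ha, hd, L, hL, m, fun n hn => le_trans ?_ (hm n hn)⟩
      exact_mod_cast coverNum_mono hst n
    · rintro s t ⟨a, ha, hd, L, hL, m, hm⟩ ⟨a', ha', hd', L', hL', m', hm'⟩
      refine ⟨max a a', le_max_of_le_left ha, ?_, L + L', by positivity, max m m',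
        fun n hn => ?_⟩
      · rcases max_choice a a' with h | h <;> rw [h] <;> assumption
      · have h1 := hm n (le_trans (le_max_left _ _) hn)
        have h2 := hm' n (le_trans (le_max_right _ _) hn)
        have h3 : (coverNum (s ∪ t) n : ℝ) ≤ coverNum s n + coverNum t n := by
          exact_mod_cast coverNum_union s t n
        have h4 : (2 : ℝ) ^ ((n : ℝ) * a) ≤ (2 : ℝ) ^ ((n : ℝ) * max a a') := by
          apply Real.rpow_le_rpow_of_exponent_le (by norm_num)
          gcongr
          exact le_max_left _ _
        have h5 : (2 : ℝ) ^ ((n : ℝ) * a') ≤ (2 : ℝ) ^ ((n : ℝ) * max a a') := by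
          apply Real.rpow_le_rpow_of_exponent_le (by norm_num)
          gcongr
          exact le_max_right _ _
        have h6 := mul_le_mul_of_nonneg_left h4 hL
        have h7 := mul_le_mul_of_nonneg_left h5 hL'
        linarith
    · intro p _
      obtain ⟨a, ha, hd, m, hm⟩ := h0 p
      refine ⟨_, mem_nhdsWithin_of_mem_nhds (Metric.closedBall_mem_nhds p
        (show (0 : ℝ) < (2 : ℝ) ^ (-(m : ℤ)) by positivity)), a, ha, hd, 1, zero_le_one, m,
        fun n hn => ?_⟩
      rw [one_mul]
      exact (hm n hn).le
  obtain ⟨a, ha, hd, L, hL, m, hm⟩ := main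
  refine absurd (ubDim_le (univ : Set X) L a ha ?_) (not_le.2 hd)
  filter_upwards [eventually_ge_atTop m] with n hn
  refine (hm n hn).trans ?_
  have : (0 : ℝ) ≤ n := by positivity
  gcongr
  linarith

end helpers

section family
variable {X : Type*} [MetricSpace X] [CompactSpace X] {Y : Type*} [TopologicalSpace Y]
  [CompactSpace Y]

/-- the basic set -/
def famSet (p : X) (Φ : ℕ → ℝ → Finset X) (M : ℕ → ℕ) (v : ℕ → ℝ) : Set X :=
  {p} ∪ ⋃ k, (Φ (M k) (v k) : Set X)

theorem fam_dim (p : X) (Φ : ℕ → ℝ → Finset X) (M : ℕ → ℕ) (v : ℕ → ℝ) (a : ℝ)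
    (hv0 : ∀ k, 0 ≤ v k) (hv : Tendsto v atTop (nhds a)) (hM0 : M 0 = 0) (hM : StrictMono M)
    (hΦ1 : ∀ k, (Φ (M k) (v k) : Set X) ⊆ Metric.closedBall p ((2 : ℝ) ^ (-(M k : ℤ))))
    (hΦ2 : ∀ k, ∃ n ≥ M k, (2 : ℝ) ^ ((n : ℝ) * v k) ≤
      coverNum (Φ (M k) (v k) : Set X) (n + 1))
    (hΦ3 : ∀ k, ∀ j ≥ M k, (coverNum (Φ (M k) (v k) : Set X) j : ℝ) ≤
      (2 : ℝ) ^ ((j : ℝ) * v k) + 1)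
    (hB : ∀ k, M k + (Φ (M k) (v k)).card ≤ M (k + 1)) :
    ubDim (closure (famSet p Φ M v)) = ENNReal.ofReal a := by
  classical
  apply le_antisymm
  · have ha : 0 ≤ a := ge_of_tendsto' hv hv0
    have key : ∀ b, a < b → ubDim (closure (famSet p Φ M v)) ≤ ENNReal.ofReal b := by
      intro b hb
      refine ubDim_le _ 3 b (by linarith) ?_
      obtain ⟨k0, hk0⟩ := eventually_atTop.1 (hv.eventually_lt_const hb)
      filter_upwards [eventually_ge_atTop (M k0)] with n hn
      have hex : ∃ k, n < M k := ⟨n + 1, lt_of_lt_of_le (Nat.lt_succ_self n) (hM.id_le _)⟩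
      obtain ⟨k, hk1, hk2⟩ : ∃ k, M k ≤ n ∧ n < M (k + 1) := by
        have h1 := Nat.find_spec hex
        have h2 := fun j => Nat.find_min hex (m := j)
        rcases hf : Nat.find hex with _ | k
        · rw [hf, hM0] at h1; omega
        · rw [hf] at h1
          exact ⟨k, not_lt.1 (h2 k (by omega)), h1⟩
      have hkk : k0 ≤ k := by
        have : M k0 < M (k + 1) := lt_of_le_of_lt hn hk2
        have := hM.lt_iff_lt.1 this
        omega
      set G : Finset X := (Finset.range k).biUnion fun j => Φ (M j) (v j)
      have hG : G.card ≤ M k := by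
        refine Finset.card_biUnion_le.trans ?_
        clear hk1 hk2 hkk G
        induction k with
        | zero => simp
        | succ k ih =>
          rw [Finset.sum_range_succ]
          have := hB k
          omega
      have hsub : famSet p Φ M v ⊆ (Metric.closedBall p ((2 : ℝ) ^ (-(n : ℤ))) ∪ (G : Set X)) ∪
          (Φ (M k) (v k) : Set X) := by
        rintro x (hx | hx)
        · rw [mem_singleton_iff.1 hx]
          exact Or.inl (Or.inl (Metric.mem_closedBall_self (by positivity)))
        · obtain ⟨j, hj⟩ := mem_iUnion.1 hx
          rcases lt_trichotomy j k with h | h | h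
          · refine Or.inl (Or.inr ?_)
            exact Finset.mem_coe.2 (Finset.mem_biUnion.2 ⟨j, Finset.mem_range.2 h, hj⟩)
          · subst h; exact Or.inr hj
          · refine Or.inl (Or.inl (Metric.closedBall_subset_closedBall ?_ (hΦ1 j hj)))
            apply zpow_le_zpow_right₀ (by norm_num)
            have : M (k + 1) ≤ M j := hM.monotone h
            omega
      have c1 : coverNum (closure (famSet p Φ M v)) n ≤
          1 + M k + coverNum (Φ (M k) (v k) : Set X) n := by
        refine (coverNum_closure _ n).trans ((coverNum_mono hsub n).trans
          ((coverNum_union _ _ n).trans ?_))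
        gcongr
        refine (coverNum_union _ _ n).trans ?_
        exact add_le_add (coverNum_ball p n) ((coverNum_finset G n).trans hG)
      have c2 : (coverNum (closure (famSet p Φ M v)) n : ℝ) ≤
          1 + M k + coverNum (Φ (M k) (v k) : Set X) n := by exact_mod_cast c1
      have c3 := hΦ3 k n hk1
      have c4 : (2 : ℝ) ^ ((n : ℝ) * v k) ≤ (2 : ℝ) ^ ((n : ℝ) * b) := by
        apply Real.rpow_le_rpow_of_exponent_le (by norm_num)
        have := (hk0 k hkk).le
        gcongr
      have c5 : (M k : ℝ) ≤ n := by exact_mod_cast hk1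
      have c6 : (1 : ℝ) ≤ (2 : ℝ) ^ ((n : ℝ) * b) := by
        apply Real.one_le_rpow (by norm_num)
        have : 0 ≤ b := by linarith
        positivity
      have c7 : (0 : ℝ) ≤ n := by positivity
      nlinarith
    have ht : Tendsto (fun b : ℝ => ENNReal.ofReal b) (nhdsWithin a (Ioi a))
        (nhds (ENNReal.ofReal a)) :=
      ENNReal.tendsto_ofReal (tendsto_id.mono_left nhdsWithin_le_nhds)
    refine ge_of_tendsto ht ?_
    filter_upwards [self_mem_nhdsWithin] with b hb using key b hb
  · refine le_ubDim _ a fun b hb0 hb => ?_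
    rw [frequently_atTop]
    intro N
    obtain ⟨k0, hk0⟩ := eventually_atTop.1 (hv.eventually_const_lt hb)
    set k := max k0 N
    obtain ⟨n, hn, h⟩ := hΦ2 k
    refine ⟨n, ?_, ?_⟩
    · exact le_trans (le_trans (le_max_right k0 N) (hM.id_le k)) hn
    · have h1 : (2 : ℝ) ^ ((n : ℝ) * b) ≤ (2 : ℝ) ^ ((n : ℝ) * v k) := by
        apply Real.rpow_le_rpow_of_exponent_le (by norm_num)
        have := (hk0 k (le_max_left _ _)).le
        gcongr
      refine h1.trans (h.trans ?_)
      have : (Φ (M k) (v k) : Set X) ⊆ closure (famSet p Φ M v) :=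
        fun x hx => subset_closure (Or.inr (mem_iUnion.2 ⟨k, hx⟩))
      exact_mod_cast coverNum_mono this (n + 1)

theorem exists_family [Nonempty X] (g : ℕ → Y → ℝ) (l : Y → ℝ)
    (hg : ∀ k, IsLocallyConstant (g k)) (hg0 : ∀ k y, 0 ≤ g k y)
    (hgd : ∀ k y, g k y = 0 ∨ ENNReal.ofReal (g k y) < ubDim (univ : Set X))
    (hl : ∀ y, Tendsto (fun k => g k y) atTop (nhds (l y))) :
    ∃ 𝒞 : Set (TopologicalSpace.NonemptyCompacts X), IsCompact 𝒞 ∧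
      {e : ℝ≥0∞ | ∃ C ∈ 𝒞, ubDim (C : Set X) = e} = range (fun y => ENNReal.ofReal (l y)) := by
  classical
  obtain ⟨p, hp⟩ := exists_point_s8 (X := X)
  have hblock : ∀ (m : ℕ) (a : ℝ), ∃ F : Finset X,
      (0 ≤ a ∧ (a = 0 ∨ ENNReal.ofReal a < ubDim (univ : Set X))) →
      ((F : Set X) ⊆ Metric.closedBall p ((2 : ℝ) ^ (-(m : ℤ))) ∧
      (∃ n ≥ m, (2 : ℝ) ^ ((n : ℝ) * a) ≤ coverNum (F : Set X) (n + 1)) ∧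
      ∀ j ≥ m, (coverNum (F : Set X) j : ℝ) ≤ (2 : ℝ) ^ ((j : ℝ) * a) + 1) := by
    intro m a
    by_cases h : 0 ≤ a ∧ (a = 0 ∨ ENNReal.ofReal a < ubDim (univ : Set X))
    · obtain ⟨F, hF⟩ := exists_block_s8 p m a h.1 (hp a h.1 h.2 m)
      exact ⟨F, fun _ => hF⟩
    · exact ⟨∅, fun h' => absurd h' h⟩
  choose Φ hΦ using hblock
  have hbd : ∀ k m : ℕ, ∃ B : ℕ, ∀ y, (Φ m (g k y)).card ≤ B := by
    intro k m
    have hfin := (hg k).range_finite.image (fun a => (Φ m a).card)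
    obtain ⟨B, hB⟩ := hfin.bddAbove
    exact ⟨B, fun y => hB ⟨_, ⟨y, rfl⟩, rfl⟩⟩
  choose B hB using hbd
  obtain ⟨M, hM0, hMs⟩ : ∃ M : ℕ → ℕ, M 0 = 0 ∧ ∀ k, M (k + 1) = M k + B k (M k) + 1 :=
    ⟨fun k => Nat.rec 0 (fun k m => m + B k m + 1) k, rfl, fun k => rfl⟩
  have hM : StrictMono M := strictMono_nat_of_lt_succ fun k => by rw [hMs]; omega
  let S : Y → Set X := fun y => famSet p Φ M (fun k => g k y)
  let C : Y → TopologicalSpace.NonemptyCompacts X := fun y =>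
    ⟨⟨closure (S y), isClosed_closure.isCompact⟩, ⟨p, subset_closure (Or.inl rfl)⟩⟩
  have hC : ∀ y, (C y : Set X) = closure (S y) := fun y => rfl
  have hdim : ∀ y, ubDim (C y : Set X) = ENNReal.ofReal (l y) := by
    intro y
    have h := fun k => hΦ (M k) (g k y) ⟨hg0 k y, hgd k y⟩
    refine fam_dim p Φ M (fun k => g k y) (l y) (fun k => hg0 k y) (hl y) hM0 hM
      (fun k => (h k).1) (fun k => (h k).2.1) (fun k => (h k).2.2) fun k => ?_
    have := hB k (M k) y
    rw [hMs]
    omega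
  have hsubs : ∀ (k : ℕ) (y y' : Y), (∀ j < k, g j y = g j y') → ∀ x ∈ S y, ∃ z ∈ S y',
      edist x z ≤ ENNReal.ofReal ((2 : ℝ) ^ (-(M k : ℤ))) := by
    rintro k y y' hyy x (hx | hx)
    · exact ⟨p, Or.inl rfl, by rw [mem_singleton_iff.1 hx]; simp⟩
    · obtain ⟨j, hj⟩ := mem_iUnion.1 hx
      rcases lt_or_ge j k with h | h
      · refine ⟨x, Or.inr (mem_iUnion.2 ⟨j, ?_⟩), by simp⟩
        have := hyy j h
        simp only at hj ⊢
        rwa [← this]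
      · refine ⟨p, Or.inl rfl, ?_⟩
        have h1 := (hΦ (M j) (g j y) ⟨hg0 j y, hgd j y⟩).1 hj
        rw [edist_dist]
        apply ENNReal.ofReal_le_ofReal
        refine (Metric.mem_closedBall.1 h1).trans ?_
        apply zpow_le_zpow_right₀ (by norm_num)
        have : M k ≤ M j := hM.monotone h
        omega
  have hcont : Continuous C := by
    rw [continuous_iff_continuousAt]
    intro y
    refine EMetric.tendsto_nhds.2 fun ε hε => ?_
    have ht : Tendsto (fun k : ℕ => ENNReal.ofReal ((2 : ℝ) ^ (-((M k : ℕ) : ℤ)))) atTop (nhds 0) := by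
      rw [← ENNReal.ofReal_zero]
      apply ENNReal.tendsto_ofReal
      have h1 : Tendsto (fun n : ℕ => ((1 : ℝ) / 2) ^ n) atTop (nhds 0) :=
        tendsto_pow_atTop_nhds_zero_of_lt_one (by norm_num) (by norm_num)
      refine (h1.comp hM.tendsto_atTop).congr fun k => ?_
      simp
    obtain ⟨k, hk⟩ := (ht.eventually_lt_const hε).exists
    have hev : ∀ᶠ y' in nhds y, ∀ j ∈ Finset.range k, g j y' = g j y :=
      (Filter.eventually_all_finset _).2 fun j _ => (hg j).eventually_eq y
    filter_upwards [hev] with y' hy'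
    refine lt_of_le_of_lt ?_ hk
    change Metric.hausdorffEDist (closure (S y')) (closure (S y)) ≤ _
    rw [Metric.hausdorffEDist_closure]
    exact Metric.hausdorffEDist_le_of_mem_edist
      (hsubs k y' y fun j hj => hy' j (Finset.mem_range.2 hj))
      (hsubs k y y' fun j hj => (hy' j (Finset.mem_range.2 hj)).symm)
  refine ⟨range C, isCompact_range hcont, ?_⟩
  ext e
  constructor
  · rintro ⟨_, ⟨y, rfl⟩, rfl⟩
    exact ⟨y, (hdim y).symm⟩
  · rintro ⟨y, rfl⟩
    exact ⟨C y, ⟨y, rfl⟩, hdim y⟩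

end family

/-- truncation to `< k` -/
def cutOne (k : ℕ) : OnePoint ℕ → ℕ := fun z => OnePoint.rec 0 (fun n => if n < k then n else 0) z

def cutLim : OnePoint ℕ → ℕ := fun z => OnePoint.rec 0 (fun n => n) z

theorem cutOne_continuous (k : ℕ) : Continuous (cutOne k) := by
  rw [OnePoint.continuous_iff_from_nat]
  refine tendsto_const_nhds.congr' ?_
  filter_upwards [eventually_ge_atTop k] with n hn
  change 0 = if n < k then n else 0
  rw [if_neg (by omega)]

theorem cutOne_eventually (z : OnePoint ℕ) : ∀ᶠ k in atTop, cutOne k z = cutLim z := by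
  induction z using OnePoint.rec with
  | infty => exact Eventually.of_forall fun _ => rfl
  | coe n =>
    filter_upwards [eventually_gt_atTop n] with k hk
    change (if n < k then n else 0) = n
    rw [if_pos hk]

def cutSeq (k : ℕ) (y : ℕ → OnePoint ℕ) : ℕ → ℕ := fun i => if i < k then cutOne k (y i) else 0

theorem cutSeq_lc (k : ℕ) : IsLocallyConstant (cutSeq k) := by
  have h1 : Continuous (fun (y : ℕ → OnePoint ℕ) (i : Fin k) => cutOne k (y i)) :=
    continuous_pi fun i => (cutOne_continuous k).comp (continuous_apply _)
  have h2 := (IsLocallyConstant.iff_continuous _).2 h1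
  have h3 := h2.comp (fun (w : Fin k → ℕ) (i : ℕ) => if h : i < k then w ⟨i, h⟩ else 0)
  have e : cutSeq k = (fun (w : Fin k → ℕ) (i : ℕ) => if h : i < k then w ⟨i, h⟩ else 0) ∘
      fun (y : ℕ → OnePoint ℕ) (i : Fin k) => cutOne k (y i) := by
    funext y i
    simp only [cutSeq, Function.comp]
    split_ifs <;> rfl
  rw [e]
  exact h3

theorem cutSeq_tendsto (y : ℕ → OnePoint ℕ) :
    Tendsto (fun k => cutSeq k y) atTop (nhds fun i => cutLim (y i)) := by
  rw [tendsto_pi_nhds]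
  intro i
  refine tendsto_const_nhds.congr' ?_
  filter_upwards [cutOne_eventually (y i), eventually_gt_atTop i] with k h1 h2
  simp only [cutSeq, if_pos h2, h1]

theorem statement8 (K : Type*) [MetricSpace K] [CompactSpace K] [Nonempty K]
    (A : Set ℝ) (han : MeasureTheory.AnalyticSet A)
    (hsub : ∀ a ∈ A, 0 ≤ a ∧ ENNReal.ofReal a ≤ ubDim (Set.univ : Set K)) :
    ∃ 𝒞 : Set (TopologicalSpace.NonemptyCompacts K),
      IsCompact 𝒞 ∧
      {e : ℝ≥0∞ | ∃ C ∈ 𝒞, ubDim (C : Set K) = e} = ENNReal.ofReal '' A := by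
  rw [AnalyticSet] at han
  rcases han with rfl | ⟨f, hf, rfl⟩
  · exact ⟨∅, isCompact_empty, by simp⟩
  · have hA : ∀ (k : ℕ) (y : ℕ → OnePoint ℕ),
        max 0 (f (cutSeq k y) - 1 / ((k : ℝ) + 1)) = 0 ∨
        ENNReal.ofReal (max 0 (f (cutSeq k y) - 1 / ((k : ℝ) + 1))) < ubDim (univ : Set K) := by
      intro k y
      have hk : (0 : ℝ) < 1 / ((k : ℝ) + 1) := by positivity
      obtain ⟨h3, h4⟩ := hsub _ ⟨cutSeq k y, rfl⟩
      rcases le_or_gt (f (cutSeq k y) - 1 / ((k : ℝ) + 1)) 0 with h | h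
      · exact Or.inl (max_eq_left h)
      · right
        refine lt_of_lt_of_le ?_ h4
        rw [max_eq_right h.le]
        exact (ENNReal.ofReal_lt_ofReal_iff (by linarith)).2 (by linarith)
    have hT : ∀ y : ℕ → OnePoint ℕ,
        Tendsto (fun k : ℕ => max 0 (f (cutSeq k y) - 1 / ((k : ℝ) + 1))) atTop
          (nhds (f fun i => cutLim (y i))) := by
      intro y
      have h5 : Tendsto (fun k : ℕ => f (cutSeq k y) - 1 / ((k : ℝ) + 1)) atTop
          (nhds ((f fun i => cutLim (y i)) - 0)) :=
        ((hf.tendsto _).comp (cutSeq_tendsto y)).sub tendsto_one_div_add_atTop_nhds_zero_nat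
      rw [sub_zero] at h5
      have h6 := (tendsto_const_nhds (x := (0 : ℝ))).max h5
      rwa [max_eq_right (hsub _ ⟨_, rfl⟩).1] at h6
    obtain ⟨𝒞, h1, h2⟩ := exists_family (X := K) (Y := ℕ → OnePoint ℕ)
      (fun k y => max 0 (f (cutSeq k y) - 1 / ((k : ℝ) + 1))) (fun y => f fun i => cutLim (y i))
      (fun k => (cutSeq_lc k).comp (fun s => max 0 (f s - 1 / ((k : ℝ) + 1))))
      (fun k y => le_max_left _ _) hA hT
    refine ⟨𝒞, h1, h2.trans ?_⟩
    ext e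
    constructor
    · rintro ⟨y, rfl⟩
      exact ⟨_, ⟨_, rfl⟩, rfl⟩
    · rintro ⟨_, ⟨s, rfl⟩, rfl⟩
      exact ⟨fun i => (s i : OnePoint ℕ), rfl⟩
end
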